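/- arXiv:1004.1474 — 2 statements merged into one kernel-verified Lean document; each statement's English description precedes it below -/
import Mathlib

section
/- Every Lie superbialgebra structure on the N=2 superconformal Neveu-Schwarz algebra L̂ (with central element C) is triangular coboundary. -/
noncomputable section
open Finsupp

/-- Sign `(-1)^(a*b)` for parities `a b : ZMod 2`. -/
def sg (a b : ZMod 2) : ℂ := if a * b = 1 then -1 else 1

/-- A (basis-presented) superalgebra datum: a basis `ι`, a parity function and
structure "constants" giving the bracket of two basis elements. -/
structure SuperData where
  ι : Type
  par : ι → ZMod 2
  br : ι → ι → (ι →₀ ℂ)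

namespace SuperData

variable (D : SuperData)

/-- The underlying vector space, with basis `ι`. -/
abbrev V := D.ι →₀ ℂ

/-- The tensor square `V ⊗ V`, modelled on the basis `ι × ι`. -/
abbrev T2 := (D.ι × D.ι) →₀ ℂ

/-- The tensor cube `V ⊗ V ⊗ V`. -/
abbrev T3 := (D.ι × D.ι × D.ι) →₀ ℂ

/-- The `n`-fold tensor power. -/
abbrev Tn (n : ℕ) := ((Fin n → D.ι) →₀ ℂ)

/-- Basis vectors. -/
def e (i : D.ι) : D.V := Finsupp.single i 1

/-- Linear extension of a map defined on the basis. -/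
def lift {α : Type*} {M : Type*} [AddCommGroup M] [Module ℂ M] (g : α → M) :
    (α →₀ ℂ) →ₗ[ℂ] M :=
  Finsupp.linearCombination ℂ g

/-- The bilinear bracket extending `D.br`. -/
def brk : D.V →ₗ[ℂ] D.V →ₗ[ℂ] D.V :=
  lift fun i => lift fun j => D.br i j

/-- Bilinear tensor-product map `V × V → V ⊗ V`. -/
def tens2 : D.V →ₗ[ℂ] D.V →ₗ[ℂ] D.T2 :=
  lift fun i => lift fun j => Finsupp.single (i, j) 1

/-- Trilinear tensor-product map. -/
def tens3 : D.V →ₗ[ℂ] D.V →ₗ[ℂ] D.V →ₗ[ℂ] D.T3 :=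
  lift fun i => lift fun j => lift fun k => Finsupp.single (i, j, k) 1

/-- The super-twist map `τ(x ⊗ y) = (-1)^{|x||y|} y ⊗ x`. -/
def tau : D.T2 →ₗ[ℂ] D.T2 :=
  lift fun p => sg (D.par p.1) (D.par p.2) • Finsupp.single (p.2, p.1) 1

/-- The super-cyclic map `ξ = (1⊗τ)(τ⊗1)` on the tensor cube. -/
def xi : D.T3 →ₗ[ℂ] D.T3 :=
  lift fun p => sg (D.par p.1) (D.par p.2.1 + D.par p.2.2) •
    Finsupp.single (p.2.1, p.2.2, p.1) 1

/-- The adjoint diagonal action of `V` on `V ⊗ V`: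
`x ∗ (a⊗b) = [x,a]⊗b + (-1)^{|x||a|} a⊗[x,b]`. -/
def star2 : D.V →ₗ[ℂ] D.T2 →ₗ[ℂ] D.T2 :=
  lift fun k => lift fun p =>
    D.tens2 (D.br k p.1) (D.e p.2) +
      sg (D.par k) (D.par p.1) • D.tens2 (D.e p.1) (D.br k p.2)

/-- The adjoint diagonal action of `V` on `V ⊗ V ⊗ V`. -/
def star3 : D.V →ₗ[ℂ] D.T3 →ₗ[ℂ] D.T3 :=
  lift fun k => lift fun p =>
    D.tens3 (D.br k p.1) (D.e p.2.1) (D.e p.2.2) +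
      sg (D.par k) (D.par p.1) • D.tens3 (D.e p.1) (D.br k p.2.1) (D.e p.2.2) +
      sg (D.par k) (D.par p.1 + D.par p.2.1) •
        D.tens3 (D.e p.1) (D.e p.2.1) (D.br k p.2.2)

/-- The adjoint diagonal action of `V` on the `n`-fold tensor power, with Koszul signs. -/
def starN (n : ℕ) : D.V →ₗ[ℂ] D.Tn n →ₗ[ℂ] D.Tn n :=
  lift fun k => lift fun f =>
    ∑ i : Fin n, sg (D.par k) (∑ j ∈ Finset.Iio i, D.par (f j)) •
      Finsupp.mapDomain (Function.update f i) (D.br k (f i))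

/-- `c(r) = [r¹²,r¹³] + [r¹²,r²³] + [r¹³,r²³]`, the Yang–Baxter expression. -/
def cybe (r : D.T2) : D.T3 :=
  r.sum fun p a => r.sum fun q b => (a * b) •
    (sg (D.par q.1) (D.par p.2) •
        (D.tens3 (D.br p.1 q.1) (D.e p.2) (D.e q.2) +
          D.tens3 (D.e p.1) (D.e q.1) (D.br p.2 q.2)) +
      D.tens3 (D.e p.1) (D.br p.2 q.1) (D.e q.2))

/-- The image of `1 - τ` in `V ⊗ V`. -/
def ImSkew : Submodule ℂ D.T2 := LinearMap.range (LinearMap.id - D.tau)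

/-- `x` is homogeneous of parity `dp`. -/
def Homog1 (dp : ZMod 2) (x : D.V) : Prop := ∀ i ∈ x.support, D.par i = dp

/-- `t ∈ V ⊗ V` is homogeneous of parity `dp`. -/
def Homog2 (dp : ZMod 2) (t : D.T2) : Prop :=
  ∀ p ∈ t.support, D.par p.1 + D.par p.2 = dp

/-- `t ∈ V ⊗ V` is even. -/
def IsEven2 (t : D.T2) : Prop := D.Homog2 0 t

/-- Super skew-symmetry of the bracket (on homogeneous elements). -/
def SuperSkew : Prop :=
  ∀ (px py : ZMod 2) (x y : D.V), D.Homog1 px x → D.Homog1 py y →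
    D.brk x y = -sg px py • D.brk y x

/-- The graded Jacobi identity
`(-1)^{|x||z|}[x,[y,z]] + (-1)^{|y||x|}[y,[z,x]] + (-1)^{|z||y|}[z,[x,y]] = 0`. -/
def SuperJacobi : Prop :=
  ∀ (px py pz : ZMod 2) (x y z : D.V), D.Homog1 px x → D.Homog1 py y → D.Homog1 pz z →
    sg px pz • D.brk x (D.brk y z) + sg py px • D.brk y (D.brk z x) +
      sg pz py • D.brk z (D.brk x y) = 0

/-- `D` presents a Lie superalgebra. -/
def IsLieSuper : Prop := D.SuperSkew ∧ D.SuperJacobi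

/-- `f : V → V ⊗ V` is a homogeneous derivation of parity `dp`. -/
def IsDer2 (dp : ZMod 2) (f : D.V →ₗ[ℂ] D.T2) : Prop :=
  ∀ i j, f (D.br i j) =
    sg dp (D.par i) • D.star2 (D.e i) (f (D.e j)) -
      sg (D.par j) (dp + D.par i) • D.star2 (D.e j) (f (D.e i))

/-- `f : V → V` is a homogeneous derivation of parity `dp` (adjoint coefficients). -/
def IsDerV (dp : ZMod 2) (f : D.V →ₗ[ℂ] D.V) : Prop :=
  ∀ i j, f (D.br i j) =
    sg dp (D.par i) • D.brk (D.e i) (f (D.e j)) -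
      sg (D.par j) (dp + D.par i) • D.brk (D.e j) (f (D.e i))

/-- `(1 ⊗ Δ)` as a map `V⊗V → V⊗V⊗V`, for `Δ : V → V⊗V`. -/
def oneDelta (Δf : D.V →ₗ[ℂ] D.T2) : D.T2 →ₗ[ℂ] D.T3 :=
  lift fun p => Finsupp.mapDomain (fun q : D.ι × D.ι => (p.1, q.1, q.2)) (Δf (D.e p.2))

/-- `Δf` makes `D` into a Lie superbialgebra: `Δf` respects the `ℤ₂`-grading, has image
in `Im(1-τ)`, satisfies co-Jacobi, and is compatible with the bracket via the
adjoint diagonal action. -/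
def IsSBialg (Δf : D.V →ₗ[ℂ] D.T2) : Prop :=
  (∀ (dp : ZMod 2) (x : D.V), D.Homog1 dp x → D.Homog2 dp (Δf x)) ∧
  (∀ x : D.V, Δf x ∈ D.ImSkew) ∧
  (∀ x : D.V, D.oneDelta Δf (Δf x) + D.xi (D.oneDelta Δf (Δf x)) +
      D.xi (D.xi (D.oneDelta Δf (Δf x))) = 0) ∧
  (∀ i j, Δf (D.br i j) =
    D.star2 (D.e i) (Δf (D.e j)) - sg (D.par i) (D.par j) • D.star2 (D.e j) (Δf (D.e i)))

end SuperData

open SuperData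

/-- Basis of the centerless `N=2` superconformal Neveu–Schwarz algebra:
`L m`, `I m` for `m : ℤ`, and `G s k` denoting `G_{k+1/2}^±` (`s = true` for `+`). -/
inductive NSI : Type
  | L : ℤ → NSI
  | I : ℤ → NSI
  | G : Bool → ℤ → NSI
  deriving DecidableEq

/-- Structure constants of the centerless `N=2` Neveu–Schwarz algebra
(`G s k` stands for `G^±_r` with `r = k + 1/2`). -/
def nsBr : NSI → NSI → (NSI →₀ ℂ)
  | .L m, .L n => ((m : ℂ) - n) • Finsupp.single (.L (m + n)) 1
  | .L m, .I n => (-(n : ℂ)) • Finsupp.single (.I (m + n)) 1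
  | .I m, .L n => (m : ℂ) • Finsupp.single (.I (m + n)) 1
  | .I _, .I _ => 0
  | .L m, .G s k => (((m : ℂ) - 2 * k - 1) / 2) • Finsupp.single (.G s (m + k)) 1
  | .G s k, .L m => (-(((m : ℂ) - 2 * k - 1) / 2)) • Finsupp.single (.G s (m + k)) 1
  | .I m, .G s k => (if s then (1 : ℂ) else -1) • Finsupp.single (.G s (m + k)) 1
  | .G s k, .I m => (if s then (-1 : ℂ) else 1) • Finsupp.single (.G s (m + k)) 1
  | .G true k, .G false l =>
      (2 : ℂ) • Finsupp.single (.L (k + l + 1)) 1 +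
        ((k : ℂ) - l) • Finsupp.single (.I (k + l + 1)) 1
  | .G false k, .G true l =>
      (2 : ℂ) • Finsupp.single (.L (k + l + 1)) 1 +
        ((l : ℂ) - k) • Finsupp.single (.I (k + l + 1)) 1
  | .G true _, .G true _ => 0
  | .G false _, .G false _ => 0

/-- Parity on the Neveu–Schwarz basis. -/
def nsPar : NSI → ZMod 2
  | .G _ _ => 1
  | _ => 0

/-- The centerless `N=2` superconformal Neveu–Schwarz algebra. -/
def NSd : SuperData := ⟨NSI, nsPar, nsBr⟩

/-- Twice the `½ℤ`-degree: `deg L_m = deg I_m = -m`, `deg G_r^± = -r`. -/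
def deg2 : NSI → ℤ
  | .L m => -(2 * m)
  | .I m => -(2 * m)
  | .G _ k => -(2 * k + 1)

namespace SuperData

/-- One-dimensional central extension of `D` determined by a cocycle `cc`;
the new basis element `none` is the central element `C`. -/
def hatData (D : SuperData) (cc : D.ι → D.ι → ℂ) : SuperData where
  ι := Option D.ι
  par := fun i => match i with
    | Option.some i => D.par i
    | Option.none => 0
  br := fun i j => match i, j with
    | Option.some i, Option.some j =>
        Finsupp.mapDomain Option.some (D.br i j) + cc i j • Finsupp.single Option.none 1
    | _, _ => 0

end SuperData

/-- The `2`-cocycle giving the central terms of the full `N=2` Neveu–Schwarz algebra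
(recall `G s k` is `G^±_r` with `r = k + 1/2`, so `(r² - 1/4)/3 = k(k+1)/3`). -/
def nsCC : NSI → NSI → ℂ
  | .L m, .L n => if m + n = 0 then ((m : ℂ) ^ 3 - m) / 12 else 0
  | .I m, .I n => if m + n = 0 then (m : ℂ) / 3 else 0
  | .G true k, .G false l => if k + l + 1 = 0 then (k : ℂ) * (k + 1) / 3 else 0
  | .G false k, .G true l => if k + l + 1 = 0 then (l : ℂ) * (l + 1) / 3 else 0
  | _, _ => 0

/-- The full `N=2` superconformal Neveu–Schwarz algebra, with central element `C`. -/
def NShd : SuperData := SuperData.hatData NSd nsCC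

namespace NSHat

/-- The sign `±1` attached to the charge of `G^±`. -/
def eps (s : Bool) : ℂ := if s then 1 else -1

@[simp] theorem eps_true : eps true = 1 := rfl
@[simp] theorem eps_false : eps false = -1 := rfl

theorem eps_mul_self (s : Bool) : eps s * eps s = 1 := by cases s <;> simp

theorem eps_ne_zero (s : Bool) : eps s ≠ 0 := by cases s <;> simp

/-- The Koszul sign of two basis indices. -/
def sgn : Option NSI → Option NSI → ℂ
  | .some (.G _ _), .some (.G _ _) => -1
  | _, _ => 1

/-- The adjoint action of a basis element, on coefficient functions. -/
def act : Option NSI → (Option NSI → ℂ) → Option NSI → ℂ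
  | .some (.L m), g, .some (.L n) => (2 * m - n) * g (.some (.L (n - m)))
  | .some (.L m), g, .some (.I n) => -(n - m) * g (.some (.I (n - m)))
  | .some (.L m), g, .some (.G s k) => (3 * m - 2 * k - 1) / 2 * g (.some (.G s (k - m)))
  | .some (.L m), g, none => (m ^ 3 - m) / 12 * g (.some (.L (-m)))
  | .some (.I _), _, .some (.L _) => 0
  | .some (.I m), g, .some (.I n) => m * g (.some (.L (n - m)))
  | .some (.I m), g, .some (.G s k) => eps s * g (.some (.G s (k - m)))
  | .some (.I m), g, none => m / 3 * g (.some (.I (-m)))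
  | .some (.G s k), g, .some (.L n) => 2 * g (.some (.G (!s) (n - k - 1)))
  | .some (.G s k), g, .some (.I n) => eps s * (2 * k + 1 - n) * g (.some (.G (!s) (n - k - 1)))
  | .some (.G s k), g, .some (.G s' j) =>
      if s' = s then -((j - 3 * k - 1) / 2) * g (.some (.L (j - k)))
        - eps s * g (.some (.I (j - k)))
      else 0
  | .some (.G s k), g, none => k * (k + 1) / 3 * g (.some (.G (!s) (-k - 1)))
  | none, _, _ => 0

/-- The linear extension of `g` evaluated at the bracket of two basis elements. -/
def brEval (g : Option NSI → ℂ) : Option NSI → Option NSI → ℂ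
  | .some (.L m), .some (.L n) =>
      (m - n) * g (.some (.L (m + n))) + if m + n = 0 then (m ^ 3 - m) / 12 * g none else 0
  | .some (.L m), .some (.I n) => -n * g (.some (.I (m + n)))
  | .some (.I m), .some (.L n) => m * g (.some (.I (m + n)))
  | .some (.I m), .some (.I n) => if m + n = 0 then m / 3 * g none else 0
  | .some (.L m), .some (.G s k) => (m - 2 * k - 1) / 2 * g (.some (.G s (m + k)))
  | .some (.G s k), .some (.L m) => -((m - 2 * k - 1) / 2) * g (.some (.G s (m + k)))
  | .some (.I m), .some (.G s k) => eps s * g (.some (.G s (m + k)))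
  | .some (.G s k), .some (.I m) => -eps s * g (.some (.G s (m + k)))
  | .some (.G s k), .some (.G s' l) =>
      if s' = s then 0 else
        2 * g (.some (.L (k + l + 1))) + eps s * (k - l) * g (.some (.I (k + l + 1))) +
          if k + l + 1 = 0 then k * (k + 1) / 3 * g none else 0
  | _, none => 0
  | none, _ => 0

theorem act_jacobi (f : Option NSI → ℂ) (i j a : Option NSI) :
    brEval (fun k => act k f a) i j =
      act i (act j f) a - sgn i j * act j (act i f) a := by
  rcases i with _ | (m | m | ⟨_ | _, m⟩) <;> rcases j with _ | (n | n | ⟨_ | _, n⟩) <;>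
  rcases a with _ | (k | k | ⟨_ | _, k⟩) <;> simp [act, brEval, sgn] <;> ring_nf

/-- The mode number of a basis index. -/
def mode : Option NSI → ℤ
  | .some (.L m) => m
  | .some (.I m) => m
  | .some (.G _ k) => k
  | .none => 0

/-- Twice the conformal weight (with opposite sign). -/
def wt : Option NSI → ℤ
  | .some (.L m) => 2 * m
  | .some (.I m) => 2 * m
  | .some (.G _ k) => 2 * k + 1
  | .none => 0

/-- The `U(1)` charge. -/
def charge : Option NSI → ℤ
  | .some (.G s _) => if s then 1 else -1
  | _ => 0

theorem act_eq (i a : Option NSI) :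
    (∃ (c : ℂ) (q : Option NSI), ∀ g, act i g a = c * g q) ∨
      ∃ (c₁ c₂ : ℂ) (q₁ q₂ : Option NSI), ∀ g, act i g a = c₁ * g q₁ - c₂ * g q₂ := by
  rcases i with _ | (m | m | ⟨_ | _, m⟩) <;> rcases a with _ | (k | k | ⟨_ | _, k⟩)
  all_goals first
    | exact .inl ⟨_, _, fun g => rfl⟩
    | exact .inr ⟨_, _, _, _, fun g => by simp only [act, if_true]; rfl⟩
    | exact .inl ⟨0, .none, fun g => by simp [act]⟩

theorem act_support {i a : Option NSI} {g : Option NSI → ℂ} (h : act i g a ≠ 0) :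
    ∃ q, g q ≠ 0 ∧ |mode q - mode a| ≤ |mode i| + 1 ∧ wt q + wt i = wt a ∧
      charge q + charge i = charge a := by
  have key (m k l : ℤ) (h₁ : k - l ≤ m ∨ k - l ≤ -m + 1 ∨ k - l ≤ -m)
      (h₂ : -m - 1 ≤ k - l ∨ m ≤ k - l) : |k - l| ≤ |m| + 1 := by
    rcases abs_cases m with h | h <;> rw [abs_le] <;> omega
  rcases i with _ | (m | m | ⟨_ | _, m⟩) <;> rcases a with _ | (k | k | ⟨_ | _, k⟩) <;>
    simp only [act, ne_eq, not_true_eq_false, if_true] at h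
  all_goals first
    | exact ⟨_, right_ne_zero_of_mul h, key _ _ _ (by simp [mode]; try omega)
        (by simp [mode]; try omega), by simp [wt]; try ring, by simp [charge]⟩
    | simp at h; done
    | by_cases h' : g (.some (.L (k - m))) = 0
      · rw [h', mul_zero, zero_sub] at h
        exact ⟨_, right_ne_zero_of_mul (neg_ne_zero.mp h), key _ _ _ (by simp [mode])
          (by simp [mode]), by simp [wt]; try ring, by simp [charge]⟩
      · exact ⟨_, h', key _ _ _ (by simp [mode]) (by simp [mode]), by simp [wt]; try ring,
          by simp [charge]⟩

theorem act_sgn (i j a : Option NSI) (g : Option NSI → ℂ) :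
    act i (fun p => sgn j p * g p) a = sgn j a * sgn j i * act i g a := by
  rcases i with _ | (m | m | ⟨_ | _, m⟩) <;> rcases j with _ | (n | n | ⟨_ | _, n⟩) <;>
  rcases a with _ | (k | k | ⟨_ | _, k⟩) <;> simp [act, sgn]

theorem sgn_comm (i j : Option NSI) : sgn i j = sgn j i := by
  rcases i with _ | (m | m | ⟨s, m⟩) <;> rcases j with _ | (n | n | ⟨t, n⟩) <;> rfl

theorem sgn_mul_self (i j : Option NSI) : sgn i j * sgn i j = 1 := by
  rcases i with _ | (m | m | ⟨s, m⟩) <;> rcases j with _ | (n | n | ⟨t, n⟩) <;> simp [sgn]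

@[simp] theorem sgn_none_right (i : Option NSI) : sgn i .none = 1 := by
  rcases i with _ | (m | m | ⟨s, m⟩) <;> rfl

theorem act_add (i a : Option NSI) (f g : Option NSI → ℂ) :
    act i (fun p => f p + g p) a = act i f a + act i g a := by
  rcases act_eq i a with ⟨c, q, h⟩ | ⟨c₁, c₂, q₁, q₂, h⟩ <;> simp only [h] <;> ring

theorem act_sub (i a : Option NSI) (f g : Option NSI → ℂ) :
    act i (fun p => f p - g p) a = act i f a - act i g a := by
  rcases act_eq i a with ⟨c, q, h⟩ | ⟨c₁, c₂, q₁, q₂, h⟩ <;> simp only [h] <;> ring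

theorem act_mul_left (i a : Option NSI) (c : ℂ) (f : Option NSI → ℂ) :
    act i (fun p => c * f p) a = c * act i f a := by
  rcases act_eq i a with ⟨c, q, h⟩ | ⟨c₁, c₂, q₁, q₂, h⟩ <;> simp only [h] <;> ring

@[simp] theorem act_zero (i a : Option NSI) : act i (fun _ => 0) a = 0 := by
  rcases act_eq i a with ⟨c, q, h⟩ | ⟨c₁, c₂, q₁, q₂, h⟩ <;> simp only [h] <;> ring

theorem act_comm (i j a b : Option NSI) (T : Option NSI → Option NSI → ℂ) :
    act i (fun p => act j (T p) b) a = act j (fun q => act i (fun p => T p q) a) b := by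
  rcases act_eq i a with ⟨c, q, h⟩ | ⟨c₁, c₂, q₁, q₂, h⟩ <;>
  rcases act_eq j b with ⟨d, r, h'⟩ | ⟨d₁, d₂, r₁, r₂, h'⟩ <;> simp only [h, h'] <;> ring

theorem brEval_add (f g : Option NSI → ℂ) (i j : Option NSI) :
    brEval (fun k => f k + g k) i j = brEval f i j + brEval g i j := by
  rcases i with _ | (m | m | ⟨s, m⟩) <;> rcases j with _ | (n | n | ⟨t, n⟩) <;>
    simp only [brEval] <;> (try split_ifs) <;> ring

theorem brEval_mul_left (c : ℂ) (f : Option NSI → ℂ) (i j : Option NSI) :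
    brEval (fun k => c * f k) i j = c * brEval f i j := by
  rcases i with _ | (m | m | ⟨s, m⟩) <;> rcases j with _ | (n | n | ⟨t, n⟩) <;>
    simp only [brEval] <;> (try split_ifs) <;> ring

theorem brEval_sgn (f : Option NSI → ℂ) (i j a : Option NSI) :
    brEval (fun k => sgn k a * f k) i j = sgn i a * sgn j a * brEval f i j := by
  rcases i with _ | (m | m | ⟨_ | _, m⟩) <;> rcases j with _ | (n | n | ⟨_ | _, n⟩) <;>
  rcases a with _ | (k | k | ⟨_ | _, k⟩) <;> simp [brEval, sgn]

/-- The diagonal action on coefficient functions of the tensor square. -/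
def act2 (i : Option NSI) (T : Option NSI → Option NSI → ℂ) (a b : Option NSI) : ℂ :=
  act i (fun p => T p b) a + sgn i a * act i (T a) b

theorem act2_jacobi (T : Option NSI → Option NSI → ℂ) (i j a b : Option NSI) :
    brEval (fun k => act2 k T a b) i j =
      act2 i (act2 j T) a b - sgn i j * act2 j (act2 i T) a b := by
  have h₁ := act_jacobi (fun p => T p b) i j a
  have h₂ := act_jacobi (T a) i j b
  have h₃ (i j : Option NSI) : act2 i (act2 j T) a b =
      act i (fun p => act j (fun r => T r b) p + sgn j p * act j (T p) b) a +
        sgn i a * act i (fun q => act j (fun r => T r q) a + sgn j a * act j (T a) q) b := rfl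
  rw [h₃, h₃]
  simp only [act2, brEval_add, brEval_sgn, act_add, act_mul_left, act_sgn, h₁, h₂]
  rw [act_comm i j a b, act_comm j i a b, sgn_comm j i]
  have := sgn_mul_self i j
  linear_combination (sgn i a * act i (fun q => act j (fun p => T p q) a) b) * this

theorem act2_sub (i a b : Option NSI) (T U : Option NSI → Option NSI → ℂ) :
    act2 i (fun p q => T p q - U p q) a b = act2 i T a b - act2 i U a b := by
  simp only [act2, act_sub]; ring

theorem act2_support {i a b : Option NSI} {T : Option NSI → Option NSI → ℂ}
    (h : act2 i T a b ≠ 0) : ∃ p q, T p q ≠ 0 ∧ |mode p - mode a| ≤ |mode i| + 1 ∧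
      |mode q - mode b| ≤ |mode i| + 1 ∧ wt p + wt q + wt i = wt a + wt b ∧
      charge p + charge q + charge i = charge a + charge b := by
  by_cases h₁ : act i (fun p => T p b) a = 0
  · have h₂ : act i (T a) b ≠ 0 := by
      intro h₂; simp [act2, h₁, h₂] at h
    obtain ⟨q, hq, h3, h4, h5⟩ := act_support h₂
    exact ⟨a, q, hq, by simp; positivity, h3, by omega, by omega⟩
  · obtain ⟨q, hq, h3, h4, h5⟩ := act_support h₁
    exact ⟨q, b, hq, h3, by simp; positivity, by omega, by omega⟩

/-- `T` has finite support, expressed as a bound on the mode numbers. -/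
def Bdd (T : Option NSI → Option NSI → ℂ) : Prop :=
  ∃ N : ℤ, ∀ a b, T a b ≠ 0 → |mode a| ≤ N ∧ |mode b| ≤ N

theorem Bdd.sub {T U : Option NSI → Option NSI → ℂ} (hT : Bdd T) (hU : Bdd U) :
    Bdd (fun a b => T a b - U a b) := by
  obtain ⟨N, hN⟩ := hT
  obtain ⟨M, hM⟩ := hU
  refine ⟨max N M, fun a b h => ?_⟩
  by_cases h₁ : T a b = 0
  · have := hM a b (by intro h₂; simp [h₁, h₂] at h)
    exact ⟨this.1.trans (le_max_right _ _), this.2.trans (le_max_right _ _)⟩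
  · have := hN a b h₁
    exact ⟨this.1.trans (le_max_left _ _), this.2.trans (le_max_left _ _)⟩

theorem Bdd.add {T U : Option NSI → Option NSI → ℂ} (hT : Bdd T) (hU : Bdd U) :
    Bdd (fun a b => T a b + U a b) := by
  have hn : Bdd (fun a b => 0 - U a b) := Bdd.sub ⟨0, by simp⟩ hU
  simpa using hT.sub hn

theorem Bdd.of_shift {T U : Option NSI → Option NSI → ℂ} (hT : Bdd T) (c : ℤ)
    (h : ∀ a b, U a b ≠ 0 → ∃ p q, T p q ≠ 0 ∧ |mode p - mode a| ≤ c ∧ |mode q - mode b| ≤ c) :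
    Bdd U := by
  obtain ⟨N, hN⟩ := hT
  refine ⟨N + c, fun a b hU => ?_⟩
  obtain ⟨p, q, h₁, h₂, h₃⟩ := h a b hU
  obtain ⟨h₄, h₅⟩ := hN p q h₁
  simp only [abs_le] at *
  refine ⟨⟨?_, ?_⟩, ⟨?_, ?_⟩⟩ <;> linarith

theorem Bdd.act2 {T : Option NSI → Option NSI → ℂ} (hT : Bdd T) (i : Option NSI) :
    Bdd (act2 i T) :=
  hT.of_shift (|mode i| + 1) fun _ _ h =>
    let ⟨p, q, h₁, h₂, h₃, _⟩ := act2_support h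
    ⟨p, q, h₁, h₂, h₃⟩

/-- The `1`-cocycle condition with values in the tensor square, on coefficients. -/
def IsCocycle (D : Option NSI → Option NSI → Option NSI → ℂ) : Prop :=
  ∀ i j a b, brEval (fun k => D k a b) i j =
    act2 i (D j) a b - sgn i j * act2 j (D i) a b

/-- Subtraction of the inner cocycle attached to `R`. -/
def gauge (D : Option NSI → Option NSI → Option NSI → ℂ) (R : Option NSI → Option NSI → ℂ) :
    Option NSI → Option NSI → Option NSI → ℂ :=
  fun i a b => D i a b - act2 i R a b

theorem IsCocycle.gauge {D : Option NSI → Option NSI → Option NSI → ℂ} (hD : IsCocycle D)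
    (R : Option NSI → Option NSI → ℂ) : IsCocycle (gauge D R) := by
  intro i j a b
  have h₁ := hD i j a b
  have h₂ := act2_jacobi R i j a b
  have h₃ : brEval (fun k => NSHat.gauge D R k a b) i j =
      brEval (fun k => D k a b) i j - brEval (fun k => NSHat.act2 k R a b) i j := by
    have := brEval_add (fun k => D k a b) (fun k => -1 * NSHat.act2 k R a b) i j
    rw [brEval_mul_left] at this
    simp only [NSHat.gauge, sub_eq_add_neg]
    simpa using this
  rw [h₃, h₁, h₂]
  unfold NSHat.gauge
  rw [act2_sub, act2_sub]
  ring

theorem act_far {g : Option NSI → ℂ} {N : ℤ} (h : ∀ i a, N < |mode a| → act i g a = 0)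
    (p : NSI) : g (.some p) = 0 := by
  have hN : N ≤ |N| := le_abs_self N
  have hfar (n k : ℤ) (hk : |n| + |N| < k) : N < |n + k| := by
    rcases abs_cases n with h | h <;> rcases abs_cases (n + k) with h' | h' <;> omega
  have hL (n : ℤ) : g (.some (.L n)) = 0 := by
    have h₁ := h (.some (.L (|n| + |N| + 1))) (.some (.L (n + (|n| + |N| + 1))))
      (hfar _ _ (by omega))
    simp only [act, add_sub_cancel_right, mul_eq_zero] at h₁
    refine h₁.resolve_left fun h₂ => ?_
    have h₃ : 2 * (|n| + |N| + 1) - (n + (|n| + |N| + 1)) = 0 := by exact_mod_cast h₂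
    have := le_abs_self n
    have := abs_nonneg N
    omega
  rcases p with n | n | ⟨s, k⟩
  · exact hL n
  · by_cases hn : n = 0
    · subst hn
      have h₁ := h (.some (.G true (|N| + 1))) (.some (.G true (0 + (|N| + 1))))
        (hfar _ _ (by simp))
      simpa [act, hL] using h₁
    · have h₁ := h (.some (.L (|n| + |N| + 1))) (.some (.I (n + (|n| + |N| + 1))))
        (hfar _ _ (by omega))
      simp only [act, add_sub_cancel_right, mul_eq_zero] at h₁
      refine h₁.resolve_left fun h₂ => hn ?_
      have h₃ : -((n + (|n| + |N| + 1)) - (|n| + |N| + 1)) = 0 := by exact_mod_cast h₂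
      omega
  · have h₁ := h (.some (.L (2 * |k| + |N| + 2))) (.some (.G s (k + (2 * |k| + |N| + 2))))
      (hfar _ _ (by have := abs_nonneg k; omega))
    simp only [act, add_sub_cancel_right, mul_eq_zero] at h₁
    refine h₁.resolve_left fun h₂ => ?_
    have h₃ : 3 * (2 * |k| + |N| + 2) - 2 * (k + (2 * |k| + |N| + 2)) - 1 = 0 := by
      have h₄ := (div_eq_zero_iff.mp h₂).resolve_right two_ne_zero
      exact_mod_cast h₄
    have := le_abs_self k
    have := abs_nonneg N
    omega

theorem invariant_eq_zero {T : Option NSI → Option NSI → ℂ} (hT : Bdd T)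
    (h : ∀ i a b, act2 i T a b = 0) (a b : Option NSI) (hab : a ≠ .none ∨ b ≠ .none) :
    T a b = 0 := by
  obtain ⟨N, hN⟩ := hT
  have h₁ (p : NSI) (b : Option NSI) : T (.some p) b = 0 := by
    refine act_far (g := fun p => T p b) (N := N) (fun i a ha => ?_) p
    have h₂ : T a = fun _ => 0 := by
      funext c
      by_contra h₃
      exact absurd (hN a c h₃).1 (not_le.mpr ha)
    have := h i a b
    rwa [act2, h₂, act_zero, mul_zero, add_zero] at this
  have h₂ (a : Option NSI) (p : NSI) : T a (.some p) = 0 := by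
    refine act_far (g := T a) (N := N) (fun i b hb => ?_) p
    have h₂ : (fun c => T c b) = fun _ => 0 := by
      funext c
      by_contra h₃
      exact absurd (hN c b h₃).2 (not_le.mpr hb)
    have := h i a b
    rw [act2, h₂, act_zero, zero_add] at this
    rcases mul_eq_zero.mp this with h₃ | h₃
    · have := sgn_mul_self i a
      simp [h₃] at this
    · exact h₃
  rcases a with _ | p
  · rcases b with _ | p
    · simp at hab
    · exact h₂ _ p
  · exact h₁ p b

/-- A finitely supported cocycle that preserves weight and charge. -/
structure Good (D : Option NSI → Option NSI → Option NSI → ℂ) : Prop where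
  coc : IsCocycle D
  bdd : ∀ i, Bdd (D i)
  hom : ∀ i a b, D i a b ≠ 0 → wt a + wt b = wt i ∧ charge a + charge b = charge i

/-- `D` is the inner cocycle of some finitely supported tensor. -/
def Inner (D : Option NSI → Option NSI → Option NSI → ℂ) : Prop :=
  ∃ R, Bdd R ∧ ∀ i a b, D i a b = act2 i R a b

theorem act2_add (i a b : Option NSI) (T U : Option NSI → Option NSI → ℂ) :
    act2 i (fun p q => T p q + U p q) a b = act2 i T a b + act2 i U a b := by
  simp only [act2, act_add]; ring

theorem Inner.of_gauge {D : Option NSI → Option NSI → Option NSI → ℂ}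
    {R : Option NSI → Option NSI → ℂ} (hR : Bdd R) (h : Inner (gauge D R)) : Inner D := by
  obtain ⟨S, hS, h⟩ := h
  refine ⟨_, hR.add hS, fun i a b => ?_⟩
  rw [act2_add, ← h, gauge]
  ring

theorem bdd_gauge {D : Option NSI → Option NSI → Option NSI → ℂ}
    {R : Option NSI → Option NSI → ℂ} (hD : ∀ i, Bdd (D i)) (hR : Bdd R) (i : Option NSI) :
    Bdd (gauge D R i) :=
  (hD i).sub (hR.act2 i)

theorem Good.gauge {D : Option NSI → Option NSI → Option NSI → ℂ}
    {R : Option NSI → Option NSI → ℂ} (hD : Good D) (hR : Bdd R)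
    (h : ∀ a b, R a b ≠ 0 → wt a + wt b = 0 ∧ charge a + charge b = 0) : Good (gauge D R) where
  coc := hD.coc.gauge R
  bdd := bdd_gauge hD.bdd hR
  hom i a b hi := by
    by_cases h₁ : D i a b = 0
    · have h₂ : act2 i R a b ≠ 0 := by
        intro h₂; simp [NSHat.gauge, h₁, h₂] at hi
      obtain ⟨p, q, h₃, -, -, h₄, h₅⟩ := act2_support h₂
      have := h p q h₃
      omega
    · exact hD.hom i a b h₁

theorem act_L_zero (g : Option NSI → ℂ) (a : Option NSI) :
    act (.some (.L 0)) g a = -(wt a : ℂ) / 2 * g a := by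
  rcases a with _ | (k | k | ⟨s, k⟩) <;> simp [act, wt] <;> ring_nf <;> simp

theorem act_I_zero (g : Option NSI → ℂ) (a : Option NSI) :
    act (.some (.I 0)) g a = charge a * g a := by
  rcases a with _ | (k | k | ⟨_ | _, k⟩) <;> simp [act, charge]

theorem brEval_L_zero (g : Option NSI → ℂ) (a : Option NSI) :
    brEval g (.some (.L 0)) a = -(wt a : ℂ) / 2 * g a := by
  rcases a with _ | (k | k | ⟨s, k⟩) <;> simp [brEval, wt] <;> ring_nf <;> simp

theorem brEval_I_zero (g : Option NSI → ℂ) (a : Option NSI) :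
    brEval g (.some (.I 0)) a = charge a * g a := by
  rcases a with _ | (k | k | ⟨_ | _, k⟩) <;> simp [brEval, charge]

theorem act2_L_zero (T : Option NSI → Option NSI → ℂ) (a b : Option NSI) :
    act2 (.some (.L 0)) T a b = -((wt a + wt b : ℤ) : ℂ) / 2 * T a b := by
  rw [act2, act_L_zero, act_L_zero, show sgn (.some (.L 0)) a = 1 from rfl]
  push_cast; ring

theorem act2_I_zero (T : Option NSI → Option NSI → ℂ) (a b : Option NSI) :
    act2 (.some (.I 0)) T a b = ((charge a + charge b : ℤ) : ℂ) * T a b := by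
  rw [act2, act_I_zero, act_I_zero, show sgn (.some (.I 0)) a = 1 from rfl]
  push_cast; ring

theorem exists_good {D : Option NSI → Option NSI → Option NSI → ℂ} (hD : IsCocycle D)
    (hb : ∀ i, Bdd (D i)) : ∃ R, Bdd R ∧ Good (gauge D R) := by
  let W (n c : ℤ) : ℂ := -(n : ℂ) / 2 + Complex.I * c
  have hW (n c : ℤ) (h : W n c = 0) : n = 0 ∧ c = 0 := by
    have h₁ := congrArg Complex.re h
    have h₂ := congrArg Complex.im h
    simp [W] at h₁ h₂
    exact ⟨h₁, h₂⟩
  let H (E : Option NSI → Option NSI → Option NSI → ℂ) (a b : Option NSI) : ℂ :=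
    E (.some (.L 0)) a b + Complex.I * E (.some (.I 0)) a b
  let R (a b : Option NSI) : ℂ := H D a b / W (wt a + wt b) (charge a + charge b)
  have hR : Bdd R := by
    obtain ⟨N, hN⟩ := hb (.some (.L 0))
    obtain ⟨M, hM⟩ := hb (.some (.I 0))
    refine ⟨max N M, fun a b h => ?_⟩
    by_cases h₁ : D (.some (.L 0)) a b = 0
    · have := hM a b (by intro h₂; simp [R, H, h₁, h₂] at h)
      exact ⟨this.1.trans (le_max_right _ _), this.2.trans (le_max_right _ _)⟩
    · have := hN a b h₁
      exact ⟨this.1.trans (le_max_left _ _), this.2.trans (le_max_left _ _)⟩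
  refine ⟨R, hR, hD.gauge R, bdd_gauge hb hR, fun i a b hi => ?_⟩
  have hH (a b : Option NSI) (h : H (gauge D R) a b ≠ 0) :
      wt a + wt b = 0 ∧ charge a + charge b = 0 := by
    by_contra h₁
    apply h
    have h₂ : W (wt a + wt b) (charge a + charge b) ≠ 0 := fun h₂ => h₁ (hW _ _ h₂)
    have h₃ : R a b * W (wt a + wt b) (charge a + charge b) = H D a b := div_mul_cancel₀ _ h₂
    simp only [H, W, gauge, act2_L_zero, act2_I_zero] at h₃ ⊢
    linear_combination -h₃
  have hs (j : Option NSI) : sgn (.some (.L 0)) j = 1 ∧ sgn (.some (.I 0)) j = 1 := ⟨rfl, rfl⟩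
  have h₁ := hD.gauge R (.some (.L 0)) i a b
  have h₂ := hD.gauge R (.some (.I 0)) i a b
  rw [brEval_L_zero, act2_L_zero, (hs _).1] at h₁
  rw [brEval_I_zero, act2_I_zero, (hs _).2] at h₂
  have h₃ : W (wt a + wt b - wt i) (charge a + charge b - charge i) * gauge D R i a b =
      act2 i (H (gauge D R)) a b := by
    have : act2 i (H (gauge D R)) a b = act2 i (gauge D R (.some (.L 0))) a b +
        Complex.I * act2 i (gauge D R (.some (.I 0))) a b := by
      have h₄ := act2_add i a b (gauge D R (.some (.L 0)))
        (fun a b => Complex.I * gauge D R (.some (.I 0)) a b)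
      rw [show H (gauge D R) = _ from rfl, h₄]
      simp only [act2, act_mul_left]
      ring
    rw [this]
    simp only [W]
    push_cast at h₁ h₂ ⊢
    linear_combination -h₁ - Complex.I * h₂
  by_cases h₄ : act2 i (H (gauge D R)) a b = 0
  · rw [h₄] at h₃
    have := hW _ _ ((mul_eq_zero.mp h₃).resolve_right hi)
    omega
  · obtain ⟨p, q, h₅, -, -, h₆, h₇⟩ := act2_support h₄
    have := hH p q h₅
    omega

theorem brEval_none_right (g : Option NSI → ℂ) (i : Option NSI) : brEval g i .none = 0 := by
  rcases i with _ | (m | m | ⟨s, m⟩) <;> rfl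

theorem IsCocycle.none_eq_zero {D : Option NSI → Option NSI → Option NSI → ℂ} (hD : IsCocycle D)
    (hb : Bdd (D .none)) (a b : Option NSI) (hab : a ≠ .none ∨ b ≠ .none) :
    D .none a b = 0 := by
  refine invariant_eq_zero hb (fun i a b => ?_) a b hab
  have h := hD i .none a b
  rw [brEval_none_right, sgn_none_right] at h
  simpa [act2, act] using h.symm

local notation "𝓛" m:max => Option.some (NSI.L m)
local notation "𝓘" m:max => Option.some (NSI.I m)
local notation "𝓖" s:max k:max => Option.some (NSI.G s k)

/-- A function on `ℤ` with finite support. -/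
def FinZ (f : ℤ → ℂ) : Prop := ∃ N : ℤ, ∀ k, N < |k| → f k = 0

theorem FinZ.add {f g : ℤ → ℂ} (hf : FinZ f) (hg : FinZ g) : FinZ (fun k => f k + g k) := by
  obtain ⟨N, hN⟩ := hf
  obtain ⟨M, hM⟩ := hg
  refine ⟨max N M, fun k hk => ?_⟩
  rw [max_lt_iff] at hk
  simp [hN k hk.1, hM k hk.2]

theorem FinZ.const_mul {f : ℤ → ℂ} (hf : FinZ f) (c : ℂ) : FinZ (fun k => c * f k) := by
  obtain ⟨N, hN⟩ := hf
  exact ⟨N, fun k hk => by simp [hN k hk]⟩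

theorem FinZ.sub {f g : ℤ → ℂ} (hf : FinZ f) (hg : FinZ g) : FinZ (fun k => f k - g k) := by
  have := hf.add (hg.const_mul (-1))
  simpa [sub_eq_add_neg] using this

theorem Bdd.finZ {T : Option NSI → Option NSI → ℂ} (hT : Bdd T) (u v : ℤ → Option NSI) (c : ℤ)
    (hu : ∀ k, mode (u k) = k + c ∨ mode (u k) = c - k) : FinZ (fun k => T (u k) (v k)) := by
  obtain ⟨N, hN⟩ := hT
  refine ⟨N + |c|, fun k hk => ?_⟩
  by_contra h
  have h₁ := (hN _ _ h).1
  rcases hu k with h₂ | h₂ <;> rw [h₂] at h₁ <;> rw [abs_le] at h₁ <;>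
    rcases abs_cases c with h₃ | h₃ <;> rcases abs_cases k with h₄ | h₄ <;> omega

theorem FinZ.eq_zero_right {f : ℤ → ℂ} (hf : FinZ f) (k₀ : ℤ)
    (h : ∀ k, k₀ < k → f k = f (k - 1)) (k : ℤ) (hk : k₀ ≤ k) : f k = 0 := by
  obtain ⟨N, hN⟩ := hf
  have h₁ (n : ℕ) : f (k + n) = f k := by
    induction n with
    | zero => simp
    | succ n ih =>
      rw [h _ (by push_cast; omega), ← ih]
      congr 1; push_cast; ring
  rw [← h₁ (|N| + |k| + 1).toNat]
  apply hN
  rcases abs_cases N with h₃ | h₃ <;> rcases abs_cases k with h₄ | h₄ <;>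
    rw [lt_abs] <;> omega

theorem FinZ.eq_zero_left {f : ℤ → ℂ} (hf : FinZ f) (k₀ : ℤ)
    (h : ∀ k, k ≤ k₀ → f k = f (k - 1)) (k : ℤ) (hk : k ≤ k₀) : f k = 0 := by
  obtain ⟨N, hN⟩ := hf
  have h₁ (n : ℕ) : f (k - n) = f k := by
    induction n with
    | zero => simp
    | succ n ih =>
      rw [← ih, h (k - n) (by omega)]
      congr 1; push_cast; ring
  rw [← h₁ (|N| + |k| + 1).toNat]
  apply hN
  rcases abs_cases N with h₃ | h₃ <;> rcases abs_cases k with h₄ | h₄ <;>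
    rw [lt_abs] <;> omega

theorem FinZ.eq_zero {f : ℤ → ℂ} (hf : FinZ f) (h : ∀ k, f k = f (k - 1)) (k : ℤ) : f k = 0 :=
  hf.eq_zero_right k (fun k _ => h k) k le_rfl

theorem FinZ.exists_primitive {f : ℤ → ℂ} (hf : FinZ f) :
    ∃ (z : ℤ → ℂ) (c : ℂ), FinZ z ∧ ∀ k, f k = z (k - 1) - z k + if k = 0 then c else 0 := by
  obtain ⟨N, hN⟩ := hf
  let S (k : ℤ) : ℂ := ∑ j ∈ Finset.Icc (-|N|) |N|, if j ≤ k then f j else 0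
  let c : ℂ := ∑ j ∈ Finset.Icc (-|N|) |N|, f j
  have hS (k : ℤ) : S k = S (k - 1) + f k := by
    have h₁ : f k = ∑ j ∈ Finset.Icc (-|N|) |N|, if j = k then f j else 0 := by
      rw [Finset.sum_ite_eq']
      split_ifs with h
      · rfl
      · rw [Finset.mem_Icc, ← abs_le, not_le] at h
        exact hN k ((le_abs_self N).trans_lt h)
    simp only [S]
    conv_rhs => rw [h₁]
    rw [← Finset.sum_add_distrib]
    refine Finset.sum_congr rfl fun j _ => ?_
    rcases lt_trichotomy j k with h | h | h
    · simp [h.le, h.ne, show j ≤ k - 1 by omega]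
    · simp [h]
    · simp [h.not_ge, h.ne', show ¬ j ≤ k - 1 by omega]
  refine ⟨fun k => (if k < 0 then 0 else c) - S k, c, ⟨|N|, fun k hk => ?_⟩, fun k => ?_⟩
  · rcases lt_abs.mp hk with h | h
    · have : S k = c := Finset.sum_congr rfl fun j hj => by
        rw [Finset.mem_Icc] at hj
        rw [if_pos (by omega)]
      have h₀ := abs_nonneg N
      simp [this, show ¬ k < 0 by omega]
    · have : S k = 0 := Finset.sum_eq_zero fun j hj => by
        rw [Finset.mem_Icc] at hj
        rw [if_neg (by omega)]
      have h₀ := abs_nonneg N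
      simp [this, show k < 0 by omega]
  · have := hS k
    rcases lt_trichotomy k 0 with h | h | h
    · simp [h, h.ne, show k - 1 < 0 by omega, this]
    · subst h; simp [this]; ring
    · simp [h.ne', h.not_gt, show ¬ k - 1 < 0 by omega, this]

theorem Good.eq_zero_of_wt {D : Option NSI → Option NSI → Option NSI → ℂ} (hD : Good D)
    {i a b : Option NSI} (h : wt a + wt b ≠ wt i) : D i a b = 0 := by
  by_contra h₁
  exact h (hD.hom i a b h₁).1

theorem Good.eq_zero_of_charge {D : Option NSI → Option NSI → Option NSI → ℂ} (hD : Good D)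
    {i a b : Option NSI} (h : charge a + charge b ≠ charge i) : D i a b = 0 := by
  by_contra h₁
  exact h (hD.hom i a b h₁).2

theorem Good.none_eq_zero {D : Option NSI → Option NSI → Option NSI → ℂ} (hD : Good D)
    {a b : Option NSI} (h : a ≠ .none ∨ b ≠ .none) : D .none a b = 0 :=
  hD.coc.none_eq_zero (hD.bdd _) a b h

/-- The bosonic generators have no coefficients in the fermionic square. -/
def GGZero (D : Option NSI → Option NSI → Option NSI → ℂ) : Prop :=
  ∀ m s k s' l, D (𝓘 m) (𝓖 s k) (𝓖 s' l) = 0 ∧ D (𝓛 m) (𝓖 s k) (𝓖 s' l) = 0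

theorem Good.ggZero_of_delta {D : Option NSI → Option NSI → Option NSI → ℂ} (hD : Good D)
    (c : Bool → ℂ)
    (hc : ∀ s k, D (𝓘 1) (𝓖 s k) (𝓖 (!s) (-k)) = if k = 0 then c s else 0) : GGZero D := by
  have heps (s : Bool) : eps (!s) = -eps s := by cases s <;> simp
  have h2 (s : Bool) (k : ℤ) : D (𝓘 2) (𝓖 s k) (𝓖 (!s) (1 - k)) =
      D (𝓘 1) (𝓖 s k) (𝓖 (!s) (-k)) + D (𝓘 1) (𝓖 s (k - 1)) (𝓖 (!s) (-(k - 1))) := by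
    have hf : FinZ (fun k => D (𝓘 2) (𝓖 s k) (𝓖 (!s) (1 - k)) -
        (D (𝓘 1) (𝓖 s k) (𝓖 (!s) (-k)) + D (𝓘 1) (𝓖 s (k - 1)) (𝓖 (!s) (-(k - 1))))) := by
      refine FinZ.sub ?_ (FinZ.add ?_ ?_)
      · exact (hD.bdd _).finZ _ _ 0 fun k => by simp [mode]
      · exact (hD.bdd _).finZ _ _ 0 fun k => by simp [mode]
      · exact (hD.bdd _).finZ _ _ (-1) fun k => by simp [mode]; omega
    refine sub_eq_zero.mp (hf.eq_zero (fun k => ?_) k)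
    have h := hD.coc (𝓘 2) (𝓘 1) (𝓖 s k) (𝓖 (!s) (2 - k))
    simp only [brEval, act2, act, sgn, heps] at h
    refine mul_left_cancel₀ (eps_ne_zero s) ?_
    norm_num at h
    ring_nf at h ⊢
    linear_combination -h
  have hL (s : Bool) (k : ℤ) :
      eps s * (D (𝓛 1) (𝓖 s (k - 1)) (𝓖 (!s) (-(k - 1))) - D (𝓛 1) (𝓖 s k) (𝓖 (!s) (-k))) =
        (if k = 0 then c s else 0) + if k = 1 then c s else 0 := by
    have h := hD.coc (𝓛 1) (𝓘 1) (𝓖 s k) (𝓖 (!s) (1 - k))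
    simp only [brEval, act2, act, sgn, heps] at h
    have h₁ := h2 s k
    rw [hc, hc] at h₁
    have h₂ := hc s (k - 1)
    have h₃ := hc s k
    norm_num at h
    ring_nf at h h₁ h₂ h₃ ⊢
    rw [h₁, h₂, h₃] at h
    have h₄ : -1 + k = 0 ↔ k = 1 := by omega
    simp only [h₄] at h
    by_cases hk : k = 0
    · subst hk; simp at h ⊢; linear_combination h
    · by_cases hk' : k = 1
      · subst hk'; simp at h ⊢; linear_combination h
      · simp [hk, hk'] at h ⊢; linear_combination h
  have hc0 (s : Bool) : c s = 0 := by
    have hf : FinZ (fun k => D (𝓛 1) (𝓖 s k) (𝓖 (!s) (-k))) :=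
      (hD.bdd _).finZ _ _ 0 fun k => by simp [mode]
    have h₁ := hf.eq_zero_right 1 (fun k hk => by
      have := hL s k
      rw [if_neg (by omega), if_neg (by omega), add_zero] at this
      exact (sub_eq_zero.mp ((mul_eq_zero.mp this).resolve_left (eps_ne_zero s))).symm) 1 le_rfl
    have h₂ := hf.eq_zero_left (-1) (fun k hk => by
      have := hL s k
      rw [if_neg (by omega), if_neg (by omega), add_zero] at this
      exact (sub_eq_zero.mp ((mul_eq_zero.mp this).resolve_left (eps_ne_zero s))).symm) (-1) le_rfl
    have h₃ := hL s 0
    have h₄ := hL s 1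
    simp at h₁ h₂ h₃ h₄
    rw [h₁] at h₄
    rw [h₂] at h₃
    linear_combination (-h₃ - h₄) / 2
  have hI1 (s s' : Bool) (k l : ℤ) : D (𝓘 1) (𝓖 s k) (𝓖 s' l) = 0 := by
    by_cases hs : s' = !s
    · by_cases hl : l = -k
      · rw [hs, hl, hc, hc0, ite_self]
      · exact hD.eq_zero_of_wt (by simp [wt]; omega)
    · exact hD.eq_zero_of_charge (by cases s <;> cases s' <;> simp_all [charge])
  have hinv (i : Option NSI) (m : ℤ) (hwt : wt i = 2 * m) (hch : charge i = 0)
      (h : ∀ s k l, act2 (𝓘 1) (D i) (𝓖 s k) (𝓖 (!s) l) = 0) (s s' : Bool) (k l : ℤ) :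
      D i (𝓖 s k) (𝓖 s' l) = 0 := by
    by_cases hs : s' = !s
    · by_cases hl : l = m - 1 - k
      · have hf : FinZ (fun k => D i (𝓖 s k) (𝓖 (!s) (m - 1 - k))) :=
          (hD.bdd _).finZ _ _ 0 fun k => by simp [mode]
        rw [hs, hl]
        refine hf.eq_zero (fun k => mul_left_cancel₀ (eps_ne_zero s) ?_) k
        have := h s k (m - k)
        simp only [act2, act, sgn, heps] at this
        ring_nf at this ⊢
        linear_combination -this
      · exact hD.eq_zero_of_wt (by rw [hwt]; simp only [wt]; omega)
    · exact hD.eq_zero_of_charge (by cases s <;> cases s' <;> simp_all [charge])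
  have hIm (m : ℤ) (s s' : Bool) (k l : ℤ) : D (𝓘 m) (𝓖 s k) (𝓖 s' l) = 0 := by
    refine hinv _ m rfl rfl (fun s k l => ?_) s s' k l
    have h := hD.coc (𝓘 m) (𝓘 1) (𝓖 s k) (𝓖 (!s) l)
    rw [show act2 (𝓘 m) (D (𝓘 1)) (𝓖 s k) (𝓖 (!s) l) = 0 by simp [act2, act, hI1]] at h
    simpa [brEval, hD.none_eq_zero, sgn] using h
  refine fun m s k s' l => ⟨hIm m s s' k l, ?_⟩
  refine hinv _ m rfl rfl (fun s k l => ?_) s s' k l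
  have h := hD.coc (𝓛 m) (𝓘 1) (𝓖 s k) (𝓖 (!s) l)
  rw [show act2 (𝓛 m) (D (𝓘 1)) (𝓖 s k) (𝓖 (!s) l) = 0 by simp [act2, act, hI1]] at h
  simpa [brEval, hIm, sgn] using h

theorem Good.exists_ggZero {D : Option NSI → Option NSI → Option NSI → ℂ} (hD : Good D) :
    ∃ R, Bdd R ∧ Good (NSHat.gauge D R) ∧ GGZero (NSHat.gauge D R) := by
  have h₁ (s : Bool) : FinZ (fun k => eps s * D (𝓘 1) (𝓖 s k) (𝓖 (!s) (-k))) :=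
    ((hD.bdd _).finZ _ _ 0 fun k => by simp [mode]).const_mul _
  choose z c hz hzc using fun s => (h₁ s).exists_primitive
  let R : Option NSI → Option NSI → ℂ
    | 𝓖 s k, 𝓖 s' l => if s' = (!s) ∧ l = -k - 1 then z s k else 0
    | _, _ => 0
  have hR : Bdd R := by
    choose N hN using hz
    refine ⟨|N true| + |N false| + 1, fun a b hab => ?_⟩
    rcases a with _ | (m | m | ⟨s, m⟩) <;> rcases b with _ | (n | n | ⟨s', n⟩) <;>
      simp only [R, ne_eq, not_true_eq_false, ite_eq_right_iff, Classical.not_imp] at hab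
    have h₂ : |m| ≤ N s := by
      by_contra h₂
      exact hab.2 (hN s m (not_le.mp h₂))
    have h₃ : N s ≤ |N true| + |N false| := by
      have := le_abs_self (N s)
      have := abs_nonneg (N true)
      have := abs_nonneg (N false)
      cases s <;> omega
    simp only [mode, hab.1.2]
    rw [abs_le] at h₂ ⊢
    rw [abs_le]
    omega
  have hG : Good (NSHat.gauge D R) := by
    refine hD.gauge hR fun a b hab => ?_
    rcases a with _ | (m | m | ⟨s, m⟩) <;> rcases b with _ | (n | n | ⟨s', n⟩) <;>
      simp only [R, ne_eq, not_true_eq_false, ite_eq_right_iff, Classical.not_imp] at hab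
    obtain ⟨⟨rfl, rfl⟩, -⟩ := hab
    cases s <;> simp [wt, charge] <;> ring
  refine ⟨R, hR, hG, hG.ggZero_of_delta (fun s => eps s * c s) fun s k => ?_⟩
  have h₂ := hzc s k
  have hs := eps_mul_self s
  have heps : eps (!s) = -eps s := by cases s <;> simp
  simp only [NSHat.gauge, act2, act, sgn, R, heps]
  rw [if_pos ⟨trivial, by omega⟩, if_pos ⟨trivial, trivial⟩]
  split_ifs at h₂ ⊢ <;>
  linear_combination eps s * h₂ - D (𝓘 1) (𝓖 s k) (𝓖 (!s) (-k)) * hs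

theorem Good.I_LL {D : Option NSI → Option NSI → Option NSI → ℂ} (hD : Good D) (m x y : ℤ) :
    D (𝓘 m) (𝓛 x) (𝓛 y) = 0 := by
  have hl (m x y : ℤ) : m * D (𝓘 1) (𝓛 (x - m)) (𝓛 y) = D (𝓘 m) (𝓛 (x - 1)) (𝓛 y) := by
    have h := hD.coc (𝓘 m) (𝓘 1) (𝓘 x) (𝓛 y)
    simp [brEval, act2, act, sgn, hD.none_eq_zero] at h
    linear_combination -h
  have hr (m x y : ℤ) : m * D (𝓘 1) (𝓛 x) (𝓛 (y - m)) = D (𝓘 m) (𝓛 x) (𝓛 (y - 1)) := by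
    have h := hD.coc (𝓘 m) (𝓘 1) (𝓛 x) (𝓘 y)
    simp [brEval, act2, act, sgn, hD.none_eq_zero] at h
    linear_combination -h
  have hf : FinZ (fun k => D (𝓘 1) (𝓛 k) (𝓛 (1 - k))) :=
    (hD.bdd _).finZ _ _ 0 fun k => by simp [mode]
  have h₁ (k : ℤ) : D (𝓘 1) (𝓛 k) (𝓛 (1 - k)) = 0 := by
    refine hf.eq_zero (fun k => ?_) k
    have h₁ := hl 2 (k + 1) (2 - k)
    have h₂ := hr 2 k (3 - k)
    ring_nf at h₁ h₂ ⊢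
    linear_combination (h₂ - h₁) / 2
  have h₂ : D (𝓘 m) (𝓛 x) (𝓛 y) = m * D (𝓘 1) (𝓛 (x + 1 - m)) (𝓛 y) := by
    rw [hl m (x + 1) y, add_sub_cancel_right]
  by_cases hy : y = m - x
  · have := h₁ (x + 1 - m)
    rw [h₂, hy, show m - x = 1 - (x + 1 - m) by ring, this, mul_zero]
  · exact hD.eq_zero_of_wt (by simp [wt]; omega)

theorem Good.bosonic_eq_zero {D : Option NSI → Option NSI → Option NSI → ℂ} (hD : Good D)
    (hp : ∀ x y, D (𝓘 1) (𝓘 x) (𝓛 y) = 0) (m x y : ℤ) :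
    D (𝓘 m) (𝓘 x) (𝓛 y) = 0 ∧ D (𝓘 m) (𝓛 x) (𝓘 y) = 0 ∧ D (𝓛 m) (𝓛 x) (𝓛 y) = 0 := by
  have e1 (m x y : ℤ) : D (𝓛 m) (𝓛 x) (𝓛 y) = D (𝓘 (m + 1)) (𝓘 (x + 1)) (𝓛 y) := by
    have h := hD.coc (𝓛 m) (𝓘 1) (𝓘 (x + 1)) (𝓛 y)
    simp [brEval, act2, act, sgn, hp] at h
    exact h.symm
  have e2 (m x y : ℤ) : D (𝓘 (m + 1)) (𝓛 x) (𝓘 y) = D (𝓛 m) (𝓛 x) (𝓛 (y - 1)) -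
      ((2 * m - x) * D (𝓘 1) (𝓛 (x - m)) (𝓘 y) - (y - m) * D (𝓘 1) (𝓛 x) (𝓘 (y - m))) := by
    have h := hD.coc (𝓛 m) (𝓘 1) (𝓛 x) (𝓘 y)
    simp [brEval, act2, act, sgn] at h
    linear_combination -h
  have e4 (m n x y : ℤ) :
      m * (D (𝓘 n) (𝓛 (x - m)) (𝓘 y) + D (𝓘 n) (𝓘 x) (𝓛 (y - m))) =
      n * (D (𝓘 m) (𝓛 (x - n)) (𝓘 y) + D (𝓘 m) (𝓘 x) (𝓛 (y - n))) := by
    have h := hD.coc (𝓘 m) (𝓘 n) (𝓘 x) (𝓘 y)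
    simp [brEval, act2, act, sgn, hD.none_eq_zero] at h
    linear_combination -h
  have e3 (m x y : ℤ) : m * D (𝓘 1) (𝓛 (x - m)) (𝓘 y) =
      D (𝓘 m) (𝓛 (x - 1)) (𝓘 y) + D (𝓘 m) (𝓘 x) (𝓛 (y - 1)) := by
    have h := e4 m 1 x y
    rw [hp] at h
    push_cast at h
    linear_combination h
  have hpm (m x y : ℤ) : 2 * D (𝓘 m) (𝓘 x) (𝓛 y) =
      (3 * m - 1 - x) * D (𝓘 1) (𝓛 (x - m)) (𝓘 (y + 1)) -
        (y - m + 2) * D (𝓘 1) (𝓛 (x - 1)) (𝓘 (y + 2 - m)) := by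
    have h₁ := e1 (m - 1) (x - 1) y
    have h₂ := e2 (m - 1) (x - 1) (y + 1)
    have h₃ := e3 m x (y + 1)
    push_cast at h₂
    ring_nf at h₁ h₂ h₃ ⊢
    linear_combination -h₁ - h₂ - h₃
  have hqm (m x y : ℤ) : 2 * D (𝓘 m) (𝓛 x) (𝓘 y) =
      (2 - m + x) * D (𝓘 1) (𝓛 (x + 1 - m)) (𝓘 y) +
        (y - m + 1) * D (𝓘 1) (𝓛 x) (𝓘 (y + 1 - m)) := by
    have h₁ := hpm m (x + 1) (y - 1)
    have h₃ := e3 m (x + 1) y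
    push_cast at h₁
    ring_nf at h₁ h₃ ⊢
    linear_combination -h₁ - 2 * h₃
  have hq (x y : ℤ) : D (𝓘 1) (𝓛 x) (𝓘 y) = 0 := by
    by_cases hxy : x + y = 1
    swap
    · exact hD.eq_zero_of_wt (by simp [wt]; omega)
    obtain ⟨N, hN⟩ := hD.bdd (𝓘 1)
    have hfar (z w : ℤ) (hz : N < |z|) : D (𝓘 1) (𝓛 z) (𝓘 w) = 0 := by
      by_contra h
      exact absurd (hN _ _ h).1 (not_le.mpr hz)
    by_cases hx : N < |x|
    · exact hfar x y hx
    rw [not_lt] at hx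
    have hN0 : 0 ≤ N := (abs_nonneg x).trans hx
    have hx' := abs_le.mp hx
    have h := e4 (2 * N + 3) (5 * N + 10) (x + (2 * N + 3)) (5 * N + 10 - x)
    have h₁ := hqm (5 * N + 10) (x + (2 * N + 3) - (2 * N + 3)) (5 * N + 10 - x)
    have h₂ := hpm (5 * N + 10) (x + (2 * N + 3)) (5 * N + 10 - x - (2 * N + 3))
    have h₃ := hqm (2 * N + 3) (x + (2 * N + 3) - (5 * N + 10)) (5 * N + 10 - x)
    have h₄ := hpm (2 * N + 3) (x + (2 * N + 3)) (5 * N + 10 - x - (5 * N + 10))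
    rw [hfar (x + (2 * N + 3) - (2 * N + 3) + 1 - (5 * N + 10)) _
        (by rw [lt_abs]; omega)] at h₁
    rw [hfar (x + (2 * N + 3) - (5 * N + 10)) _ (by rw [lt_abs]; omega),
      hfar (x + (2 * N + 3) - 1) _ (by rw [lt_abs]; omega)] at h₂
    rw [hfar (x + (2 * N + 3) - (5 * N + 10)) _ (by rw [lt_abs]; omega),
      hfar (x + (2 * N + 3) - (5 * N + 10) + 1 - (2 * N + 3)) _ (by rw [lt_abs]; omega)] at h₃
    rw [hfar (x + (2 * N + 3) - 1) _ (by rw [lt_abs]; omega)] at h₄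
    rw [show x + (2 * N + 3) - (2 * N + 3) = x by ring,
      show 5 * N + 10 - x + 1 - (5 * N + 10) = y by omega] at h₁
    rw [show x + (2 * N + 3) - (2 * N + 3) = x by ring,
      show 5 * N + 10 - x - (5 * N + 10) + 1 = y by omega] at h₄
    rw [show x + (2 * N + 3) - (2 * N + 3) = x by ring] at h
    have h₅ : (((2 * N + 3) * (1 - x) - (5 * N + 10) * (4 * N + 5 - x) : ℤ) : ℂ) *
        D (𝓘 1) (𝓛 x) (𝓘 y) = 0 := by
      push_cast at h h₁ h₂ h₃ h₄ ⊢
      linear_combination 2 * h - (2 * N + 3 : ℂ) * (h₁ + h₂) + (5 * N + 10 : ℂ) * (h₃ + h₄)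
    refine (mul_eq_zero.mp h₅).resolve_left fun h₆ => ?_
    have h₇ : (2 * N + 3) * (1 - x) - (5 * N + 10) * (4 * N + 5 - x) = 0 := by exact_mod_cast h₆
    nlinarith
  have hP (m x y : ℤ) : D (𝓘 m) (𝓘 x) (𝓛 y) = 0 := by
    have := hpm m x y
    rw [hq, hq] at this
    linear_combination this / 2
  refine ⟨hP m x y, ?_, ?_⟩
  · have := hqm m x y
    rw [hq, hq] at this
    linear_combination this / 2
  · rw [e1, hP]

theorem GGZero.gauge {D : Option NSI → Option NSI → Option NSI → ℂ} (hD : GGZero D)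
    {R : Option NSI → Option NSI → ℂ} (hR : ∀ s k s' l, R (𝓖 s k) (𝓖 s' l) = 0) :
    GGZero (gauge D R) := by
  intro m s k s' l
  simp [NSHat.gauge, act2, act, hR, (hD m s k s' l).1, (hD m s k s' l).2]

/-- A good cocycle, normalized on its bosonic components. -/
structure BosonicNormal (D : Option NSI → Option NSI → Option NSI → ℂ) : Prop where
  good : Good D
  gg : GGZero D
  I_IL : ∀ m x y, D (𝓘 m) (𝓘 x) (𝓛 y) = 0
  I_LI : ∀ m x y, D (𝓘 m) (𝓛 x) (𝓘 y) = 0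
  L_LL : ∀ m x y, D (𝓛 m) (𝓛 x) (𝓛 y) = 0
  I_one_II : ∀ x y, D (𝓘 1) (𝓘 x) (𝓘 y) = 0

theorem Good.exists_bosonicNormal {D : Option NSI → Option NSI → Option NSI → ℂ} (hD : Good D)
    (hg : GGZero D) : ∃ R, Bdd R ∧ BosonicNormal (NSHat.gauge D R) := by
  let R : Option NSI → Option NSI → ℂ
    | 𝓛 x, 𝓛 y => D (𝓘 1) (𝓘 (x + 1)) (𝓛 y)
    | 𝓘 x, 𝓛 y => D (𝓘 1) (𝓘 x) (𝓘 (y + 1))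
    | _, _ => 0
  have hR : Bdd R := (hD.bdd (𝓘 1)).of_shift 1 fun a b hab => by
    rcases a with _ | (m | m | ⟨s, m⟩) <;> rcases b with _ | (n | n | ⟨s', n⟩) <;>
      simp only [R, ne_eq, not_true_eq_false] at hab
    all_goals exact ⟨_, _, hab, by simp [mode], by simp [mode]⟩
  have hG : Good (NSHat.gauge D R) := by
    refine hD.gauge hR fun a b hab => ?_
    rcases a with _ | (m | m | ⟨s, m⟩) <;> rcases b with _ | (n | n | ⟨s', n⟩) <;>
      simp only [R, ne_eq, not_true_eq_false] at hab
    all_goals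
      have := (hD.hom _ _ _ hab).1
      simp only [wt, charge] at this ⊢
      omega
  have hp (x y : ℤ) : NSHat.gauge D R (𝓘 1) (𝓘 x) (𝓛 y) = 0 := by
    simp [NSHat.gauge, act2, act, R]
  have hb := hG.bosonic_eq_zero hp
  refine ⟨R, hR, hG, hg.gauge fun _ _ _ _ => rfl, fun m x y => (hb m x y).1,
    fun m x y => (hb m x y).2.1, fun m x y => (hb m x y).2.2, fun x y => ?_⟩
  simp [NSHat.gauge, act2, act, R, sgn]

section BosonicNormal

variable {D : Option NSI → Option NSI → Option NSI → ℂ}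

theorem BosonicNormal.G_GL (hD : BosonicNormal D) (s : Bool) (m k j y : ℤ) :
    D (𝓖 s (m + k)) (𝓖 s j) (𝓛 y) = D (𝓖 s k) (𝓖 s (j - m)) (𝓛 y) := by
  have h := hD.good.coc (𝓘 m) (𝓖 s k) (𝓖 s j) (𝓛 y)
  simp [brEval, act2, act, sgn, hD.good.I_LL, hD.I_IL, (hD.gg _ _ _ _ _).1] at h
  exact h.resolve_right (eps_ne_zero s)

theorem BosonicNormal.G_LG (hD : BosonicNormal D) (s : Bool) (m k x j : ℤ) :
    D (𝓖 s (m + k)) (𝓛 x) (𝓖 s j) = D (𝓖 s k) (𝓛 x) (𝓖 s (j - m)) := by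
  have h := hD.good.coc (𝓘 m) (𝓖 s k) (𝓛 x) (𝓖 s j)
  simp [brEval, act2, act, sgn, hD.good.I_LL, hD.I_LI, (hD.gg _ _ _ _ _).1] at h
  exact h.resolve_right (eps_ne_zero s)

theorem BosonicNormal.G_GI (hD : BosonicNormal D) (s : Bool) (m k j y : ℤ) :
    eps s * D (𝓖 s (m + k)) (𝓖 s j) (𝓘 y) = eps s * D (𝓖 s k) (𝓖 s (j - m)) (𝓘 y) +
      m * D (𝓖 s k) (𝓖 s j) (𝓛 (y - m)) + eps s * D (𝓘 m) (𝓘 (j - k)) (𝓘 y) := by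
  have h := hD.good.coc (𝓘 m) (𝓖 s k) (𝓖 s j) (𝓘 y)
  simp [brEval, act2, act, sgn, hD.I_LI, (hD.gg _ _ _ _ _).1] at h
  linear_combination h

theorem BosonicNormal.G_IG (hD : BosonicNormal D) (s : Bool) (m k x j : ℤ) :
    eps s * D (𝓖 s (m + k)) (𝓘 x) (𝓖 s j) = eps s * D (𝓖 s k) (𝓘 x) (𝓖 s (j - m)) +
      m * D (𝓖 s k) (𝓛 (x - m)) (𝓖 s j) + eps s * D (𝓘 m) (𝓘 x) (𝓘 (j - k)) := by
  have h := hD.good.coc (𝓘 m) (𝓖 s k) (𝓘 x) (𝓖 s j)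
  simp [brEval, act2, act, sgn, hD.I_IL, (hD.gg _ _ _ _ _).1] at h
  linear_combination h

theorem BosonicNormal.I_two_left (hD : BosonicNormal D) (s : Bool) (x : ℤ) :
    eps s * D (𝓘 2) (𝓘 x) (𝓘 (2 - x)) = 2 * D (𝓖 s 0) (𝓖 s (x - 1)) (𝓛 (-(x - 1))) -
      2 * D (𝓖 s 0) (𝓖 s x) (𝓛 (-x)) := by
  have h₁ := hD.G_GI s 1 0 (x - 1) (2 - x)
  have h₂ := hD.G_GI s 1 1 x (2 - x)
  have h₃ := hD.G_GI s 2 0 x (2 - x)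
  have h₄ := hD.G_GL s 1 0 x (1 - x)
  rw [hD.I_one_II] at h₁ h₂
  norm_num at h₁ h₂ h₃ h₄
  ring_nf at h₁ h₂ h₃ h₄ ⊢
  linear_combination h₁ + h₂ - h₃ + h₄

theorem BosonicNormal.I_two_right (hD : BosonicNormal D) (s : Bool) (x : ℤ) :
    eps s * D (𝓘 2) (𝓘 x) (𝓘 (2 - x)) = 2 * D (𝓖 s 0) (𝓛 (x - 1)) (𝓖 s (-(x - 1))) -
      2 * D (𝓖 s 0) (𝓛 (x - 2)) (𝓖 s (-(x - 2))) := by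
  have h₁ := hD.G_IG s 1 0 x (1 - x)
  have h₂ := hD.G_IG s 1 1 x (2 - x)
  have h₃ := hD.G_IG s 2 0 x (2 - x)
  have h₄ := hD.G_LG s 1 0 (x - 1) (2 - x)
  rw [hD.I_one_II] at h₁ h₂
  norm_num at h₁ h₂ h₃ h₄
  ring_nf at h₁ h₂ h₃ h₄ ⊢
  linear_combination h₁ + h₂ - h₃ + h₄

theorem BosonicNormal.G_bosonL_eq_zero (hD : BosonicNormal D)
    (hA : ∀ x y, D (𝓖 true 0) (𝓖 true x) (𝓛 y) = 0) (s : Bool) (k x y : ℤ) :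
    D (𝓖 s k) (𝓖 s x) (𝓛 y) = 0 ∧ D (𝓖 s k) (𝓛 y) (𝓖 s x) = 0 := by
  have hF (x : ℤ) : D (𝓖 false 0) (𝓖 false x) (𝓛 (-x)) = 0 := by
    refine FinZ.eq_zero (f := fun x => D (𝓖 false 0) (𝓖 false x) (𝓛 (-x)))
      ((hD.good.bdd _).finZ _ _ 0 fun k => by simp [mode]) (fun x => ?_) x
    have h₁ := hD.I_two_left true x
    have h₂ := hD.I_two_left false x
    rw [hA, hA, eps_true] at h₁
    rw [eps_false] at h₂
    linear_combination (h₁ + h₂) / 2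
  have hl (s : Bool) (x : ℤ) : D (𝓖 s 0) (𝓖 s x) (𝓛 (-x)) = 0 := by
    cases s
    · exact hF x
    · exact hA x _
  have hr (s : Bool) (x : ℤ) : D (𝓖 s 0) (𝓛 x) (𝓖 s (-x)) = 0 := by
    refine FinZ.eq_zero (f := fun x => D (𝓖 s 0) (𝓛 x) (𝓖 s (-x)))
      ((hD.good.bdd _).finZ _ _ 0 fun k => by simp [mode]) (fun x => ?_) x
    have h₁ := hD.I_two_left s (x + 1)
    have h₂ := hD.I_two_right s (x + 1)
    rw [hl, hl] at h₁
    ring_nf at h₁ h₂ ⊢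
    linear_combination (h₁ - h₂) / 2
  have h₁ := hD.G_GL s k 0 x y
  have h₂ := hD.G_LG s k 0 y x
  rw [add_zero] at h₁ h₂
  rw [h₁, h₂]
  by_cases hxy : y = -(x - k)
  · refine ⟨by rw [hxy, hl], ?_⟩
    have := hr s y
    rwa [show -y = x - k by omega] at this
  · exact ⟨hD.good.eq_zero_of_wt (by simp [wt]; omega),
      hD.good.eq_zero_of_wt (by simp [wt]; omega)⟩

theorem BosonicNormal.G_GI_shift (hD : BosonicNormal D)
    (hA : ∀ x y, D (𝓖 true 0) (𝓖 true x) (𝓛 y) = 0) (s : Bool) (k j y : ℤ) :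
    D (𝓖 s k) (𝓖 s j) (𝓘 y) = D (𝓖 s 0) (𝓖 s (j - k)) (𝓘 y) := by
  have h₁ (k j : ℤ) : D (𝓖 s (1 + k)) (𝓖 s j) (𝓘 y) = D (𝓖 s k) (𝓖 s (j - 1)) (𝓘 y) := by
    have h := hD.G_GI s 1 k j y
    rw [hD.I_one_II, (hD.G_bosonL_eq_zero hA s k j _).1] at h
    exact mul_left_cancel₀ (eps_ne_zero s) (by linear_combination h)
  induction k generalizing j with
  | zero => simp
  | succ n ih =>
    rw [add_comm, h₁, ih]; congr 3; ring
  | pred n ih =>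
    have := h₁ (-n - 1) (j + 1)
    rw [show 1 + (-(n : ℤ) - 1) = -n by ring, ih, add_sub_cancel_right] at this
    rw [← this]; congr 3; ring

theorem BosonicNormal.I_II_eq_zero (hD : BosonicNormal D)
    (hA : ∀ x y, D (𝓖 true 0) (𝓖 true x) (𝓛 y) = 0) (m x y : ℤ) :
    D (𝓘 m) (𝓘 x) (𝓘 y) = 0 := by
  have h := hD.G_GI true m 0 x y
  rw [hD.G_GI_shift hA, (hD.G_bosonL_eq_zero hA true 0 x _).1] at h
  simpa using h

theorem BosonicNormal.I_noncentral_eq_zero (hD : BosonicNormal D)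
    (hA : ∀ x y, D (𝓖 true 0) (𝓖 true x) (𝓛 y) = 0) (m : ℤ) (p q : NSI) :
    D (𝓘 m) (.some p) (.some q) = 0 := by
  rcases p with x | x | ⟨s, x⟩ <;> rcases q with y | y | ⟨t, y⟩
  · exact hD.good.I_LL _ _ _
  · exact hD.I_LI _ _ _
  · exact hD.good.eq_zero_of_charge (by cases t <;> simp [charge])
  · exact hD.I_IL _ _ _
  · exact hD.I_II_eq_zero hA _ _ _
  · exact hD.good.eq_zero_of_charge (by cases t <;> simp [charge])
  · exact hD.good.eq_zero_of_charge (by cases s <;> simp [charge])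
  · exact hD.good.eq_zero_of_charge (by cases s <;> simp [charge])
  · exact (hD.gg _ _ _ _ _).1

theorem act_some_eq_zero {g : Option NSI → ℂ} (hg : ∀ p : NSI, g (.some p) = 0) (i : Option NSI)
    (p : NSI) : act i g (.some p) = 0 := by
  rcases i with _ | (m | m | ⟨s, m⟩) <;> rcases p with n | n | ⟨t, n⟩ <;> simp [act, hg]

theorem act2_some_eq_zero {T : Option NSI → Option NSI → ℂ}
    (hT : ∀ p q : NSI, T (.some p) (.some q) = 0) (i : Option NSI) (p q : NSI) :
    act2 i T (.some p) (.some q) = 0 := by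
  rw [act2, act_some_eq_zero (fun p => hT p q), act_some_eq_zero (hT p)]
  simp

theorem BosonicNormal.noncentral_eq_zero (hD : BosonicNormal D)
    (hA : ∀ x y, D (𝓖 true 0) (𝓖 true x) (𝓛 y) = 0)
    (hB : ∀ x y, D (𝓖 true 0) (𝓖 true x) (𝓘 y) = 0) (i : Option NSI) (p q : NSI) :
    D i (.some p) (.some q) = 0 := by
  have hLL := hD.G_bosonL_eq_zero hA
  have hB₁ (k x y : ℤ) : D (𝓖 true k) (𝓖 true x) (𝓘 y) = 0 := by rw [hD.G_GI_shift hA, hB]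
  have hI (s : Bool) (m k x j : ℤ) :
      D (𝓖 s (m + k)) (𝓘 x) (𝓖 s j) = D (𝓖 s k) (𝓘 x) (𝓖 s (j - m)) := by
    have h := hD.G_IG s m k x j
    rw [hD.I_II_eq_zero hA, (hLL _ _ _ _).2] at h
    exact mul_left_cancel₀ (eps_ne_zero s) (by linear_combination h)
  have hB₂ (k x y : ℤ) : D (𝓖 true k) (𝓘 x) (𝓖 true y) = 0 := by
    have h := hD.good.coc (𝓖 true k) (𝓖 true k) (𝓖 true (x + k)) (𝓖 true y)
    simp [brEval, act2, act, sgn, (hLL _ _ _ _).1, (hLL _ _ _ _).2, hB₁] at h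
    linear_combination h / 2
  have hG (t : Bool) (ht : ∀ k x y, D (𝓖 t k) (𝓖 t x) (𝓘 y) = 0 ∧ D (𝓖 t k) (𝓘 x) (𝓖 t y) = 0)
      (k : ℤ) (p q : NSI) : D (𝓖 t k) (.some p) (.some q) = 0 := by
    rcases p with x | x | ⟨s, x⟩ <;> rcases q with y | y | ⟨s', y⟩
    · exact hD.good.eq_zero_of_charge (by cases t <;> simp [charge])
    · exact hD.good.eq_zero_of_charge (by cases t <;> simp [charge])
    · by_cases hs : s' = t
      · rw [hs]; exact (hLL t k y x).2
      · exact hD.good.eq_zero_of_charge (by cases t <;> cases s' <;> simp_all [charge])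
    · exact hD.good.eq_zero_of_charge (by cases t <;> simp [charge])
    · exact hD.good.eq_zero_of_charge (by cases t <;> simp [charge])
    · by_cases hs : s' = t
      · rw [hs]; exact (ht k x y).2
      · exact hD.good.eq_zero_of_charge (by cases t <;> cases s' <;> simp_all [charge])
    · by_cases hs : s = t
      · rw [hs]; exact (hLL t k x y).1
      · exact hD.good.eq_zero_of_charge (by cases t <;> cases s <;> simp_all [charge])
    · by_cases hs : s = t
      · rw [hs]; exact (ht k x y).1
      · exact hD.good.eq_zero_of_charge (by cases t <;> cases s <;> simp_all [charge])
    · exact hD.good.eq_zero_of_charge (by cases t <;> cases s <;> cases s' <;> simp [charge])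
  have hG₁ := hG true fun k x y => ⟨hB₁ k x y, hB₂ k x y⟩
  have hI₀ := hD.I_noncentral_eq_zero hA
  have hG₂ := hG false fun k x y => by
    have h := hD.good.coc (𝓖 true 0) (𝓖 false k) (𝓖 false x) (𝓖 true y)
    have h' := hD.good.coc (𝓖 true 0) (𝓖 false k) (𝓖 true x) (𝓖 false y)
    simp [brEval, act2, act, sgn, (hLL _ _ _ _).1, (hLL _ _ _ _).2, hG₁, hI₀,
      (hD.gg _ _ _ _ _).2, hD.good.none_eq_zero] at h h'
    exact ⟨h.symm, h'⟩
  have hL₀ (n : ℤ) (p q : NSI) : D (𝓛 n) (.some p) (.some q) = 0 := by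
    have h := hD.good.coc (𝓖 true (n - 1)) (𝓖 false 0) (.some p) (.some q)
    rw [act2_some_eq_zero (hG₁ _), act2_some_eq_zero (hG₂ _)] at h
    simpa [brEval, hI₀, hD.good.none_eq_zero] using h
  rcases i with _ | (n | n | ⟨_ | _, n⟩)
  · exact hD.good.none_eq_zero (.inl (by simp))
  · exact hL₀ _ _ _
  · exact hI₀ _ _ _
  · exact hG₂ _ _ _
  · exact hG₁ _ _ _

theorem BosonicNormal.exists_noncentral_eq_zero (hD : BosonicNormal D) :
    ∃ R, Bdd R ∧ Good (gauge D R) ∧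
      ∀ (i : Option NSI) (p q : NSI), gauge D R i (.some p) (.some q) = 0 := by
  let R : Option NSI → Option NSI → ℂ
    | 𝓘 x, 𝓛 y => -D (𝓖 true 0) (𝓖 true x) (𝓛 y)
    | 𝓛 x, 𝓘 y => D (𝓖 true 0) (𝓖 true (x + 1)) (𝓛 (y - 1))
    | 𝓘 x, 𝓘 y => -D (𝓖 true 0) (𝓖 true x) (𝓘 y) -
        (x - 1) / 2 * D (𝓖 true 0) (𝓖 true (x + 1)) (𝓛 (y - 1))
    | _, _ => 0
  have hRD (a b : Option NSI) (hab : R a b ≠ 0) : ∃ p q, D (𝓖 true 0) p q ≠ 0 ∧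
      |mode p - mode a| ≤ 1 ∧ |mode q - mode b| ≤ 1 ∧ wt a + wt b + 1 = wt p + wt q ∧
      charge a = 0 ∧ charge b = 0 := by
    rcases a with _ | (m | m | ⟨s, m⟩) <;> rcases b with _ | (n | n | ⟨s', n⟩) <;>
      simp only [R, ne_eq, not_true_eq_false, neg_eq_zero] at hab
    · exact ⟨_, _, hab, by simp [mode], by simp [mode], by simp [wt]; ring, rfl, rfl⟩
    · exact ⟨_, _, hab, by simp [mode], by simp [mode], by simp [wt]; ring, rfl, rfl⟩
    · by_cases h : D (𝓖 true 0) (𝓖 true m) (𝓘 n) = 0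
      · rw [h, neg_zero, zero_sub, neg_eq_zero] at hab
        exact ⟨_, _, right_ne_zero_of_mul hab, by simp [mode], by simp [mode],
          by simp [wt]; ring, rfl, rfl⟩
      · exact ⟨_, _, h, by simp [mode], by simp [mode], by simp [wt]; ring, rfl, rfl⟩
  have hR : Bdd R := (hD.good.bdd (𝓖 true 0)).of_shift 1 fun a b hab =>
    let ⟨p, q, h₁, h₂, h₃, _⟩ := hRD a b hab
    ⟨p, q, h₁, h₂, h₃⟩
  have hG : Good (gauge D R) := by
    refine hD.good.gauge hR fun a b hab => ?_
    obtain ⟨p, q, h₁, -, -, h₂, h₃, h₄⟩ := hRD a b hab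
    have : wt p + wt q = 1 := (hD.good.hom _ _ _ h₁).1
    omega
  have hN : BosonicNormal (gauge D R) := by
    refine ⟨hG, hD.gg.gauge fun _ _ _ _ => rfl, fun m x y => ?_, fun m x y => ?_,
      fun m x y => ?_, fun x y => ?_⟩
    · simp [gauge, act2, act, R, hD.I_IL]
    · simp [gauge, act2, act, R, hD.I_LI]
    · simp [gauge, act2, act, R, hD.L_LL]
    · simp [gauge, act2, act, R, hD.I_one_II, sgn]
  refine ⟨R, hR, hG, hN.noncentral_eq_zero (fun x y => ?_) fun x y => ?_⟩
  · simp [gauge, act2, act, R]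
  · simp [gauge, act2, act, R]
    ring

end BosonicNormal

/-- The coefficient function of `x L₀ + y I₀`. -/
def cartan (x y : ℂ) : Option NSI → ℂ
  | 𝓛 n => if n = 0 then x else 0
  | 𝓘 n => if n = 0 then y else 0
  | _ => 0

theorem derivation_eq_act_cartan {Φ : Option NSI → Option NSI → ℂ}
    (h : ∀ i j (p : NSI), brEval (fun k => Φ k (.some p)) i j =
      act i (Φ j) (.some p) - sgn i j * act j (Φ i) (.some p))
    (hw : ∀ i (p : NSI), Φ i (.some p) ≠ 0 → wt (.some p) = wt i ∧ charge (.some p) = charge i)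
    (h₀ : ∀ p : NSI, Φ .none (.some p) = 0) :
    ∃ x y, ∀ i (p : NSI), Φ i (.some p) = act i (cartan x y) (.some p) := by
  have hI (m n : ℤ) : 0 = m * Φ (𝓘 n) (𝓛 n) - n * Φ (𝓘 m) (𝓛 m) := by
    have := h (𝓘 m) (𝓘 n) (.I (m + n))
    simpa [brEval, act, sgn, h₀] using this
  have hIG (s : Bool) (m k : ℤ) : eps s * Φ (𝓖 s (m + k)) (𝓖 s (m + k)) =
      eps s * Φ (𝓖 s k) (𝓖 s k) + (m - 2 * k - 1) / 2 * Φ (𝓘 m) (𝓛 m) +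
        eps s * Φ (𝓘 m) (𝓘 m) := by
    have := h (𝓘 m) (𝓖 s k) (.G s (m + k))
    simp [brEval, act, sgn] at this
    linear_combination this
  have ha₁ : Φ (𝓘 1) (𝓛 1) = 0 := by
    have h₁ := hI 1 2
    have h₂ := hIG true 1 0
    have h₃ := hIG true 1 1
    have h₄ := hIG true 2 0
    have h₅ := hIG false 1 0
    have h₆ := hIG false 1 1
    have h₇ := hIG false 2 0
    norm_num at h₁ h₂ h₃ h₄ h₅ h₆ h₇
    linear_combination (h₂ + h₃ - h₄ + h₅ + h₆ - h₇) / 4 + (1 / 4) * h₁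
  have ha (m : ℤ) : Φ (𝓘 m) (𝓛 m) = 0 := by
    have := hI 1 m
    rw [ha₁] at this
    push_cast at this
    linear_combination -this
  have hg₁ (s : Bool) (m k : ℤ) :
      Φ (𝓖 s (m + k)) (𝓖 s (m + k)) = Φ (𝓖 s k) (𝓖 s k) + Φ (𝓘 m) (𝓘 m) := by
    have := hIG s m k
    rw [ha] at this
    exact mul_left_cancel₀ (eps_ne_zero s) (by linear_combination this)
  have hg (s : Bool) (k : ℤ) : Φ (𝓖 s k) (𝓖 s k) = Φ (𝓖 s 0) (𝓖 s 0) + k * Φ (𝓘 1) (𝓘 1) := by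
    induction k with
    | zero => simp
    | succ n ih =>
      rw [add_comm, hg₁, ih]; push_cast; ring
    | pred n ih =>
      have := hg₁ s 1 (-n - 1)
      rw [show 1 + (-(n : ℤ) - 1) = -n by ring, ih] at this
      push_cast at this ⊢
      linear_combination -this
  have hb (m : ℤ) : Φ (𝓘 m) (𝓘 m) = m * Φ (𝓘 1) (𝓘 1) := by
    have h₁ := hg₁ true m 0
    rw [add_zero, hg true m] at h₁
    linear_combination -h₁
  have hLG (m : ℤ) (s : Bool) (k : ℤ) :
      (m - 2 * k - 1) / 2 * (m * Φ (𝓘 1) (𝓘 1) - Φ (𝓛 m) (𝓛 m)) = eps s * Φ (𝓛 m) (𝓘 m) := by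
    have h₁ := h (𝓛 m) (𝓖 s k) (.G s (m + k))
    simp [brEval, act, sgn] at h₁
    have h₂ := hg s (m + k)
    have h₃ := hg s k
    rw [h₂, h₃] at h₁
    push_cast at h₁
    linear_combination h₁
  have hc (m : ℤ) : Φ (𝓛 m) (𝓛 m) = m * Φ (𝓘 1) (𝓘 1) := by
    have h₁ := hLG m true 0
    have h₂ := hLG m true 1
    push_cast at h₁ h₂
    linear_combination h₂ - h₁
  have he (m : ℤ) : Φ (𝓛 m) (𝓘 m) = 0 := by
    have h₁ := hLG m true 0
    rw [hc, eps_true] at h₁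
    linear_combination -h₁
  have hm : Φ (𝓖 false 0) (𝓖 false 0) = Φ (𝓘 1) (𝓘 1) - Φ (𝓖 true 0) (𝓖 true 0) := by
    have h₁ := h (𝓖 true 0) (𝓖 false (-1)) (.L 0)
    have h₂ := hg false (-1)
    have h₃ : Φ (𝓘 0) (𝓛 0) = 0 := ha 0
    have h₄ := hc 0
    simp [brEval, act, sgn, h₀, h₃, h₄] at h₁
    push_cast at h₂
    linear_combination -h₂ - h₁ / 2
  refine ⟨Φ (𝓘 1) (𝓘 1), Φ (𝓘 1) (𝓘 1) / 2 - Φ (𝓖 true 0) (𝓖 true 0), fun i p => ?_⟩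
  by_cases hip : wt (.some p) = wt i ∧ charge (.some p) = charge i
  swap
  · have h₁ : Φ i (.some p) = 0 := by
      by_contra h₁
      exact hip (hw i p h₁)
    rw [h₁]
    by_contra h₂
    obtain ⟨q, hq, -, h₃, h₄⟩ := act_support (Ne.symm h₂)
    have h₅ : wt q = 0 ∧ charge q = 0 := by
      rcases q with _ | (m | m | ⟨s, m⟩) <;> simp [cartan] at hq <;> simp [wt, charge, hq]
    omega
  obtain ⟨h₁, h₂⟩ := hip
  rcases i with _ | (m | m | ⟨s, m⟩)
  · simp [act, h₀]
  · rcases p with n | n | ⟨t, n⟩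
    · obtain rfl : n = m := by simp only [wt] at h₁; omega
      rw [hc]; simp [act, cartan]; left; ring
    · obtain rfl : n = m := by simp only [wt] at h₁; omega
      simp [act, he]
    · cases t <;> simp [charge] at h₂
  · rcases p with n | n | ⟨t, n⟩
    · obtain rfl : n = m := by simp only [wt] at h₁; omega
      rw [ha]; simp [act]
    · obtain rfl : n = m := by simp only [wt] at h₁; omega
      rw [hb]; simp [act, cartan]
    · cases t <;> simp [charge] at h₂
  · rcases p with n | n | ⟨t, n⟩
    · cases s <;> simp [charge] at h₂
    · cases s <;> simp [charge] at h₂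
    · obtain rfl : n = m := by simp only [wt] at h₁; omega
      obtain rfl : t = s := by cases s <;> cases t <;> first | rfl | (simp [charge] at h₂)
      rw [hg]
      cases t
      · rw [hm]; simp [act, cartan]; ring
      · simp [act, cartan]; ring

theorem act_eq_zero {g : Option NSI → ℂ} (hg : ∀ p : NSI, g (.some p) = 0) (i a : Option NSI) :
    act i g a = 0 := by
  rcases a with _ | p
  · rcases i with _ | (m | m | ⟨s, m⟩) <;> simp [act, hg]
  · exact act_some_eq_zero hg i p

theorem act2_none_left {T : Option NSI → Option NSI → ℂ}
    (hT : ∀ p q : NSI, T (.some p) (.some q) = 0) (i : Option NSI) (p : NSI) :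
    act2 i T .none (.some p) = act i (T .none) (.some p) := by
  rw [act2, act_eq_zero (fun q => hT q p), sgn_none_right]; ring

theorem act2_none_right {T : Option NSI → Option NSI → ℂ}
    (hT : ∀ p q : NSI, T (.some p) (.some q) = 0) (i : Option NSI) (p : NSI) :
    act2 i T (.some p) .none = act i (fun a => T a .none) (.some p) := by
  rw [act2, act_eq_zero (hT p)]; ring

theorem Good.inner_of_noncentral {D : Option NSI → Option NSI → Option NSI → ℂ} (hD : Good D)
    (h : ∀ i (p q : NSI), D i (.some p) (.some q) = 0) : Inner D := by
  obtain ⟨x, y, hxy⟩ := derivation_eq_act_cartan (Φ := fun i => D i .none)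
    (fun i j p => by
      have := hD.coc i j .none (.some p)
      rwa [act2_none_left (h j), act2_none_left (h i)] at this)
    (fun i p hp => by simpa [wt, charge] using hD.hom _ _ _ hp)
    (fun p => hD.none_eq_zero (.inr (by simp)))
  obtain ⟨z, w, hzw⟩ := derivation_eq_act_cartan (Φ := fun i a => D i a .none)
    (fun i j p => by
      have := hD.coc i j (.some p) .none
      rwa [act2_none_right (h j), act2_none_right (h i)] at this)
    (fun i p hp => by simpa [wt, charge] using hD.hom _ _ _ hp)
    (fun p => hD.none_eq_zero (.inl (by simp)))
  let R : Option NSI → Option NSI → ℂ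
    | .none, .some p => cartan x y (.some p)
    | .some p, .none => cartan z w (.some p)
    | _, _ => 0
  have hc (x y : ℂ) (p : NSI) (hp : cartan x y (.some p) ≠ 0) :
      mode (.some p) = 0 ∧ wt (.some p) = 0 ∧ charge (.some p) = 0 := by
    rcases p with m | m | ⟨s, m⟩ <;> simp [cartan] at hp <;> simp [mode, wt, charge, hp]
  have hR₁ (a b : Option NSI) (hab : R a b ≠ 0) : mode a = 0 ∧ mode b = 0 ∧
      wt a + wt b = 0 ∧ charge a + charge b = 0 := by
    rcases a with _ | a <;> rcases b with _ | b <;> simp only [R, ne_eq, not_true_eq_false] at hab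
    · simpa [mode, wt, charge] using hc _ _ _ hab
    · simpa [mode, wt, charge] using hc _ _ _ hab
  have hR : Bdd R := ⟨0, fun a b hab => by simp [hR₁ a b hab]⟩
  have hG := hD.gauge hR fun a b hab => (hR₁ a b hab).2.2
  have hRs (p q : NSI) : R (.some p) (.some q) = 0 := rfl
  have hs (i : Option NSI) (p q : NSI) : NSHat.gauge D R i (.some p) (.some q) = 0 := by
    rw [NSHat.gauge, h, act2_some_eq_zero hRs, sub_zero]
  have hl (i : Option NSI) (p : NSI) : NSHat.gauge D R i .none (.some p) = 0 := by
    rw [NSHat.gauge, act2_none_left hRs, hxy, sub_eq_zero, ← sub_eq_zero, ← act_sub]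
    exact act_eq_zero (fun p => sub_self _) _ _
  have hr (i : Option NSI) (p : NSI) : NSHat.gauge D R i (.some p) .none = 0 := by
    rw [NSHat.gauge, act2_none_right hRs, hzw, sub_eq_zero, ← sub_eq_zero, ← act_sub]
    exact act_eq_zero (fun p => sub_self _) _ _
  have ht (i j : Option NSI) : brEval (fun k => NSHat.gauge D R k .none .none) i j = 0 := by
    rw [hG.coc i j, act2, act2, act_eq_zero (hl j), act_eq_zero (hl i), act_eq_zero (hr j),
      act_eq_zero (hr i)]
    ring
  have hL : NSHat.gauge D R (𝓛 0) .none .none = 0 := by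
    simpa [brEval] using ht (𝓛 1) (𝓛 (-1))
  have hI : NSHat.gauge D R (𝓘 0) .none .none = 0 := by
    simpa [brEval] using ht (𝓘 1) (𝓛 (-1))
  have hC : NSHat.gauge D R .none .none .none = 0 := by
    have := ht (𝓘 1) (𝓘 (-1))
    simpa [brEval] using this
  refine Inner.of_gauge hR ⟨fun _ _ => 0, ⟨0, by simp⟩, fun i a b => ?_⟩
  simp only [act2, act_zero, mul_zero, add_zero]
  rcases a with _ | a
  · rcases b with _ | b
    · by_contra hi
      have := hG.hom _ _ _ hi
      rcases i with _ | (m | m | ⟨s, m⟩)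
      · exact hi hC
      · obtain rfl : m = 0 := by simpa [wt] using this.1
        exact hi hL
      · obtain rfl : m = 0 := by simpa [wt] using this.1
        exact hi hI
      · cases s <;> simp [charge] at this
    · exact hl i b
  · rcases b with _ | b
    · exact hr i a
    · exact hs i a b

theorem IsCocycle.inner {D : Option NSI → Option NSI → Option NSI → ℂ} (hD : IsCocycle D)
    (hb : ∀ i, Bdd (D i)) : Inner D := by
  obtain ⟨R₀, hR₀, h₀⟩ := exists_good hD hb
  obtain ⟨R₁, hR₁, h₁, hg⟩ := h₀.exists_ggZero
  obtain ⟨R₂, hR₂, h₂⟩ := h₁.exists_bosonicNormal hg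
  obtain ⟨R₃, hR₃, h₃, hn⟩ := h₂.exists_noncentral_eq_zero
  exact .of_gauge hR₀ <| .of_gauge hR₁ <| .of_gauge hR₂ <| .of_gauge hR₃ <|
    h₃.inner_of_noncentral hn

end NSHat

theorem sg_add_right (a b c : ZMod 2) : sg a (b + c) = sg a b * sg a c := by
  have h : ∀ x : ZMod 2, x = 0 ∨ x = 1 := by decide
  rcases h a with rfl | rfl <;> rcases h b with rfl | rfl <;> rcases h c with rfl | rfl <;>
    simp [sg, show (1 : ZMod 2) + 1 = 0 from rfl]

theorem sg_comm (a b : ZMod 2) : sg a b = sg b a := by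
  rw [sg, sg, mul_comm]

theorem sg_add_left (a b c : ZMod 2) : sg (a + b) c = sg a c * sg b c := by
  rw [sg_comm, sg_add_right, sg_comm a, sg_comm b]

theorem sg_mul_self (a b : ZMod 2) : sg a b * sg a b = 1 := by
  rw [sg]; split_ifs <;> norm_num

namespace SuperData

variable {D : SuperData}

theorem homog1_e (i : D.ι) : D.Homog1 (D.par i) (D.e i) := by
  intro j hj
  rw [e] at hj
  rw [Finset.mem_singleton.mp (Finsupp.support_single_subset hj)]

@[elab_as_elim]
theorem Homog1.induction {s : ZMod 2} {v : D.V} (hv : D.Homog1 s v) {P : D.V → Prop}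
    (zero : P 0) (add : ∀ u w, P u → P w → P (u + w)) (smul : ∀ (c : ℂ) u, P u → P (c • u))
    (basis : ∀ i, D.par i = s → P (D.e i)) : P v := by
  have h : v ∈ Submodule.span ℂ (D.e '' {i | D.par i = s}) := by
    have := (Finsupp.mem_supported ℂ v).mpr (show ↑v.support ⊆ {i | D.par i = s} from hv)
    rwa [Finsupp.supported_eq_span_single] at this
  clear hv
  induction h using Submodule.span_induction with
  | mem u hu => obtain ⟨i, hi, rfl⟩ := hu; exact basis i hi
  | zero => exact zero
  | add u w _ _ hu hw => exact add u w hu hw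
  | smul c u _ hu => exact smul c u hu

theorem lift_single {α M : Type*} [AddCommGroup M] [Module ℂ M] (g : α → M) (a : α) (c : ℂ) :
    lift g (single a c) = c • g a := by
  simp [lift]

@[simp] theorem brk_e (i j : D.ι) : D.brk (D.e i) (D.e j) = D.br i j := by
  simp [brk, e, lift_single]

@[simp] theorem tens2_e (i j : D.ι) : D.tens2 (D.e i) (D.e j) = single (i, j) 1 := by
  simp [tens2, e, lift_single]

@[simp] theorem tens3_e (i j k : D.ι) :
    D.tens3 (D.e i) (D.e j) (D.e k) = single (i, j, k) 1 := by
  simp [tens3, e, lift_single]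

theorem star2_e_single (x : D.ι) (p : D.ι × D.ι) : D.star2 (D.e x) (single p 1) =
    D.tens2 (D.br x p.1) (D.e p.2) +
      sg (D.par x) (D.par p.1) • D.tens2 (D.e p.1) (D.br x p.2) := by
  simp [star2, e, lift_single]

theorem star3_e_single (x : D.ι) (p : D.ι × D.ι × D.ι) : D.star3 (D.e x) (single p 1) =
    D.tens3 (D.br x p.1) (D.e p.2.1) (D.e p.2.2) +
      sg (D.par x) (D.par p.1) • D.tens3 (D.e p.1) (D.br x p.2.1) (D.e p.2.2) +
      sg (D.par x) (D.par p.1 + D.par p.2.1) •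
        D.tens3 (D.e p.1) (D.e p.2.1) (D.br x p.2.2) := by
  simp [star3, e, lift_single]

theorem tau_tens2 {a b : ZMod 2} {u v : D.V} (hu : D.Homog1 a u) (hv : D.Homog1 b v) :
    D.tau (D.tens2 u v) = sg a b • D.tens2 v u := by
  refine hu.induction (by simp) (fun u w hu hw => by simp [hu, hw])
    (fun c u hu => by simp [hu, smul_comm c]) fun i hi => ?_
  refine hv.induction (by simp) (fun u w hu hw => by simp [hu, hw])
    (fun c u hu => by simp [hu, smul_comm c]) fun j hj => ?_
  simp [tau, lift_single, hi, hj]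

theorem xi_tens3 {a b c : ZMod 2} {u v w : D.V} (hu : D.Homog1 a u) (hv : D.Homog1 b v)
    (hw : D.Homog1 c w) : D.xi (D.tens3 u v w) = sg a (b + c) • D.tens3 v w u := by
  refine hu.induction (by simp) (fun u w hu hw => by simp [hu, hw])
    (fun c u hu => by simp [hu, smul_comm c]) fun i hi => ?_
  refine hv.induction (by simp) (fun u w hu hw => by simp [hu, hw])
    (fun c u hu => by simp [hu, smul_comm c]) fun j hj => ?_
  refine hw.induction (by simp) (fun u w hu hw => by simp [hu, hw])
    (fun c u hu => by simp [hu, smul_comm c]) fun k hk => ?_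
  simp [xi, lift_single, hi, hj, hk]

theorem star2_tens2 (x : D.ι) {a : ZMod 2} {u : D.V} (hu : D.Homog1 a u) (v : D.V) :
    D.star2 (D.e x) (D.tens2 u v) = D.tens2 (D.brk (D.e x) u) v +
      sg (D.par x) a • D.tens2 u (D.brk (D.e x) v) := by
  refine hu.induction (by simp)
    (fun u w hu hw => by simp only [map_add, LinearMap.add_apply, hu, hw]; module)
    (fun c u hu => by simp only [map_smul, LinearMap.smul_apply, hu]; module) fun i hi => ?_
  induction v using Finsupp.induction_linear with
  | zero => simp
  | add u w hu hw => simp only [map_add, hu, hw]; module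
  | single j c =>
    rw [show single j c = c • D.e j by simp [e]]
    simp only [map_smul, tens2_e]
    simp [star2_e_single, hi, smul_comm c]

theorem star3_tens3 (x : D.ι) {a b : ZMod 2} {u v : D.V} (hu : D.Homog1 a u)
    (hv : D.Homog1 b v) (w : D.V) :
    D.star3 (D.e x) (D.tens3 u v w) = D.tens3 (D.brk (D.e x) u) v w +
      sg (D.par x) a • D.tens3 u (D.brk (D.e x) v) w +
      sg (D.par x) (a + b) • D.tens3 u v (D.brk (D.e x) w) := by
  refine hu.induction (by simp)
    (fun u w hu hw => by simp only [map_add, LinearMap.add_apply, hu, hw]; module)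
    (fun c u hu => by simp only [map_smul, LinearMap.smul_apply, hu]; module) fun i hi => ?_
  refine hv.induction (by simp)
    (fun u w hu hw => by simp only [map_add, LinearMap.add_apply, hu, hw]; module)
    (fun c u hu => by simp only [map_smul, LinearMap.smul_apply, hu]; module) fun j hj => ?_
  induction w using Finsupp.induction_linear with
  | zero => simp
  | add u w hu hw => simp only [map_add, hu, hw]; module
  | single k c =>
    rw [show single k c = c • D.e k by simp [e]]
    simp only [map_smul, tens3_e]
    simp [star3_e_single, hi, hj, smul_comm c]

/-- The Lie superalgebra axioms, expressed on the basis. -/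
structure IsLieBasis (D : SuperData) : Prop where
  parity (i j : D.ι) : D.Homog1 (D.par i + D.par j) (D.br i j)
  skew (i j : D.ι) : D.br i j = -sg (D.par i) (D.par j) • D.br j i
  jacobi (i j k : D.ι) : D.brk (D.e i) (D.br j k) =
    D.brk (D.br i j) (D.e k) + sg (D.par i) (D.par j) • D.brk (D.e j) (D.br i k)

theorem Homog1.brk (hD : IsLieBasis D) {a b : ZMod 2} {u v : D.V} (hu : D.Homog1 a u)
    (hv : D.Homog1 b v) : D.Homog1 (a + b) (D.brk u v) := by
  classical
  have hz (s : ZMod 2) : D.Homog1 s 0 := by simp [Homog1]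
  have ha (s : ZMod 2) (u w : D.V) (hu : D.Homog1 s u) (hw : D.Homog1 s w) :
      D.Homog1 s (u + w) := fun i hi => by
    rcases Finset.mem_union.mp (Finsupp.support_add hi) with h | h
    exacts [hu i h, hw i h]
  have hm (s : ZMod 2) (c : ℂ) (u : D.V) (hu : D.Homog1 s u) : D.Homog1 s (c • u) :=
    fun i hi => hu i (Finsupp.support_smul hi)
  refine Homog1.induction hu (by simpa using hz _) (fun u w hu hw => by simpa using ha _ _ _ hu hw)
    (fun c u hu => by simpa using hm _ _ _ hu) fun i hi => ?_
  refine Homog1.induction hv (by simpa using hz _) (fun u w hu hw => by simpa using ha _ _ _ hu hw)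
    (fun c u hu => by simpa using hm _ _ _ hu) fun j hj => ?_
  simpa [hi, hj] using hD.parity i j

theorem IsLieBasis.brk_skew (hD : IsLieBasis D) {a b : ZMod 2} {u v : D.V} (hu : D.Homog1 a u)
    (hv : D.Homog1 b v) : D.brk u v = -sg a b • D.brk v u := by
  refine Homog1.induction hu (by simp)
    (fun u w hu hw => by simp only [map_add, LinearMap.add_apply, hu, hw]; module)
    (fun c u hu => by simp only [map_smul, LinearMap.smul_apply, hu]; module) fun i hi => ?_
  refine Homog1.induction hv (by simp)
    (fun u w hu hw => by simp only [map_add, LinearMap.add_apply, hu, hw]; module)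
    (fun c u hu => by simp only [map_smul, LinearMap.smul_apply, hu]; module) fun j hj => ?_
  rw [brk_e, brk_e, hD.skew, hi, hj]

theorem tau_star2 (hD : IsLieBasis D) (x : D.ι) (t : D.T2) :
    D.tau (D.star2 (D.e x) t) = D.star2 (D.e x) (D.tau t) := by
  induction t using Finsupp.induction_linear with
  | zero => simp
  | add t u ht hu => simp only [map_add, ht, hu]
  | single p c =>
    obtain ⟨i, j⟩ := p
    rw [show single (i, j) c = c • D.tens2 (D.e i) (D.e j) by simp]
    simp only [map_smul]
    rw [tau_tens2 (homog1_e i) (homog1_e j), star2_tens2 x (homog1_e i), map_smul,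
      star2_tens2 x (homog1_e j), brk_e, brk_e, map_add, map_smul,
      tau_tens2 (hD.parity x i) (homog1_e j), tau_tens2 (homog1_e i) (hD.parity x j)]
    simp only [sg_add_left, sg_add_right, sg_comm (D.par i) (D.par x)]
    have := sg_mul_self (D.par x) (D.par i)
    match_scalars
    · ring
    · linear_combination (c * sg (D.par i) (D.par j)) * this

theorem tau_tau (t : D.T2) : D.tau (D.tau t) = t := by
  induction t using Finsupp.induction_linear with
  | zero => simp
  | add t u ht hu => simp only [map_add, ht, hu]
  | single p c =>
    obtain ⟨i, j⟩ := p
    rw [show single (i, j) c = c • D.tens2 (D.e i) (D.e j) by simp]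
    rw [map_smul, tau_tens2 (homog1_e i) (homog1_e j), map_smul, map_smul,
      tau_tens2 (homog1_e j) (homog1_e i), smul_smul (sg _ _), sg_comm (D.par j), sg_mul_self,
      one_smul]

theorem tau_eq_neg_of_mem_imSkew {t : D.T2} (ht : t ∈ D.ImSkew) : D.tau t = -t := by
  obtain ⟨u, rfl⟩ := ht
  simp [tau_tau]

section PairSum

variable {M : Type*} [AddCommGroup M] [Module ℂ M] {r : D.T2}

theorem lift_add_fun {α : Type*} (f g : α → M) (v : α →₀ ℂ) :
    lift (fun a => f a + g a) v = lift f v + lift g v := by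
  simp [lift, linearCombination_apply, Finsupp.sum_add]

theorem lift_smul_fun {α : Type*} (c : ℂ) (f : α → M) (v : α →₀ ℂ) :
    lift (fun a => c • f a) v = c • lift f v := by
  simp [lift, linearCombination_apply, Finsupp.smul_sum, smul_comm c]

theorem map_lift {α N : Type*} [AddCommGroup N] [Module ℂ N] (g : M →ₗ[ℂ] N) (f : α → M)
    (v : α →₀ ℂ) : g (lift f v) = lift (fun a => g (f a)) v := by
  simp [lift, linearCombination_apply, map_finsuppSum]

theorem lift_congr_of_isEven2 (hr : D.IsEven2 r) {f g : D.ι × D.ι → M}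
    (h : ∀ p : D.ι × D.ι, D.par p.2 = D.par p.1 → f p = g p) : lift f r = lift g r := by
  simp only [lift, linearCombination_apply]
  exact Finsupp.sum_congr fun p hp => by rw [h p (CharTwo.add_eq_zero.mp (hr p hp)).symm]

theorem lift_swap (hr : D.tau r = -r) (f : D.ι × D.ι → M) :
    lift f r = lift (fun p => -sg (D.par p.1) (D.par p.2) • f p.swap) r := by
  have : lift f (D.tau r) = lift (fun p => sg (D.par p.1) (D.par p.2) • f p.swap) r := by
    rw [tau, map_lift]
    simp [lift_single, Prod.swap]
  rw [hr, map_neg, neg_eq_iff_eq_neg] at this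
  rw [this]
  simp only [neg_smul]
  simpa using (lift_smul_fun (-1) (fun p => sg (D.par p.1) (D.par p.2) • f p.swap) r).symm

/-- The sum of `Φ p q` over the terms `p` and `q` of two copies of `r`. -/
def pairSum (r : D.T2) (Φ : D.ι × D.ι → D.ι × D.ι → M) : M := lift (fun p => lift (Φ p) r) r

theorem pairSum_add (Φ Ψ : D.ι × D.ι → D.ι × D.ι → M) :
    pairSum r (fun p q => Φ p q + Ψ p q) = pairSum r Φ + pairSum r Ψ := by
  simp only [pairSum, lift_add_fun]

theorem map_pairSum {N : Type*} [AddCommGroup N] [Module ℂ N] (g : M →ₗ[ℂ] N)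
    (Φ : D.ι × D.ι → D.ι × D.ι → M) : g (pairSum r Φ) = pairSum r fun p q => g (Φ p q) := by
  simp only [pairSum, map_lift]

theorem pairSum_congr (hr : D.IsEven2 r) {Φ Ψ : D.ι × D.ι → D.ι × D.ι → M}
    (h : ∀ p q : D.ι × D.ι, D.par p.2 = D.par p.1 → D.par q.2 = D.par q.1 → Φ p q = Ψ p q) :
    pairSum r Φ = pairSum r Ψ :=
  lift_congr_of_isEven2 hr fun p hp => lift_congr_of_isEven2 hr fun q hq => h p q hp hq

theorem pairSum_exchange (Φ : D.ι × D.ι → D.ι × D.ι → M) :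
    pairSum r Φ = pairSum r fun p q => Φ q p := by
  simp only [pairSum, lift, linearCombination_apply, Finsupp.smul_sum]
  rw [Finsupp.sum_comm]
  exact Finsupp.sum_congr fun p _ => Finsupp.sum_congr fun q _ => smul_comm _ _ _

theorem pairSum_swap_left (hr : D.tau r = -r) (Φ : D.ι × D.ι → D.ι × D.ι → M) :
    pairSum r Φ = pairSum r fun p q => -sg (D.par p.1) (D.par p.2) • Φ p.swap q := by
  simp only [pairSum, lift_smul_fun]
  exact lift_swap hr _

theorem pairSum_swap_right (hr : D.tau r = -r) (Φ : D.ι × D.ι → D.ι × D.ι → M) :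
    pairSum r Φ = pairSum r fun p q => -sg (D.par q.1) (D.par q.2) • Φ p q.swap := by
  rw [pairSum_exchange, pairSum_swap_left hr, pairSum_exchange]

end PairSum

variable {r : D.T2}

theorem cybe_eq_pairSum (r : D.T2) : D.cybe r = pairSum r fun p q =>
    sg (D.par q.1) (D.par p.2) •
        (D.tens3 (D.br p.1 q.1) (D.e p.2) (D.e q.2) +
          D.tens3 (D.e p.1) (D.e q.1) (D.br p.2 q.2)) +
      D.tens3 (D.e p.1) (D.br p.2 q.1) (D.e q.2) := by
  simp only [cybe, pairSum, lift, linearCombination_apply, Finsupp.smul_sum, mul_smul]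

theorem mapDomain_tens2 (i : D.ι) (v w : D.V) :
    Finsupp.mapDomain (fun q : D.ι × D.ι => (i, q.1, q.2)) (D.tens2 v w) =
      D.tens3 (D.e i) v w := by
  rw [← Finsupp.lmapDomain_apply ℂ ℂ]
  induction v using Finsupp.induction_linear with
  | zero => simp
  | add t u ht hu => simp only [map_add, LinearMap.add_apply, ht, hu]
  | single j c =>
    rw [show single j c = c • D.e j by simp [e]]
    induction w using Finsupp.induction_linear with
    | zero => simp
    | add t u ht hu => simp only [map_add, ht, hu]
    | single k c =>
      rw [show single k c = c • D.e k by simp [e]]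
      simp only [map_smul, LinearMap.smul_apply, tens2_e, tens3_e]
      simp

theorem oneDelta_tens2 (r : D.T2) (u : D.V) {s : ZMod 2} {v : D.V} (hv : D.Homog1 s v) :
    D.oneDelta (D.star2.flip r) (D.tens2 u v) = lift (fun q : D.ι × D.ι =>
      D.tens3 u (D.brk v (D.e q.1)) (D.e q.2) +
        sg s (D.par q.1) • D.tens3 u (D.e q.1) (D.brk v (D.e q.2))) r := by
  have key (u v : D.V) : lift (fun q : D.ι × D.ι => D.tens3 u (D.brk v (D.e q.1)) (D.e q.2) +
        sg s (D.par q.1) • D.tens3 u (D.e q.1) (D.brk v (D.e q.2))) r =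
      (lift (fun q : D.ι × D.ι => (D.tens3.flip (D.brk v (D.e q.1))).flip (D.e q.2) +
        sg s (D.par q.1) • (D.tens3.flip (D.e q.1)).flip (D.brk v (D.e q.2))) r) u := by
    simp only [lift, linearCombination_apply, Finsupp.sum, LinearMap.sum_apply,
      LinearMap.smul_apply, LinearMap.add_apply, LinearMap.flip_apply]
  induction u using Finsupp.induction_linear with
  | zero => simp only [key]; simp
  | add t u ht hu => simp only [key] at *; simp only [map_add, LinearMap.add_apply, ht, hu]
  | single i c =>
    rw [show single i c = c • D.e i by simp [e]]
    rw [key]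
    simp only [map_smul, LinearMap.smul_apply]
    rw [← key]
    congr 1
    refine hv.induction ?_ (fun u w hu hw => ?_) (fun c u hu => ?_) fun j hj => ?_
    · simp [lift, linearCombination_apply]
    · simp only [map_add, LinearMap.add_apply, hu, hw, ← lift_add_fun]
      exact congrArg (fun f => lift f r) (funext fun q => by module)
    · simp only [map_smul, LinearMap.smul_apply, hu, ← lift_smul_fun]
      exact congrArg (fun f => lift f r) (funext fun q => by module)
    · rw [tens2_e, oneDelta, lift_single, one_smul, LinearMap.flip_apply,
        ← Finsupp.lmapDomain_apply ℂ ℂ, e, star2, lift_single, one_smul, map_lift]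
      refine congrArg (fun f => lift f r) (funext fun q => ?_)
      rw [map_add, map_smul, Finsupp.lmapDomain_apply, Finsupp.lmapDomain_apply,
        mapDomain_tens2, mapDomain_tens2, hj]
      simp only [← e.eq_def, brk_e]

theorem oneDelta_star2 (hD : IsLieBasis D) (hr : D.IsEven2 r) (x : D.ι) :
    D.oneDelta (D.star2.flip r) (D.star2 (D.e x) r) =
      pairSum r (fun p q => D.tens3 (D.br x p.1) (D.br p.2 q.1) (D.e q.2)) +
      pairSum r (fun p q => sg (D.par p.1) (D.par q.1) •
        D.tens3 (D.br x p.1) (D.e q.1) (D.br p.2 q.2)) +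
      pairSum r (fun p q => sg (D.par x) (D.par p.1) •
        D.tens3 (D.e p.1) (D.brk (D.br x p.2) (D.e q.1)) (D.e q.2)) +
      pairSum r (fun p q => (sg (D.par x) (D.par p.1) * sg (D.par x + D.par p.1) (D.par q.1)) •
        D.tens3 (D.e p.1) (D.e q.1) (D.brk (D.br x p.2) (D.e q.2))) := by
  have h₁ : D.star2 (D.e x) r = lift (fun p : D.ι × D.ι => D.tens2 (D.br x p.1) (D.e p.2) +
      sg (D.par x) (D.par p.1) • D.tens2 (D.e p.1) (D.br x p.2)) r := by
    rw [star2, e, lift_single, one_smul]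
  rw [h₁, map_lift, ← pairSum_add, ← pairSum_add, ← pairSum_add, pairSum]
  refine lift_congr_of_isEven2 hr fun p hp => ?_
  rw [map_add, map_smul, oneDelta_tens2 r _ (homog1_e p.2), oneDelta_tens2 r _ (hD.parity x p.2),
    ← lift_smul_fun, ← lift_add_fun, hp]
  refine congrArg (fun f => lift f r) (funext fun q => ?_)
  simp only [brk_e]
  module

theorem oneDelta_cyclic (hD : IsLieBasis D) (hr : D.IsEven2 r) (ht : D.tau r = -r) (x : D.ι) :
    D.oneDelta (D.star2.flip r) (D.star2 (D.e x) r) +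
      D.xi (D.oneDelta (D.star2.flip r) (D.star2 (D.e x) r)) +
      D.xi (D.xi (D.oneDelta (D.star2.flip r) (D.star2 (D.e x) r))) =
    D.star3 (D.e x) (D.cybe r) := by
  have hz : ∀ x : ZMod 2, x = 0 ∨ x = 1 := by decide
  have h11 : (1 : ZMod 2) + 1 = 0 := rfl
  have hb (i j k : D.ι) := (hD.parity i j).brk hD (homog1_e k)
  have es (Φ : D.ι × D.ι → D.ι × D.ι → D.T3) : pairSum r Φ =
      pairSum r fun p q => -sg (D.par q.1) (D.par q.2) • Φ q.swap p := by
    rw [pairSum_swap_left ht, pairSum_exchange]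
  have es' (Φ : D.ι × D.ι → D.ι × D.ι → D.T3) : pairSum r Φ =
      pairSum r fun p q => -sg (D.par p.1) (D.par p.2) • Φ q p.swap := by
    rw [pairSum_exchange, pairSum_swap_left ht]
  have ss (Φ : D.ι × D.ι → D.ι × D.ι → D.T3) : pairSum r Φ =
      pairSum r fun p q => -sg (D.par q.1) (D.par q.2) • -sg (D.par p.1) (D.par p.2) •
        Φ p.swap q.swap := by
    rw [pairSum_swap_left ht, pairSum_swap_right ht]
  have t₁' : D.xi (pairSum r fun p q => D.tens3 (D.br x p.1) (D.br p.2 q.1) (D.e q.2)) =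
      pairSum r fun p q => (sg (D.par p.1) (D.par q.1) * sg (D.par x) (D.par q.1)) •
        D.tens3 (D.br p.1 q.1) (D.e p.2) (D.br x q.2) := by
    rw [map_pairSum, es]
    refine pairSum_congr hr fun p q hp hq => ?_
    rw [xi_tens3 (hD.parity _ _) (hD.parity _ _) (homog1_e _)]
    simp only [Prod.fst_swap, Prod.snd_swap]
    rw [hD.skew q.1 p.1]
    simp only [map_smul, LinearMap.smul_apply, hp, hq]
    match_scalars
    rcases hz (D.par x) with h₁ | h₁ <;> rcases hz (D.par p.1) with h₂ | h₂ <;>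
      rcases hz (D.par q.1) with h₃ | h₃ <;> simp [sg, h₁, h₂, h₃, h11]
  have t₂' : D.xi (pairSum r fun p q => sg (D.par p.1) (D.par q.1) •
        D.tens3 (D.br x p.1) (D.e q.1) (D.br p.2 q.2)) =
      pairSum r fun p q => sg (D.par x) (D.par q.1) •
        D.tens3 (D.e p.1) (D.br p.2 q.1) (D.br x q.2) := by
    rw [map_pairSum, es]
    refine pairSum_congr hr fun p q hp hq => ?_
    rw [map_smul, xi_tens3 (hD.parity _ _) (homog1_e _) (hD.parity _ _)]
    simp only [Prod.fst_swap, Prod.snd_swap]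
    rw [hD.skew q.1 p.2]
    simp only [map_smul, LinearMap.smul_apply, hp, hq]
    match_scalars
    rcases hz (D.par x) with h₁ | h₁ <;> rcases hz (D.par p.1) with h₂ | h₂ <;>
      rcases hz (D.par q.1) with h₃ | h₃ <;> simp [sg, h₁, h₂, h₃, h11]
  have t₁'' : D.xi (D.xi (pairSum r fun p q => D.tens3 (D.br x p.1) (D.br p.2 q.1) (D.e q.2))) =
      pairSum r fun p q => (sg (D.par p.1) (D.par q.1) * sg (D.par x) (D.par p.1)) •
        D.tens3 (D.e p.1) (D.br x q.1) (D.br p.2 q.2) := by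
    rw [map_pairSum, map_pairSum, es']
    refine pairSum_congr hr fun p q hp hq => ?_
    rw [xi_tens3 (hD.parity _ _) (hD.parity _ _) (homog1_e _), map_smul,
      xi_tens3 (hD.parity _ _) (homog1_e _) (hD.parity _ _)]
    simp only [Prod.fst_swap, Prod.snd_swap]
    rw [hD.skew q.2 p.2]
    simp only [map_smul, hp, hq]
    match_scalars
    rcases hz (D.par x) with h₁ | h₁ <;> rcases hz (D.par p.1) with h₂ | h₂ <;>
      rcases hz (D.par q.1) with h₃ | h₃ <;> simp [sg, h₁, h₂, h₃, h11]
  have t₂'' : D.xi (D.xi (pairSum r fun p q => sg (D.par p.1) (D.par q.1) •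
        D.tens3 (D.br x p.1) (D.e q.1) (D.br p.2 q.2))) =
      pairSum r fun p q => (sg (D.par p.1) (D.par q.1) * sg (D.par x) (D.par p.1 + D.par q.1)) •
        D.tens3 (D.br p.1 q.1) (D.br x p.2) (D.e q.2) := by
    rw [map_pairSum, map_pairSum, ss]
    refine pairSum_congr hr fun p q hp hq => ?_
    rw [map_smul, xi_tens3 (hD.parity _ _) (homog1_e _) (hD.parity _ _),
      map_smul, map_smul, xi_tens3 (homog1_e _) (hD.parity _ _) (hD.parity _ _)]
    simp only [Prod.fst_swap, Prod.snd_swap]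
    simp only [hp, hq]
    match_scalars
    rcases hz (D.par x) with h₁ | h₁ <;> rcases hz (D.par p.1) with h₂ | h₂ <;>
      rcases hz (D.par q.1) with h₃ | h₃ <;> simp [sg, h₁, h₂, h₃, h11]
  have t₄' : D.xi (pairSum r fun p q =>
    (sg (D.par x) (D.par p.1) * sg (D.par x + D.par p.1) (D.par q.1)) •
        D.tens3 (D.e p.1) (D.e q.1) (D.brk (D.br x p.2) (D.e q.2))) =
      pairSum r fun p q => sg (D.par x) (D.par p.1 + D.par p.1) •
        D.tens3 (D.e p.1) (D.brk (D.e p.2) (D.br x q.1)) (D.e q.2) := by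
    rw [map_pairSum, es]
    refine pairSum_congr hr fun p q hp hq => ?_
    rw [map_smul, xi_tens3 (homog1_e _) (homog1_e _) (hb _ _ _)]
    simp only [Prod.fst_swap, Prod.snd_swap]
    rw [hD.brk_skew (hD.parity x q.1) (homog1_e p.2)]
    simp only [map_smul, LinearMap.smul_apply, hp, hq]
    match_scalars
    rcases hz (D.par x) with h₁ | h₁ <;> rcases hz (D.par p.1) with h₂ | h₂ <;>
      rcases hz (D.par q.1) with h₃ | h₃ <;> simp [sg, h₁, h₂, h₃, h11]
  have t₃'' : D.xi (D.xi (pairSum r fun p q => sg (D.par x) (D.par p.1) •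
        D.tens3 (D.e p.1) (D.brk (D.br x p.2) (D.e q.1)) (D.e q.2))) =
      pairSum r fun p q => (sg (D.par p.1) (D.par q.1) * sg (D.par x) (D.par q.1)) •
        D.tens3 (D.e p.1) (D.e q.1) (D.brk (D.e p.2) (D.br x q.2)) := by
    rw [map_pairSum, map_pairSum, es']
    refine pairSum_congr hr fun p q hp hq => ?_
    rw [map_smul, xi_tens3 (homog1_e _) (hb _ _ _) (homog1_e _), map_smul,
      map_smul, xi_tens3 (hb _ _ _) (homog1_e _) (homog1_e _)]
    simp only [Prod.fst_swap, Prod.snd_swap]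
    rw [hD.brk_skew (hD.parity x q.2) (homog1_e p.2)]
    simp only [map_smul, hp, hq]
    match_scalars
    rcases hz (D.par x) with h₁ | h₁ <;> rcases hz (D.par p.1) with h₂ | h₂ <;>
      rcases hz (D.par q.1) with h₃ | h₃ <;> simp [sg, h₁, h₂, h₃, h11]
  have t₃' : D.xi (pairSum r fun p q => sg (D.par x) (D.par p.1) •
        D.tens3 (D.e p.1) (D.brk (D.br x p.2) (D.e q.1)) (D.e q.2)) =
      pairSum r fun p q => (sg (D.par p.1) (D.par q.1) * sg (D.par x) (D.par p.1)) •
        D.tens3 (D.brk (D.e p.1) (D.br x q.1)) (D.e p.2) (D.e q.2) := by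
    rw [map_pairSum, es]
    refine pairSum_congr hr fun p q hp hq => ?_
    rw [map_smul, xi_tens3 (homog1_e _) (hb _ _ _) (homog1_e _)]
    simp only [Prod.fst_swap, Prod.snd_swap]
    rw [hD.brk_skew (hD.parity x q.1) (homog1_e p.1)]
    simp only [map_smul, LinearMap.smul_apply, hp, hq]
    match_scalars
    rcases hz (D.par x) with h₁ | h₁ <;> rcases hz (D.par p.1) with h₂ | h₂ <;>
      rcases hz (D.par q.1) with h₃ | h₃ <;> simp [sg, h₁, h₂, h₃, h11]
  have t₄'' : D.xi (D.xi (pairSum r fun p q =>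
    (sg (D.par x) (D.par p.1) * sg (D.par x + D.par p.1) (D.par q.1)) •
        D.tens3 (D.e p.1) (D.e q.1) (D.brk (D.br x p.2) (D.e q.2)))) =
      pairSum r fun p q => sg (D.par p.1) (D.par q.1) •
        D.tens3 (D.brk (D.br x p.1) (D.e q.1)) (D.e p.2) (D.e q.2) := by
    rw [map_pairSum, map_pairSum, ss]
    refine pairSum_congr hr fun p q hp hq => ?_
    rw [map_smul, xi_tens3 (homog1_e _) (homog1_e _) (hb _ _ _),
      map_smul, map_smul, xi_tens3 (homog1_e _) (hb _ _ _) (homog1_e _)]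
    simp only [Prod.fst_swap, Prod.snd_swap]
    simp only [hp, hq]
    match_scalars
    rcases hz (D.par x) with h₁ | h₁ <;> rcases hz (D.par p.1) with h₂ | h₂ <;>
      rcases hz (D.par q.1) with h₃ | h₃ <;> simp [sg, h₁, h₂, h₃, h11]
  have c : D.star3 (D.e x) (D.cybe r) =
      pairSum r (fun p q => D.tens3 (D.br x p.1) (D.br p.2 q.1) (D.e q.2)) +
      pairSum r (fun p q => sg (D.par p.1) (D.par q.1) •
        D.tens3 (D.br x p.1) (D.e q.1) (D.br p.2 q.2)) +
      pairSum r (fun p q => sg (D.par x) (D.par p.1) •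
        D.tens3 (D.e p.1) (D.brk (D.br x p.2) (D.e q.1)) (D.e q.2)) +
      pairSum r (fun p q => (sg (D.par x) (D.par p.1) * sg (D.par x + D.par p.1) (D.par q.1)) •
        D.tens3 (D.e p.1) (D.e q.1) (D.brk (D.br x p.2) (D.e q.2))) +
      pairSum r (fun p q => (sg (D.par p.1) (D.par q.1) * sg (D.par x) (D.par q.1)) •
        D.tens3 (D.br p.1 q.1) (D.e p.2) (D.br x q.2)) +
      pairSum r (fun p q => sg (D.par x) (D.par q.1) •
        D.tens3 (D.e p.1) (D.br p.2 q.1) (D.br x q.2)) +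
      pairSum r (fun p q => (sg (D.par p.1) (D.par q.1) * sg (D.par x) (D.par p.1)) •
        D.tens3 (D.e p.1) (D.br x q.1) (D.br p.2 q.2)) +
      pairSum r (fun p q => (sg (D.par p.1) (D.par q.1) * sg (D.par x) (D.par p.1 + D.par q.1)) •
        D.tens3 (D.br p.1 q.1) (D.br x p.2) (D.e q.2)) +
      pairSum r (fun p q => sg (D.par x) (D.par p.1 + D.par p.1) •
        D.tens3 (D.e p.1) (D.brk (D.e p.2) (D.br x q.1)) (D.e q.2)) +
      pairSum r (fun p q => (sg (D.par p.1) (D.par q.1) * sg (D.par x) (D.par q.1)) •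
        D.tens3 (D.e p.1) (D.e q.1) (D.brk (D.e p.2) (D.br x q.2))) +
      pairSum r (fun p q => (sg (D.par p.1) (D.par q.1) * sg (D.par x) (D.par p.1)) •
        D.tens3 (D.brk (D.e p.1) (D.br x q.1)) (D.e p.2) (D.e q.2)) +
      pairSum r (fun p q => sg (D.par p.1) (D.par q.1) •
        D.tens3 (D.brk (D.br x p.1) (D.e q.1)) (D.e p.2) (D.e q.2)) := by
    rw [cybe_eq_pairSum, map_pairSum]
    simp only [← pairSum_add]
    refine pairSum_congr hr fun p q hp hq => ?_
    simp only [map_add, map_smul]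
    rw [star3_tens3 x (hD.parity _ _) (homog1_e _), star3_tens3 x (homog1_e _) (homog1_e _),
      star3_tens3 x (homog1_e _) (hD.parity _ _)]
    simp only [brk_e, hD.jacobi x p.1 q.1, hD.jacobi x p.2 q.1, hD.jacobi x p.2 q.2, map_add,
      map_smul, LinearMap.smul_apply, LinearMap.add_apply, hp]
    match_scalars <;>
    rcases hz (D.par x) with h₁ | h₁ <;> rcases hz (D.par p.1) with h₂ | h₂ <;>
      rcases hz (D.par q.1) with h₃ | h₃ <;> simp [sg, h₁, h₂, h₃, h11]
  rw [oneDelta_star2 hD hr, c]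
  simp only [map_add]
  rw [t₁'', t₂'', t₃'', t₄'', t₁', t₂', t₃', t₄']
  abel

theorem tens2_apply (u v : D.V) (a b : D.ι) : D.tens2 u v (a, b) = u a * v b := by
  classical
  induction u using Finsupp.induction_linear with
  | zero => simp
  | add u w hu hw => simp [hu, hw, add_mul]
  | single i c =>
    induction v using Finsupp.induction_linear with
    | zero => simp
    | add u w hu hw => simp [hu, hw, mul_add]
    | single j d =>
      simp only [tens2, lift_single, LinearMap.smul_apply, Finsupp.smul_apply, single_apply,
        Prod.mk.injEq, smul_eq_mul]
      split_ifs <;> simp_all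

theorem tens3_apply (u v w : D.V) (a b c : D.ι) : D.tens3 u v w (a, b, c) = u a * v b * w c := by
  classical
  induction u using Finsupp.induction_linear with
  | zero => simp
  | add u w hu hw => simp [hu, hw, add_mul]
  | single i x =>
    induction v using Finsupp.induction_linear with
    | zero => simp
    | add u w hu hw => simp [hu, hw, mul_add, add_mul]
    | single j y =>
      induction w using Finsupp.induction_linear with
      | zero => simp
      | add u w hu hw => simp [hu, hw, mul_add]
      | single k z =>
        simp only [tens3, lift_single, LinearMap.smul_apply, Finsupp.smul_apply, single_apply,
          Prod.mk.injEq, smul_eq_mul]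
        split_ifs <;> simp_all [mul_assoc]

theorem tau_apply (t : D.T2) (a b : D.ι) : D.tau t (a, b) = sg (D.par b) (D.par a) * t (b, a) := by
  classical
  induction t using Finsupp.induction_linear with
  | zero => simp
  | add t u ht hu => simp [ht, hu, mul_add]
  | single p c =>
    obtain ⟨i, j⟩ := p
    simp only [tau, lift_single, Finsupp.smul_apply, single_apply, Prod.mk.injEq, smul_eq_mul]
    split_ifs <;> simp_all [mul_comm]

theorem lift_hatData_br (cc : D.ι → D.ι → ℂ) (g : Option D.ι → ℂ) (i j : D.ι) :
    lift g ((hatData D cc).br (.some i) (.some j)) =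
      lift (fun k => g (.some k)) (D.br i j) + cc i j * g none := by
  simp [hatData, lift, Finsupp.linearCombination_mapDomain, Function.comp_def]

end SuperData

namespace NSHat

theorem lift_br (g : Option NSI → ℂ) (i j : Option NSI) :
    SuperData.lift g (NShd.br i j) = brEval g i j := by
  rcases i with _ | i
  · rcases j with _ | j <;> exact map_zero (Finsupp.linearCombination ℂ g)
  rcases j with _ | j
  · rcases i with _ | _ | _ <;> exact map_zero (Finsupp.linearCombination ℂ g)
  refine (lift_hatData_br (D := NSd) nsCC g i j).trans ?_
  change Finsupp.linearCombination ℂ (fun k => g (.some k)) (nsBr i j) + nsCC i j * g none = _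
  rcases i with m | m | ⟨_ | _, m⟩ <;> rcases j with n | n | ⟨_ | _, n⟩ <;>
    simp [nsBr, nsCC, brEval, sub_eq_add_neg]
  · ring
  · split_ifs with h
    · obtain rfl : n = -m - 1 := by omega
      push_cast
      ring
    · ring
  · ring

theorem brEval_skew (g : Option NSI → ℂ) (i j : Option NSI) :
    brEval g i j = -sgn i j * brEval g j i := by
  rcases i with _ | (m | m | ⟨_ | _, m⟩) <;> rcases j with _ | (n | n | ⟨_ | _, n⟩) <;>
    simp [brEval, sgn]
  all_goals rw [add_comm n m]
  all_goals try split_ifs with h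
  all_goals
    first
    | simp; done
    | have hn : n = -m := eq_neg_of_add_eq_zero_right h
      subst hn; push_cast; ring
    | have hn : n = -m - 1 :=
      eq_sub_of_add_eq (eq_neg_of_add_eq_zero_right ((add_assoc ..).symm.trans h))
      subst hn; push_cast; ring
    | ring

theorem brEval_single (i j a : Option NSI) :
    brEval (fun k => single k (1 : ℂ) a) i j = act i (fun p => single j (1 : ℂ) p) a := by
  rcases i with _ | (m | m | ⟨_ | _, m⟩) <;> rcases j with _ | (n | n | ⟨_ | _, n⟩) <;>
    rcases a with _ | (k | k | ⟨_ | _, k⟩) <;> simp [brEval, act, single_apply]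
  all_goals try split_ifs
  all_goals first | omega | simp; done | (subst_vars; push_cast; ring)

end NSHat

namespace SuperData

variable {D : SuperData}

theorem lift_single_apply {α : Type*} (v : α →₀ ℂ) (a : α) :
    lift (fun k => single k (1 : ℂ) a) v = v a := by
  classical
  simp +contextual [lift, linearCombination_apply, single_apply, eq_comm]

theorem map_apply_eq_lift {α : Type*} (f : D.V →ₗ[ℂ] (α →₀ ℂ)) (v : D.V) (a : α) :
    f v a = lift (fun i => f (D.e i) a) v := by
  induction v using Finsupp.induction_linear with
  | zero => simp
  | add u w hu hw => simp [hu, hw]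
  | single j c => rw [lift_single, show single j c = c • D.e j by simp [e], map_smul]; rfl

/-- `A` extends the adjoint action of the basis elements to all coefficient functions. -/
def IsAdjoint (D : SuperData) (A : D.ι → (D.ι → ℂ) →ₗ[ℂ] (D.ι → ℂ)) : Prop :=
  ∀ i j, ⇑(D.br i j) = A i ⇑(D.e j)

namespace IsAdjoint

variable {A : D.ι → (D.ι → ℂ) →ₗ[ℂ] (D.ι → ℂ)}

theorem brk_e_apply (hA : D.IsAdjoint A) (i : D.ι) (v : D.V) :
    ⇑(D.brk (D.e i) v) = A i v := by
  induction v using Finsupp.induction_linear with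
  | zero => simp
  | add u w hu hw => simp [hu, hw]
  | single j c =>
    rw [show single j c = c • D.e j by simp [e], map_smul, brk_e, Finsupp.coe_smul, hA,
      Finsupp.coe_smul, map_smul]

theorem star2_apply (hA : D.IsAdjoint A) (i : D.ι) (t : D.T2) (a b : D.ι) :
    D.star2 (D.e i) t (a, b) =
    A i (fun p => t (p, b)) a + sg (D.par i) (D.par a) * A i (fun q => t (a, q)) b := by
  have hadd (f g : D.ι → ℂ) : A i (fun p => f p + g p) = A i f + A i g := map_add (A i) f g
  have hmul {c : ℂ} {f g : D.ι → ℂ} (h : ∀ p, f p = c * g p) : A i f = c • A i g := by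
    rw [← map_smul]
    exact congrArg (A i) (funext h)
  induction t using Finsupp.induction_linear with
  | zero =>
    have h0 : A i (fun _ => 0) = 0 := map_zero (A i)
    simp [h0]
  | add t u ht hu =>
    simp only [map_add, Finsupp.add_apply, ht, hu, hadd, Pi.add_apply]
    ring
  | single p c =>
    obtain ⟨j, k⟩ := p
    rw [show single (j, k) c = c • D.tens2 (D.e j) (D.e k) by simp, map_smul,
      star2_tens2 i (homog1_e j)]
    have hl : A i (fun p => (c • D.tens2 (D.e j) (D.e k)) (p, b)) =
        (c * D.e k b) • A i (D.e j) := by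
      refine hmul fun p => ?_
      simp only [Finsupp.smul_apply, tens2_apply, smul_eq_mul]
      ring
    have hr : A i (fun q => (c • D.tens2 (D.e j) (D.e k)) (a, q)) =
        (c * D.e j a) • A i (D.e k) := by
      refine hmul fun p => ?_
      simp only [Finsupp.smul_apply, tens2_apply, smul_eq_mul]
      ring
    rw [hl, hr]
    simp only [Finsupp.smul_apply, Finsupp.add_apply, tens2_apply, hA.brk_e_apply, Pi.smul_apply,
      smul_eq_mul]
    by_cases h : j = a
    · subst h; ring
    · simp [e, single_eq_of_ne' h]; ring

theorem star3_apply (hA : D.IsAdjoint A) (i : D.ι) (t : D.T3) (a b c : D.ι) :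
    D.star3 (D.e i) t (a, b, c) =
    A i (fun p => t (p, b, c)) a + sg (D.par i) (D.par a) * A i (fun q => t (a, q, c)) b +
      sg (D.par i) (D.par a + D.par b) * A i (fun q => t (a, b, q)) c := by
  have hadd (f g : D.ι → ℂ) : A i (fun p => f p + g p) = A i f + A i g := map_add (A i) f g
  have hmul {c : ℂ} {f g : D.ι → ℂ} (h : ∀ p, f p = c * g p) : A i f = c • A i g := by
    rw [← map_smul]
    exact congrArg (A i) (funext h)
  induction t using Finsupp.induction_linear with
  | zero =>
    have h0 : A i (fun _ => 0) = 0 := map_zero (A i)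
    simp [h0]
  | add t u ht hu =>
    simp only [map_add, Finsupp.add_apply, ht, hu, hadd, Pi.add_apply]
    ring
  | single p d =>
    obtain ⟨j, k, l⟩ := p
    rw [show single (j, k, l) d = d • D.tens3 (D.e j) (D.e k) (D.e l) by simp, map_smul,
      star3_tens3 i (homog1_e j) (homog1_e k)]
    have h₁ : A i (fun p => (d • D.tens3 (D.e j) (D.e k) (D.e l)) (p, b, c)) =
        (d * D.e k b * D.e l c) • A i (D.e j) := by
      refine hmul fun p => ?_
      simp only [Finsupp.smul_apply, tens3_apply, smul_eq_mul]
      ring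
    have h₂ : A i (fun p => (d • D.tens3 (D.e j) (D.e k) (D.e l)) (a, p, c)) =
        (d * D.e j a * D.e l c) • A i (D.e k) := by
      refine hmul fun p => ?_
      simp only [Finsupp.smul_apply, tens3_apply, smul_eq_mul]
      ring
    have h₃ : A i (fun p => (d • D.tens3 (D.e j) (D.e k) (D.e l)) (a, b, p)) =
        (d * D.e j a * D.e k b) • A i (D.e l) := by
      refine hmul fun p => ?_
      simp only [Finsupp.smul_apply, tens3_apply, smul_eq_mul]
      ring
    rw [h₁, h₂, h₃]
    simp only [Finsupp.smul_apply, Finsupp.add_apply, tens3_apply, hA.brk_e_apply, Pi.smul_apply,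
      smul_eq_mul]
    by_cases h : j = a
    · subst h
      by_cases h : k = b
      · subst h; ring
      · simp [e, single_eq_of_ne' h]; ring
    · simp [e, single_eq_of_ne' h]; ring

end IsAdjoint

end SuperData

namespace NSHat

/-- The action `act` as a linear map. -/
def actHom (i : NShd.ι) : (NShd.ι → ℂ) →ₗ[ℂ] (NShd.ι → ℂ) where
  toFun g := act i g
  map_add' f g := funext fun a => act_add i a f g
  map_smul' c f := funext fun a => act_mul_left i a c f

theorem br_apply_eq_brEval (i j a : NShd.ι) :
    NShd.br i j a = brEval (fun k => single k (1 : ℂ) a) i j :=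
  (lift_single_apply (NShd.br i j) a).symm.trans (lift_br _ i j)

theorem br_apply (i j a : NShd.ι) : NShd.br i j a = act i (NShd.e j) a :=
  (br_apply_eq_brEval i j a).trans (brEval_single i j a)

theorem isAdjoint_actHom : NShd.IsAdjoint actHom := fun i j => funext (br_apply i j)

theorem par_eq (i : NShd.ι) : NShd.par i = (charge i : ZMod 2) := by
  rcases i with _ | (m | m | ⟨_ | _, m⟩) <;> rfl

theorem sg_par (i j : NShd.ι) : sg (NShd.par i) (NShd.par j) = sgn i j := by
  rcases i with _ | (m | m | ⟨_ | _, m⟩) <;> rcases j with _ | (n | n | ⟨_ | _, n⟩) <;>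
    simp [sg, sgn, NShd, NSd, hatData, nsPar]

theorem star2_apply (i : NShd.ι) (t : NShd.T2) (a b : NShd.ι) :
    NShd.star2 (NShd.e i) t (a, b) = act2 i (fun p q => t (p, q)) a b := by
  rw [isAdjoint_actHom.star2_apply, sg_par]; rfl

theorem isLieBasis : IsLieBasis NShd where
  parity i j a ha := by
    rw [Finsupp.mem_support_iff, br_apply] at ha
    obtain ⟨q, hq, -, -, hc⟩ := act_support ha
    obtain rfl : q = j := by
      by_contra h
      exact hq (single_eq_of_ne h)
    refine (par_eq a).trans ((congrArg (Int.cast : ℤ → ZMod 2) hc).symm.trans ?_)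
    rw [Int.cast_add, add_comm]
    exact congrArg₂ (· + ·) (par_eq i).symm (par_eq q).symm
  skew i j := by
    ext a
    rw [Finsupp.smul_apply, br_apply_eq_brEval i j, br_apply_eq_brEval j i, sg_par]
    exact brEval_skew _ i j
  jacobi i j k := by
    ext a
    have h := act_jacobi (NShd.e k) i j a
    have h₁ : NShd.brk (NShd.br i j) (NShd.e k) a = brEval (fun l => act l (NShd.e k) a) i j := by
      rw [← LinearMap.flip_apply, map_apply_eq_lift]
      simp only [LinearMap.flip_apply, isAdjoint_actHom.brk_e_apply]
      exact lift_br _ i j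
    rw [Finsupp.add_apply, Finsupp.smul_apply, isAdjoint_actHom.brk_e_apply, h₁, h,
      isAdjoint_actHom.brk_e_apply, isAdjoint_actHom i k, isAdjoint_actHom j k, sg_par]
    exact (sub_add_cancel _ _).symm

end NSHat

namespace SuperData

variable {D : SuperData} {r : D.T2}

theorem cybe_apply_diag (hD : IsLieBasis D) (hr : D.IsEven2 r) (ht : D.tau r = -r) {z : D.ι}
    (hz : D.par z = 0) : D.cybe r (z, z, z) = 0 := by
  have sg0 (a : ZMod 2) : sg a 0 = 1 ∧ sg 0 a = 1 := by simp [sg]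
  have hez (i : D.ι) (h : D.par i ≠ 0) : D.e i z = 0 :=
    single_eq_of_ne (by rintro rfl; exact h hz)
  have anti (Φ : D.ι × D.ι → D.ι × D.ι → ℂ) (h : ∀ p q : D.ι × D.ι, D.par p.2 = D.par p.1 →
      D.par q.2 = D.par q.1 → Φ p q = -Φ q p) : pairSum r Φ = 0 := by
    have h₁ : pairSum r Φ = pairSum r fun p q => Φ q p := pairSum_exchange Φ
    have h₂ : pairSum r Φ + pairSum r (fun p q => Φ q p) = 0 := by
      rw [← pairSum_add, pairSum_congr hr (Ψ := fun _ _ => 0)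
        fun p q hp hq => by rw [h p q hp hq]; ring]
      simp [pairSum, lift, linearCombination_apply]
    rw [← h₁] at h₂
    exact add_self_eq_zero.mp h₂
  have h₁ : pairSum r (fun p q => D.br p.1 q.1 z * D.e p.2 z * D.e q.2 z) = 0 :=
    anti _ fun p q hp hq => by
      by_cases hp0 : D.par p.2 = 0
      · rw [hD.skew, ← hp, hp0, (sg0 _).2]
        simp only [Finsupp.smul_apply, smul_eq_mul]; ring
      · simp [hez _ hp0]
  have h₃ : pairSum r (fun p q => D.e p.1 z * D.e q.1 z * D.br p.2 q.2 z) = 0 :=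
    anti _ fun p q hp hq => by
      by_cases hp0 : D.par p.1 = 0
      · rw [hD.skew, hp, hp0, (sg0 _).2]
        simp only [Finsupp.smul_apply, smul_eq_mul]; ring
      · simp [hez _ hp0]
  have h₂ : pairSum r (fun p q => D.e p.1 z * D.br p.2 q.1 z * D.e q.2 z) = 0 := by
    rw [pairSum_swap_left ht, ← neg_eq_zero, ← h₁, neg_eq_iff_eq_neg, ← neg_one_smul ℂ,
      ← LinearMap.lsmul_apply, map_pairSum]
    refine pairSum_congr hr fun p q hp hq => ?_
    by_cases hp0 : D.par p.2 = 0
    · simp only [hp0, (sg0 _).1, LinearMap.lsmul_apply, smul_eq_mul, Prod.fst_swap,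
        Prod.snd_swap]
      ring
    · simp [hez _ hp0]
  have key : D.cybe r (z, z, z) =
      pairSum r (fun p q => D.br p.1 q.1 z * D.e p.2 z * D.e q.2 z) +
      pairSum r (fun p q => D.e p.1 z * D.e q.1 z * D.br p.2 q.2 z) +
      pairSum r (fun p q => D.e p.1 z * D.br p.2 q.1 z * D.e q.2 z) := by
    rw [cybe_eq_pairSum, ← Finsupp.lapply_apply (R := ℂ), map_pairSum, ← pairSum_add, ← pairSum_add]
    refine pairSum_congr hr fun p q hp hq => ?_
    simp only [Finsupp.lapply_apply, Finsupp.add_apply, Finsupp.smul_apply, tens3_apply,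
      smul_eq_mul]
    by_cases hp0 : D.par p.2 = 0
    · rw [hp0, (sg0 _).1]; ring
    · rw [hez _ hp0, hez _ (fun h => hp0 (hp.trans h))]; ring
  rw [key, h₁, h₂, h₃]
  ring

end SuperData

namespace NSHat

theorem finite_mode_le (N : ℤ) : {a : Option NSI | |mode a| ≤ N}.Finite := by
  have hI := Set.finite_Icc (-N) N
  refine ((((hI.image NSI.L).union (hI.image NSI.I)).union
    ((hI.image (NSI.G true)).union (hI.image (NSI.G false)))).image Option.some).insert none
    |>.subset fun a ha => ?_
  rw [Set.mem_ofPred_eq, abs_le] at ha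
  rcases a with _ | (m | m | ⟨_ | _, m⟩) <;> simp_all [mode]

theorem bdd_coeff (t : NShd.T2) : Bdd fun a b => t (a, b) := by
  refine ⟨∑ p ∈ t.support, (|mode p.1| + |mode p.2|), fun a b h => ?_⟩
  have := Finset.single_le_sum (f := fun p : NShd.ι × NShd.ι => |mode p.1| + |mode p.2|)
    (fun p _ => by positivity) (Finsupp.mem_support_iff.mpr h)
  have h₁ := abs_nonneg (mode a)
  have h₂ := abs_nonneg (mode b)
  simp only at this
  constructor <;> linarith

theorem exists_coeff {R : Option NSI → Option NSI → ℂ} (hR : Bdd R) :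
    ∃ r : NShd.T2, ∀ a b, r (a, b) = R a b := by
  obtain ⟨N, hN⟩ := hR
  have hfin : (Function.support fun p : NShd.ι × NShd.ι => R p.1 p.2).Finite :=
    ((finite_mode_le N).prod (finite_mode_le N)).subset fun p hp => hN p.1 p.2 hp
  exact ⟨Finsupp.ofSupportFinite _ hfin, fun a b => rfl⟩

theorem exists_coboundary {Δ : NShd.V →ₗ[ℂ] NShd.T2}
    (h : ∀ i j, Δ (NShd.br i j) = NShd.star2 (NShd.e i) (Δ (NShd.e j)) -
      sg (NShd.par i) (NShd.par j) • NShd.star2 (NShd.e j) (Δ (NShd.e i))) :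
    ∃ r : NShd.T2, ∀ i, Δ (NShd.e i) = NShd.star2 (NShd.e i) r := by
  have hij (i j a b : NShd.ι) : Δ (NShd.br i j) (a, b) =
      act2 i (fun p q => Δ (NShd.e j) (p, q)) a b -
        sgn i j * act2 j (fun p q => Δ (NShd.e i) (p, q)) a b := by
    rw [h, Finsupp.sub_apply, Finsupp.smul_apply, star2_apply, star2_apply, sg_par, smul_eq_mul]
  have hc : IsCocycle fun i a b => Δ (NShd.e i) (a, b) := fun i j a b =>
    (lift_br _ i j).symm.trans
      ((map_apply_eq_lift (D := NShd) Δ (NShd.br i j) (a, b)).symm.trans (hij i j a b))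
  obtain ⟨R, hR, hD⟩ := hc.inner fun i => bdd_coeff _
  obtain ⟨r, hr⟩ := exists_coeff hR
  refine ⟨r, fun i => Finsupp.ext fun p => ?_⟩
  obtain ⟨a, b⟩ := p
  rw [star2_apply]
  refine (hD i a b).trans ?_
  exact congrArg (fun T => act2 i T a b) (funext fun a => funext fun b => (hr a b).symm)

theorem star2_support {i : NShd.ι} {t : NShd.T2} {a b : NShd.ι}
    (h : NShd.star2 (NShd.e i) t (a, b) ≠ 0) :
    ∃ p ∈ t.support, NShd.par p.1 + NShd.par p.2 + NShd.par i = NShd.par a + NShd.par b := by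
  rw [star2_apply] at h
  obtain ⟨p, q, hpq, -, -, -, hc⟩ := act2_support h
  have hc' := congrArg (Int.cast : ℤ → ZMod 2) hc
  rw [Int.cast_add, Int.cast_add, Int.cast_add] at hc'
  refine ⟨(p, q), Finsupp.mem_support_iff.mpr hpq, ?_⟩
  exact (congrArg₂ (· + ·) (congrArg₂ (· + ·) (par_eq p) (par_eq q)) (par_eq i)).trans
    (hc'.trans (congrArg₂ (· + ·) (par_eq a) (par_eq b)).symm)

theorem exists_even_coboundary {Δ : NShd.V →ₗ[ℂ] NShd.T2}
    (he : ∀ (s : ZMod 2) (x : NShd.V), NShd.Homog1 s x → NShd.Homog2 s (Δ x)) {r₀ : NShd.T2}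
    (h : ∀ i, Δ (NShd.e i) = NShd.star2 (NShd.e i) r₀) :
    ∃ r : NShd.T2, NShd.IsEven2 r ∧ ∀ i, Δ (NShd.e i) = NShd.star2 (NShd.e i) r := by
  classical
  let P : NShd.ι × NShd.ι → Prop := fun p => NShd.par p.1 + NShd.par p.2 = 0
  have heven : NShd.IsEven2 (r₀.filter P) := fun p hp => by
    rw [Finsupp.support_filter] at hp
    exact (Finset.mem_filter.mp hp).2
  refine ⟨r₀.filter P, heven, fun i => Finsupp.ext fun ⟨a, b⟩ => ?_⟩
  by_cases hab : NShd.par a + NShd.par b = NShd.par i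
  · rw [h]
    conv_lhs => rw [← Finsupp.filter_add_filter_not r₀ P]
    rw [map_add, Finsupp.add_apply, add_eq_left]
    by_contra hne
    obtain ⟨p, hp, hpar⟩ := star2_support hne
    rw [hab, add_eq_right] at hpar
    rw [Finsupp.support_filter] at hp
    exact (Finset.mem_filter.mp hp).2 hpar
  · have h₁ : Δ (NShd.e i) (a, b) = 0 := by
      by_contra hne
      exact hab (he _ _ (homog1_e i) (a, b) (Finsupp.mem_support_iff.mpr hne))
    rw [h₁]
    by_contra hne
    obtain ⟨p, hp, hpar⟩ := star2_support (Ne.symm hne)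
    rw [heven p hp, zero_add] at hpar
    exact hab hpar.symm

theorem invariant3_eq_zero {T : Option NSI → Option NSI → Option NSI → ℂ} {N : ℤ}
    (hN : ∀ a b c, T a b c ≠ 0 → |mode a| ≤ N ∧ |mode b| ≤ N ∧ |mode c| ≤ N)
    (h : ∀ i a b c, ∃ x y : ℂ, x ≠ 0 ∧ y ≠ 0 ∧ act i (fun p => T p b c) a +
      x * act i (fun p => T a p c) b + y * act i (fun p => T a b p) c = 0)
    (a b c : Option NSI) (habc : a ≠ none ∨ b ≠ none ∨ c ≠ none) : T a b c = 0 := by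
  have h₁ (p : NSI) (b c : Option NSI) : T (.some p) b c = 0 :=
    act_far (g := fun p => T p b c) (N := N) (fun i a ha => by
      have hz (b c) : T a b c = 0 := by
        by_contra hne
        exact (hN a b c hne).1.not_gt ha
      obtain ⟨x, y, -, -, hxy⟩ := h i a b c
      simpa only [hz, act_zero, mul_zero, add_zero] using hxy) p
  have h₂ (a : Option NSI) (p : NSI) (c : Option NSI) : T a (.some p) c = 0 :=
    act_far (g := fun p => T a p c) (N := N) (fun i b hb => by
      have hz (a c) : T a b c = 0 := by
        by_contra hne
        exact (hN a b c hne).2.1.not_gt hb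
      obtain ⟨x, y, hx, -, hxy⟩ := h i a b c
      simpa only [hz, act_zero, mul_zero, add_zero, zero_add, mul_eq_zero, hx, false_or]
        using hxy) p
  have h₃ (a b : Option NSI) (p : NSI) : T a b (.some p) = 0 :=
    act_far (g := fun p => T a b p) (N := N) (fun i c hc => by
      have hz (a b) : T a b c = 0 := by
        by_contra hne
        exact (hN a b c hne).2.2.not_gt hc
      obtain ⟨x, y, -, hy, hxy⟩ := h i a b c
      simpa only [hz, act_zero, mul_zero, zero_add, mul_eq_zero, hy, false_or] using hxy) p
  rcases a with _ | a
  · rcases b with _ | b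
    · rcases c with _ | c
      · simp at habc
      · exact h₃ _ _ c
    · exact h₂ _ b _
  · exact h₁ a _ _

theorem eq_zero_of_star3 {t : NShd.T3} (h : ∀ i, NShd.star3 (NShd.e i) t = 0)
    (h0 : t ((none : Option NSI), (none : Option NSI), (none : Option NSI)) = 0) : t = 0 := by
  have hN (a b c : NShd.ι) (h : t (a, b, c) ≠ 0) :
      |mode a| ≤ ∑ p ∈ t.support, (|mode p.1| + |mode p.2.1| + |mode p.2.2|) ∧
      |mode b| ≤ ∑ p ∈ t.support, (|mode p.1| + |mode p.2.1| + |mode p.2.2|) ∧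
      |mode c| ≤ ∑ p ∈ t.support, (|mode p.1| + |mode p.2.1| + |mode p.2.2|) := by
    have := Finset.single_le_sum
      (f := fun p : NShd.ι × NShd.ι × NShd.ι => |mode p.1| + |mode p.2.1| + |mode p.2.2|)
      (fun p _ => by positivity) (Finsupp.mem_support_iff.mpr h)
    have h₁ := abs_nonneg (mode a)
    have h₂ := abs_nonneg (mode b)
    have h₃ := abs_nonneg (mode c)
    simp only at this
    refine ⟨?_, ?_, ?_⟩ <;> linarith
  have hsg (x y : ZMod 2) : sg x y ≠ 0 := by rw [sg]; split_ifs <;> norm_num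
  have hs (i a b c : NShd.ι) :=
    (isAdjoint_actHom.star3_apply i t a b c).symm.trans (DFunLike.congr_fun (h i) (a, b, c))
  ext ⟨a, b, c⟩
  by_cases habc : a ≠ (none : Option NSI) ∨ b ≠ (none : Option NSI) ∨ c ≠ (none : Option NSI)
  · exact invariant3_eq_zero (T := fun a b c => t (a, b, c)) hN
      (fun i a b c => ⟨_, _, hsg _ _, hsg _ _, hs i a b c⟩) a b c habc
  · push Not at habc
    obtain ⟨rfl, rfl, rfl⟩ := habc
    exact h0

end NSHat

/-- every Lie superbialgebra structure on the full `N=2` superconformal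
Neveu–Schwarz algebra (with central element `C`) is triangular coboundary. -/
theorem NShat_bialgebra_triangular_coboundary (Δf : NShd.V →ₗ[ℂ] NShd.T2)
    (h : NShd.IsSBialg Δf) :
    ∃ r : NShd.T2, NShd.IsEven2 r ∧ r ∈ NShd.ImSkew ∧ NShd.cybe r = 0 ∧
      ∀ x : NShd.V, Δf x = NShd.star2 x r := by
  obtain ⟨heven, hskew, hcoj, hder⟩ := h
  obtain ⟨r₀, hr₀⟩ := NSHat.exists_coboundary hder
  obtain ⟨r₁, he₁, hr₁⟩ := NSHat.exists_even_coboundary heven hr₀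
  set r : NShd.T2 := (1 / 2 : ℂ) • (r₁ - NShd.tau r₁) with hr
  have ht : NShd.tau r = -r := by
    rw [hr, map_smul, map_sub, tau_tau, ← smul_neg, neg_sub]
  have he : NShd.IsEven2 r := by
    intro p hp
    by_contra hne
    have h₁ : r₁ (p.1, p.2) = 0 := by
      by_contra h₁
      exact hne (he₁ _ (Finsupp.mem_support_iff.mpr h₁))
    have h₂ : r₁ (p.2, p.1) = 0 := by
      by_contra h₁
      exact hne ((add_comm _ _).trans (he₁ _ (Finsupp.mem_support_iff.mpr h₁)))
    refine Finsupp.mem_support_iff.mp hp ?_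
    rw [hr, Finsupp.smul_apply, Finsupp.sub_apply, ← Prod.mk.eta (p := p), tau_apply, h₁, h₂]
    simp
  have hi (i : NShd.ι) : Δf (NShd.e i) = NShd.star2 (NShd.e i) r := by
    have := tau_eq_neg_of_mem_imSkew (hskew (NShd.e i))
    rw [hr, map_smul, map_sub, ← tau_star2 NSHat.isLieBasis, ← hr₁, this]
    module
  have hΔ : Δf = NShd.star2.flip r := Finsupp.lhom_ext' fun i => LinearMap.ext_ring (hi i)
  refine ⟨r, he, ⟨(1 / 2 : ℂ) • r₁, ?_⟩, ?_, fun x => by rw [hΔ]; rfl⟩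
  · rw [LinearMap.sub_apply, LinearMap.id_apply, map_smul, ← smul_sub]
  · refine NSHat.eq_zero_of_star3 (fun i => ?_) (cybe_apply_diag NSHat.isLieBasis he ht rfl)
    rw [← oneDelta_cyclic NSHat.isLieBasis he ht, ← hi, ← hΔ]
    exact hcoj _
end
end

section
/- All derivations from the centerless N=2 superconformal Neveu-Schwarz algebra L to L⊗L vanishing on L_0 and defined by D(L_n) = (nα+γ)I_0⊗I_n + (nα†−γ)I_n⊗I_0, D(I_n) = βI_0⊗I_n + β†I_n⊗I_0 on the even part, must satisfy α = α† = γ = β = β† = 0 when extended to a derivation on all of L; moreover the extension satisfies D(G_r^±) = a(I_0⊗G_r^± + G_r^±⊗I_0) with a single scalar a satisfying a = a⁺ = −a⁻. -/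
noncomputable section
open Finsupp

open SuperData

/-- `f : L → L⊗L` is homogeneous of (doubled) degree `i2` with respect to the
`½ℤ`-grading of the Neveu–Schwarz algebra. -/
def HomogDeg (i2 : ℤ) (f : NSd.V →ₗ[ℂ] NSd.T2) : Prop :=
  ∀ (j : NSI), ∀ p ∈ (f (NSd.e j)).support, deg2 p.1 + deg2 p.2 = i2 + deg2 j

/-- A vector in `V ⊗ V` has only finitely many nonzero coefficients along an injective family. -/
lemma exists_bound_of_injective {κ : Type*} (t : κ →₀ ℂ) (g : ℤ → κ)
    (hg : Function.Injective g) : ∃ N : ℤ, ∀ i, N ≤ |i| → t (g i) = 0 := by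
  obtain ⟨N, hN⟩ := ((t.support.preimage g hg.injOn).image fun i => |i|).bddAbove
  refine ⟨N + 1, fun i hi => ?_⟩
  by_contra h
  have := hN (show |i| ∈ _ by
    simp only [Finset.coe_image, Set.mem_image, Finset.mem_coe, Finset.mem_preimage]
    exact ⟨i, by simpa using h, rfl⟩)
  omega

/-- The recurrences satisfied by the coefficients of `L_i ⊗ G_{k-i}` (namely `a k i`) and of
`I_i ⊗ G_{k-i}` (namely `b k i`) force the even-part parameters to vanish. -/
lemma coefficient_recurrence (a b : ℤ → ℤ → ℂ) (α α' γ β β' : ℂ)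
    (hfa : ∃ N : ℤ, ∀ i, N ≤ |i| → a 0 i = 0) (hfb : ∃ N : ℤ, ∀ i, N ≤ |i| → b 0 i = 0)
    (ha : ∀ k m i, a (m + k) i = a k i)
    (hb : ∀ k m i, b (m + k) i = b k i + m * a k (i - m) +
      (if i = 0 then β else 0) + (if i = m then β' else 0))
    (hL : ∀ k m i : ℤ, ((m : ℂ) - 2 * k - 1) / 2 * b (m + k) i =
      -((i : ℂ) - m) * b k (i - m) + ((m : ℂ) - 2 * (k - i) - 1) / 2 * b k i +
      (if i = 0 then m * α + γ else 0) + (if i = m then m * α' - γ else 0)) :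
    (α = 0 ∧ α' = 0 ∧ γ = 0 ∧ β = 0 ∧ β' = 0) ∧ (∀ k i, a k i = 0) ∧
      (∀ k i, i ≠ 0 → b k i = 0) ∧ ∀ k, b k 0 = b 0 0 := by
  have ha0 : ∀ k i, a k i = a 0 i := fun k i => by simpa using ha 0 k i
  have hββ : β + β' = 0 := by simpa [add_assoc] using hb 0 0 0
  have key : ∀ m i : ℤ, ((m : ℂ) + 1) * a 0 (i - m - 1) + (if i = m + 1 then β' else 0) =
      a 0 (i - 1) + m * a 0 (i - m) + (if i = 0 then β else 0) + (if i = 1 then β' else 0) +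
      (if i = m then β' else 0) := by
    intro m i
    have h1 := hb 0 1 i
    have h2 := hb 1 m i
    have h3 := hb 0 (m + 1) i
    rw [ha0] at h2
    simp only [add_zero, ← sub_sub] at h1 h2 h3
    push_cast at h1 h3
    linear_combination h2 + h1 - h3
  obtain ⟨N, hN⟩ := hfa
  have step : ∀ j : ℤ, j ≠ 0 → j ≠ 1 → a 0 j = 0 ∧ a 0 (j - 1) = 0 := by
    intro j h0 h1
    have rel : ∀ m : ℤ, |N| + |j| + 3 ≤ m → ((m : ℂ) + 1) * a 0 (j - 1) = m * a 0 j := by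
      intro m hm
      have hN' := le_abs_self N
      have hN'' := abs_nonneg N
      have hj := neg_abs_le j
      have h := key m (j + m)
      rw [hN (j + m - 1) (le_trans (by omega) (le_abs_self _)), if_neg (by omega),
        if_neg (by omega), if_neg (by omega), if_neg (by omega)] at h
      simpa using h
    have e1 := rel (|N| + |j| + 3) le_rfl
    have e2 := rel (|N| + |j| + 4) (by omega)
    generalize |N| + |j| = q at e1 e2
    push_cast at e1 e2
    have e3 : a 0 (j - 1) = a 0 j := by linear_combination e2 - e1
    rw [e3] at e1 ⊢
    have : a 0 j = 0 := by linear_combination e1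
    exact ⟨this, this⟩
  have hβ'm : ∀ m : ℤ, 2 < m → (m : ℂ) * a 0 0 + β' = 0 := by
    intro m hm
    have h := key m m
    rw [if_neg (by omega), if_neg (by omega), if_neg (by omega), if_pos rfl, sub_self,
      (step (0 - 1) (by omega) (by omega)).1, (step (m - 1) (by omega) (by omega)).1] at h
    linear_combination -h
  have e3 := hβ'm 3 (by omega)
  have e4 := hβ'm 4 (by omega)
  push_cast at e3 e4
  have a00 : a 0 0 = 0 := by linear_combination e4 - e3
  have hβ' : β' = 0 := by linear_combination 4 * e3 - 3 * e4
  have hβ : β = 0 := by linear_combination hββ - hβ'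
  have hall : ∀ k i, a k i = 0 := by
    intro k i
    rw [ha0]
    rcases eq_or_ne i 0 with rfl | h0
    · exact a00
    rcases eq_or_ne i 1 with rfl | h1
    · exact (step 2 (by omega) (by omega)).2
    · exact (step i h0 h1).1
  have hb0 : ∀ k i, b k i = b 0 i := fun k i => by
    simpa [hall, hβ, hβ'] using hb 0 k i
  have hLb : ∀ m i : ℤ, (i : ℂ) * b 0 i = ((i : ℂ) - m) * b 0 (i - m) -
      (if i = 0 then m * α + γ else 0) - (if i = m then m * α' - γ else 0) := by
    intro m i
    have h := hL 0 m i
    rw [hb0] at h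
    push_cast at h
    linear_combination -h
  obtain ⟨M, hM⟩ := hfb
  have hu : ∀ i : ℤ, i ≠ 0 → b 0 i = 0 := by
    intro i hi
    have hM' := le_abs_self M
    have hM'' := abs_nonneg M
    have hi' := le_abs_self i
    have h := hLb (|M| + |i| + 1) i
    rw [hM (i - _) (le_trans (by omega) (neg_le_abs _)), if_neg hi, if_neg (by omega)] at h
    have : (i : ℂ) ≠ 0 := by exact_mod_cast hi
    simpa [this] using h
  have p1 := hLb 1 0
  have p2 := hLb 2 0
  have p3 := hLb 1 1
  norm_num [hu] at p1 p2 p3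
  have hα : α = 0 := by linear_combination p2 - p1
  have hγ : γ = 0 := by linear_combination p1 - hα
  refine ⟨⟨hα, ?_, hγ, hβ, hβ'⟩, hall, fun k i hi => by rw [hb0, hu i hi], fun k => hb0 k 0⟩
  linear_combination hγ + p3

lemma SuperData.tens2_apply_s18 (D : SuperData) (A B : D.V) (u v : D.ι) :
    D.tens2 A B (u, v) = A u * B v := by
  classical
  induction A using Finsupp.induction_linear with
  | zero => simp
  | add x y hx hy => simp [hx, hy, add_mul]
  | single i c =>
    induction B using Finsupp.induction_linear with
    | zero => simp
    | add x y hx hy => simp [hx, hy, mul_add]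
    | single j d =>
      simp only [tens2, lift, linearCombination_single, LinearMap.smul_apply, Finsupp.smul_apply,
        Finsupp.single_apply, Prod.mk.injEq, smul_eq_mul]
      split_ifs <;> simp_all

lemma SuperData.star2_single_apply (D : SuperData) (x y z u v : D.ι) (c : ℂ) :
    D.star2 (D.e x) (Finsupp.single (y, z) c) (u, v) =
      c * (D.br x y u * D.e z v + sg (D.par x) (D.par y) * (D.e y u * D.br x z v)) := by
  simp [star2, lift, e, tens2_apply_s18, mul_add]

/-- The linear functional sending `T ∈ V ⊗ V` to the coefficient of `u ⊗ v` in `x ∗ T`. -/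
def actCoeff (x u v : NSI) : (NSI × NSI →₀ ℂ) →ₗ[ℂ] ℂ :=
  Finsupp.linearCombination ℂ fun p =>
    nsBr x p.1 u * (if p.2 = v then 1 else 0) +
      sg (nsPar x) (nsPar p.1) * ((if p.1 = u then 1 else 0) * nsBr x p.2 v)

lemma actCoeff_single (x u v : NSI) (p : NSI × NSI) (c : ℂ) :
    actCoeff x u v (Finsupp.single p c) = c * (nsBr x p.1 u * (if p.2 = v then 1 else 0) +
      sg (nsPar x) (nsPar p.1) * ((if p.1 = u then 1 else 0) * nsBr x p.2 v)) := by
  simp [actCoeff]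

lemma star2_NSd_apply (x u v : NSI) (T : NSI × NSI →₀ ℂ) :
    NSd.star2 (NSd.e x) T (u, v) = actCoeff x u v T := by
  induction T using Finsupp.induction_linear with
  | zero => exact congrArg (fun g : NSd.T2 => g (u, v)) (map_zero (NSd.star2 (NSd.e x)))
  | add T₁ T₂ h₁ h₂ =>
    rw [map_add, ← h₁, ← h₂]
    exact congrArg (fun g : NSd.T2 => g (u, v)) (map_add (NSd.star2 (NSd.e x)) T₁ T₂)
  | single p c =>
    rw [actCoeff_single]
    refine (NSd.star2_single_apply x p.1 p.2 u v c).trans ?_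
    rw [← Finsupp.single_apply, ← Finsupp.single_apply]
    rfl

/-- The derivation property, read off in coefficients. -/
lemma der_coeff {f : NSd.V →ₗ[ℂ] NSd.T2} (hder : NSd.IsDer2 0 f)
    (F : NSI → NSI × NSI →₀ ℂ) (hF : ∀ x, F x = f (NSd.e x)) (x y u v : NSI) :
    Finsupp.linearCombination ℂ (fun z => F z (u, v)) (nsBr x y) =
      actCoeff x u v (F y) - sg (nsPar y) (nsPar x) * actCoeff y u v (F x) := by
  have key : ∀ A : NSI →₀ ℂ, Finsupp.linearCombination ℂ (fun z => F z (u, v)) A =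
      f A (u, v) := by
    intro A
    induction A using Finsupp.induction_linear with
    | zero => exact (congrArg (fun g : NSd.T2 => g (u, v)) (map_zero f)).symm
    | add A₁ A₂ h₁ h₂ =>
      rw [map_add, h₁, h₂]
      exact (congrArg (fun g : NSd.T2 => g (u, v)) (map_add f A₁ A₂)).symm
    | single z c =>
      rw [Finsupp.linearCombination_single, hF]
      have : (Finsupp.single z c : NSd.V) = c • NSd.e z := by
        exact (by simp : Finsupp.single z c = c • Finsupp.single z 1)
      refine Eq.trans ?_ (congrArg (fun g : NSd.V => f g (u, v)) this).symm
      exact (congrArg (fun g : NSd.T2 => g (u, v)) (map_smul f c (NSd.e z))).symm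
  rw [key, ← star2_NSd_apply, ← star2_NSd_apply, hF, hF]
  have h := congrArg (fun g : NSd.T2 => g (u, v)) (hder x y)
  refine h.trans ?_
  have : sg 0 (nsPar x) = 1 := by simp [sg]
  change sg 0 (nsPar x) * _ - sg (nsPar y) (0 + nsPar x) * _ = _
  rw [this, zero_add, one_mul]

/-- The `I_0`-weight of `G^±`. -/
def wt (s : Bool) : ℂ := if s then 1 else -1

lemma actCoeff_I_apply_L_G (m i j : ℤ) (s : Bool) (T : NSI × NSI →₀ ℂ) :
    actCoeff (.I m) (.L i) (.G s j) T =
      wt s * T (.L i, .G s (j - m)) := by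
  induction T using Finsupp.induction_linear with
  | zero => simp
  | add x y hx hy => rw [map_add, hx, hy]; simp only [Finsupp.add_apply]; ring
  | single p c =>
    rw [actCoeff_single]
    obtain ⟨y | y | ⟨_ | _, y⟩, z | z | ⟨_ | _, z⟩⟩ := p <;> cases s <;>
      simp [nsBr, nsPar, sg, Finsupp.single_apply, wt, eq_sub_iff_add_eq'] <;>
      grind

lemma actCoeff_I_apply_G_L (m i j : ℤ) (s : Bool) (T : NSI × NSI →₀ ℂ) :
    actCoeff (.I m) (.G s j) (.L i) T =
      wt s * T (.G s (j - m), .L i) := by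
  induction T using Finsupp.induction_linear with
  | zero => simp
  | add x y hx hy => rw [map_add, hx, hy]; simp only [Finsupp.add_apply]; ring
  | single p c =>
    rw [actCoeff_single]
    obtain ⟨y | y | ⟨_ | _, y⟩, z | z | ⟨_ | _, z⟩⟩ := p <;> cases s <;>
      simp [nsBr, nsPar, sg, Finsupp.single_apply, wt, eq_sub_iff_add_eq'] <;>
      grind

lemma actCoeff_I_apply_I_G (m i j : ℤ) (s : Bool) (T : NSI × NSI →₀ ℂ) :
    actCoeff (.I m) (.I i) (.G s j) T =
      m * T (.L (i - m), .G s j) + wt s * T (.I i, .G s (j - m)) := by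
  induction T using Finsupp.induction_linear with
  | zero => simp
  | add x y hx hy => rw [map_add, hx, hy]; simp only [Finsupp.add_apply]; ring
  | single p c =>
    rw [actCoeff_single]
    obtain ⟨y | y | ⟨_ | _, y⟩, z | z | ⟨_ | _, z⟩⟩ := p <;> cases s <;>
      simp [nsBr, nsPar, sg, Finsupp.single_apply, wt, eq_sub_iff_add_eq'] <;>
      grind

lemma actCoeff_I_apply_G_I (m i j : ℤ) (s : Bool) (T : NSI × NSI →₀ ℂ) :
    actCoeff (.I m) (.G s j) (.I i) T =
      m * T (.G s j, .L (i - m)) + wt s * T (.G s (j - m), .I i) := by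
  induction T using Finsupp.induction_linear with
  | zero => simp
  | add x y hx hy => rw [map_add, hx, hy]; simp only [Finsupp.add_apply]; ring
  | single p c =>
    rw [actCoeff_single]
    obtain ⟨y | y | ⟨_ | _, y⟩, z | z | ⟨_ | _, z⟩⟩ := p <;> cases s <;>
      simp [nsBr, nsPar, sg, Finsupp.single_apply, wt, eq_sub_iff_add_eq'] <;>
      grind

lemma actCoeff_L_apply_I_G (m i j : ℤ) (s : Bool) (T : NSI × NSI →₀ ℂ) :
    actCoeff (.L m) (.I i) (.G s j) T =
      -((i : ℂ) - m) * T (.I (i - m), .G s j) +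
        ((m : ℂ) - 2 * (j - m) - 1) / 2 * T (.I i, .G s (j - m)) := by
  obtain ⟨i, rfl⟩ : ∃ i', i = m + i' := ⟨i - m, by ring⟩
  obtain ⟨j, rfl⟩ : ∃ j', j = m + j' := ⟨j - m, by ring⟩
  induction T using Finsupp.induction_linear with
  | zero => simp
  | add x y hx hy => rw [map_add, hx, hy]; simp only [Finsupp.add_apply]; ring
  | single p c =>
    rw [actCoeff_single]
    obtain ⟨y | y | ⟨_ | _, y⟩, z | z | ⟨_ | _, z⟩⟩ := p <;> cases s <;>
      simp [nsBr, nsPar, sg, Finsupp.single_apply] <;>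
      grind

lemma actCoeff_L_apply_G_I (m i j : ℤ) (s : Bool) (T : NSI × NSI →₀ ℂ) :
    actCoeff (.L m) (.G s j) (.I i) T =
      -((i : ℂ) - m) * T (.G s j, .I (i - m)) +
        ((m : ℂ) - 2 * (j - m) - 1) / 2 * T (.G s (j - m), .I i) := by
  obtain ⟨i, rfl⟩ : ∃ i', i = m + i' := ⟨i - m, by ring⟩
  obtain ⟨j, rfl⟩ : ∃ j', j = m + j' := ⟨j - m, by ring⟩
  induction T using Finsupp.induction_linear with
  | zero => simp
  | add x y hx hy => rw [map_add, hx, hy]; simp only [Finsupp.add_apply]; ring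
  | single p c =>
    rw [actCoeff_single]
    obtain ⟨y | y | ⟨_ | _, y⟩, z | z | ⟨_ | _, z⟩⟩ := p <;> cases s <;>
      simp [nsBr, nsPar, sg, Finsupp.single_apply] <;>
      grind

section Constraints

variable {F : NSI → NSI × NSI →₀ ℂ} {α α' γ β β' : ℂ}

lemma even_odd_coefficients_right
    (hd : ∀ x y u v, Finsupp.linearCombination ℂ (fun z => F z (u, v)) (nsBr x y) =
      actCoeff x u v (F y) - sg (nsPar y) (nsPar x) * actCoeff y u v (F x))
    (hL : ∀ n : ℤ, F (.L n) =
      Finsupp.single (.I 0, .I n) (n * α + γ) + Finsupp.single (.I n, .I 0) (n * α' - γ))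
    (hI : ∀ n : ℤ, F (.I n) =
      Finsupp.single (.I 0, .I n) β + Finsupp.single (.I n, .I 0) β') (s : Bool) :
    (wt s * α = 0 ∧ wt s * α' = 0 ∧ wt s * γ = 0 ∧ β = 0 ∧ β' = 0) ∧
      (∀ k i, wt s * F (.G s k) (.L i, .G s (k - i)) = 0) ∧
      (∀ k i, i ≠ 0 → F (.G s k) (.I i, .G s (k - i)) = 0) ∧
      ∀ k, F (.G s k) (.I 0, .G s (k - 0)) = F (.G s 0) (.I 0, .G s (0 - 0)) := by
  refine coefficient_recurrence (fun k i => wt s * F (.G s k) (.L i, .G s (k - i)))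
    (fun k i => F (.G s k) (.I i, .G s (k - i))) _ _ _ _ _ ?_ ?_ ?_ ?_ ?_
  · obtain ⟨N, hN⟩ := exists_bound_of_injective (F (.G s 0)) (fun i => (.L i, .G s (0 - i)))
      fun i j h => by simpa using h
    exact ⟨N, fun i hi => mul_eq_zero_of_right _ (hN i hi)⟩
  · exact exists_bound_of_injective (F (.G s 0)) (fun i => (.I i, .G s (0 - i)))
      fun i j h => by simpa using h
  · intro k m i
    have h := hd (.I m) (.G s k) (.L i) (.G s (m + k - i))
    rw [actCoeff_I_apply_L_G, hI, map_add, actCoeff_single, actCoeff_single,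
      show m + k - i - m = k - i by ring] at h
    cases s <;> simp [nsBr, nsPar, sg, wt, Finsupp.single_apply] at h ⊢ <;> linear_combination h
  · intro k m i
    have h := hd (.I m) (.G s k) (.I i) (.G s (m + k - i))
    rw [actCoeff_I_apply_I_G, hI, map_add, actCoeff_single, actCoeff_single,
      show m + k - i - m = k - i by ring, show m + k - i = k - (i - m) by ring] at h
    rw [show m + k - i = k - (i - m) by ring]
    have e₁ : m + k = k - (i - m) ↔ i = 0 := by omega
    have e₂ : k = k - (i - m) ↔ i = m := by omega
    cases s <;> simp [nsBr, nsPar, sg, wt, Finsupp.single_apply] at h ⊢ <;>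
      simp only [e₁, e₂, eq_comm (b := i)] at h ⊢ <;> split_ifs at h ⊢ <;>
      first | linear_combination h | linear_combination -h
  · intro k m i
    have h := hd (.L m) (.G s k) (.I i) (.G s (m + k - i))
    rw [actCoeff_L_apply_I_G, hL, map_add, actCoeff_single, actCoeff_single,
      show m + k - i - m = k - i by ring, show m + k - i = k - (i - m) by ring] at h
    rw [show m + k - i = k - (i - m) by ring]
    have e₁ : m + k = k - (i - m) ↔ i = 0 := by omega
    have e₂ : k = k - (i - m) ↔ i = m := by omega
    cases s <;> simp [nsBr, nsPar, sg, wt, Finsupp.single_apply] at h ⊢ <;>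
      simp only [e₁, e₂, eq_comm (b := i)] at h ⊢ <;> split_ifs at h ⊢ <;>
      linear_combination h

lemma even_odd_coefficients_left
    (hd : ∀ x y u v, Finsupp.linearCombination ℂ (fun z => F z (u, v)) (nsBr x y) =
      actCoeff x u v (F y) - sg (nsPar y) (nsPar x) * actCoeff y u v (F x))
    (hL : ∀ n : ℤ, F (.L n) =
      Finsupp.single (.I 0, .I n) (n * α + γ) + Finsupp.single (.I n, .I 0) (n * α' - γ))
    (hI : ∀ n : ℤ, F (.I n) =
      Finsupp.single (.I 0, .I n) β + Finsupp.single (.I n, .I 0) β') (s : Bool) :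
    (wt s * α' = 0 ∧ wt s * α = 0 ∧ wt s * -γ = 0 ∧ β' = 0 ∧ β = 0) ∧
      (∀ k i, wt s * F (.G s k) (.G s (k - i), .L i) = 0) ∧
      (∀ k i, i ≠ 0 → F (.G s k) (.G s (k - i), .I i) = 0) ∧
      ∀ k, F (.G s k) (.G s (k - 0), .I 0) = F (.G s 0) (.G s (0 - 0), .I 0) := by
  refine coefficient_recurrence (fun k i => wt s * F (.G s k) (.G s (k - i), .L i))
    (fun k i => F (.G s k) (.G s (k - i), .I i)) _ _ _ _ _ ?_ ?_ ?_ ?_ ?_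
  · obtain ⟨N, hN⟩ := exists_bound_of_injective (F (.G s 0)) (fun i => (.G s (0 - i), .L i))
      fun i j h => by simpa using h
    exact ⟨N, fun i hi => mul_eq_zero_of_right _ (hN i hi)⟩
  · exact exists_bound_of_injective (F (.G s 0)) (fun i => (.G s (0 - i), .I i))
      fun i j h => by simpa using h
  · intro k m i
    have h := hd (.I m) (.G s k) (.G s (m + k - i)) (.L i)
    rw [actCoeff_I_apply_G_L, hI, map_add, actCoeff_single, actCoeff_single,
      show m + k - i - m = k - i by ring] at h
    cases s <;> simp [nsBr, nsPar, sg, wt, Finsupp.single_apply] at h ⊢ <;> linear_combination h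
  · intro k m i
    have h := hd (.I m) (.G s k) (.G s (m + k - i)) (.I i)
    rw [actCoeff_I_apply_G_I, hI, map_add, actCoeff_single, actCoeff_single,
      show m + k - i - m = k - i by ring, show m + k - i = k - (i - m) by ring] at h
    rw [show m + k - i = k - (i - m) by ring]
    have e₁ : m + k = k - (i - m) ↔ i = 0 := by omega
    have e₂ : k = k - (i - m) ↔ i = m := by omega
    cases s <;> simp [nsBr, nsPar, sg, wt, Finsupp.single_apply] at h ⊢ <;>
      simp only [e₁, e₂, eq_comm (b := i)] at h ⊢ <;> split_ifs at h ⊢ <;>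
      first | linear_combination h | linear_combination -h
  · intro k m i
    have h := hd (.L m) (.G s k) (.G s (m + k - i)) (.I i)
    rw [actCoeff_L_apply_G_I, hL, map_add, actCoeff_single, actCoeff_single,
      show m + k - i - m = k - i by ring, show m + k - i = k - (i - m) by ring] at h
    rw [show m + k - i = k - (i - m) by ring]
    have e₁ : m + k = k - (i - m) ↔ i = 0 := by omega
    have e₂ : k = k - (i - m) ↔ i = m := by omega
    cases s <;> simp [nsBr, nsPar, sg, wt, Finsupp.single_apply] at h ⊢ <;>
      simp only [e₁, e₂, eq_comm (b := i)] at h ⊢ <;> split_ifs at h ⊢ <;>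
      linear_combination h

lemma coefficient_L_opposite_G
    (hd : ∀ x y u v, Finsupp.linearCombination ℂ (fun z => F z (u, v)) (nsBr x y) =
      actCoeff x u v (F y) - sg (nsPar y) (nsPar x) * actCoeff y u v (F x))
    (hI : ∀ n : ℤ, F (.I n) =
      Finsupp.single (.I 0, .I n) β + Finsupp.single (.I n, .I 0) β') (s : Bool) (k i j : ℤ) :
    F (.G s k) (.L i, .G (!s) j) = 0 := by
  have h := hd (.I 0) (.G s k) (.L i) (.G (!s) j)
  rw [actCoeff_I_apply_L_G, hI, map_add, actCoeff_single, actCoeff_single] at h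
  cases s <;> simp [nsBr, nsPar, sg, wt] at h ⊢ <;>
    first | linear_combination h / 2 | linear_combination -h / 2

lemma coefficient_opposite_G_L
    (hd : ∀ x y u v, Finsupp.linearCombination ℂ (fun z => F z (u, v)) (nsBr x y) =
      actCoeff x u v (F y) - sg (nsPar y) (nsPar x) * actCoeff y u v (F x))
    (hI : ∀ n : ℤ, F (.I n) =
      Finsupp.single (.I 0, .I n) β + Finsupp.single (.I n, .I 0) β') (s : Bool) (k i j : ℤ) :
    F (.G s k) (.G (!s) j, .L i) = 0 := by
  have h := hd (.I 0) (.G s k) (.G (!s) j) (.L i)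
  rw [actCoeff_I_apply_G_L, hI, map_add, actCoeff_single, actCoeff_single] at h
  cases s <;> simp [nsBr, nsPar, sg, wt] at h ⊢ <;>
    first | linear_combination h / 2 | linear_combination -h / 2

lemma coefficient_I_opposite_G
    (hd : ∀ x y u v, Finsupp.linearCombination ℂ (fun z => F z (u, v)) (nsBr x y) =
      actCoeff x u v (F y) - sg (nsPar y) (nsPar x) * actCoeff y u v (F x))
    (hI : ∀ n : ℤ, F (.I n) =
      Finsupp.single (.I 0, .I n) β + Finsupp.single (.I n, .I 0) β') (s : Bool) (k i j : ℤ) :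
    F (.G s k) (.I i, .G (!s) j) = 0 := by
  have h := hd (.I 0) (.G s k) (.I i) (.G (!s) j)
  rw [actCoeff_I_apply_I_G, hI, map_add, actCoeff_single, actCoeff_single] at h
  cases s <;> simp [nsBr, nsPar, sg, wt] at h ⊢ <;>
    first | linear_combination h / 2 | linear_combination -h / 2

lemma coefficient_opposite_G_I
    (hd : ∀ x y u v, Finsupp.linearCombination ℂ (fun z => F z (u, v)) (nsBr x y) =
      actCoeff x u v (F y) - sg (nsPar y) (nsPar x) * actCoeff y u v (F x))
    (hI : ∀ n : ℤ, F (.I n) =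
      Finsupp.single (.I 0, .I n) β + Finsupp.single (.I n, .I 0) β') (s : Bool) (k i j : ℤ) :
    F (.G s k) (.G (!s) j, .I i) = 0 := by
  have h := hd (.I 0) (.G s k) (.G (!s) j) (.I i)
  rw [actCoeff_I_apply_G_I, hI, map_add, actCoeff_single, actCoeff_single] at h
  cases s <;> simp [nsBr, nsPar, sg, wt] at h ⊢ <;>
    first | linear_combination h / 2 | linear_combination -h / 2

/-- The odd part of a degree-zero derivation is supported on `I_0 ⊗ G` and `G ⊗ I_0`. -/
lemma odd_part_eq
    (hd : ∀ x y u v, Finsupp.linearCombination ℂ (fun z => F z (u, v)) (nsBr x y) =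
      actCoeff x u v (F y) - sg (nsPar y) (nsPar x) * actCoeff y u v (F x))
    (hL : ∀ n : ℤ, F (.L n) =
      Finsupp.single (.I 0, .I n) (n * α + γ) + Finsupp.single (.I n, .I 0) (n * α' - γ))
    (hI : ∀ n : ℤ, F (.I n) =
      Finsupp.single (.I 0, .I n) β + Finsupp.single (.I n, .I 0) β')
    (hdeg : ∀ x p, F x p ≠ 0 → deg2 p.1 + deg2 p.2 = deg2 x) (s : Bool) (k : ℤ) :
    F (.G s k) = Finsupp.single (.I 0, .G s k) (F (.G s 0) (.I 0, .G s 0)) +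
      Finsupp.single (.G s k, .I 0) (F (.G s 0) (.G s 0, .I 0)) := by
  obtain ⟨-, hr, hr', hr₀⟩ := even_odd_coefficients_right hd hL hI s
  obtain ⟨-, hl, hl', hl₀⟩ := even_odd_coefficients_left hd hL hI s
  have hw : wt s ≠ 0 := by cases s <;> simp [wt]
  simp only [mul_eq_zero, hw, false_or] at hr hl
  simp only [sub_zero] at hr₀ hl₀
  have off : ∀ p, deg2 p.1 + deg2 p.2 ≠ deg2 (.G s k) → F (.G s k) p = 0 := fun p hp =>
    by_contra fun h => hp (hdeg _ p h)
  have sign : ∀ s' : Bool, s' = s ∨ s' = !s := by cases s <;> simp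
  ext ⟨u, v⟩
  rcases u with i | i | ⟨s₁, i⟩ <;> rcases v with j | j | ⟨s₂, j⟩
  · rw [off _ (by simp only [deg2]; omega)]; simp
  · rw [off _ (by simp only [deg2]; omega)]; simp
  · by_cases hj : j = k - i
    · rcases sign s₂ with rfl | rfl
      · subst hj; simp [hr]
      · simp [coefficient_L_opposite_G hd hI]
    · rw [off _ (by simp only [deg2]; omega)]; simp
  · rw [off _ (by simp only [deg2]; omega)]; simp
  · rw [off _ (by simp only [deg2]; omega)]; simp
  · by_cases hj : j = k - i
    · rcases sign s₂ with rfl | rfl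
      · subst hj
        rcases eq_or_ne i 0 with rfl | hi
        · simp [hr₀]
        · simp [hr' k i hi, hi.symm]
      · simp [coefficient_I_opposite_G hd hI]
    · rw [off _ (by simp only [deg2]; omega)]; simp [Finsupp.single_apply]; grind
  · by_cases hi : i = k - j
    · rcases sign s₁ with rfl | rfl
      · subst hi; simp [hl]
      · simp [coefficient_opposite_G_L hd hI]
    · rw [off _ (by simp only [deg2]; omega)]; simp
  · by_cases hi : i = k - j
    · rcases sign s₁ with rfl | rfl
      · subst hi
        rcases eq_or_ne j 0 with rfl | hj
        · simp [hl₀]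
        · simp [hl' k j hj, hj.symm]
      · simp [coefficient_opposite_G_I hd hI]
    · rw [off _ (by simp only [deg2]; omega)]; simp [Finsupp.single_apply]; grind
  · rw [off _ (by simp only [deg2]; omega)]; simp

end Constraints

/-- a degree-zero derivation `D : L → L⊗L` whose restriction to the even
part has the form `D(L_n) = (nα+γ)I_0⊗I_n + (nα†-γ)I_n⊗I_0`,
`D(I_n) = βI_0⊗I_n + β†I_n⊗I_0` must have `α = α† = γ = β = β† = 0`, and on the odd
part `D(G_r^±) = ±a(I_0⊗G_r^± + G_r^±⊗I_0)` for a single scalar `a`. -/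
theorem degree_zero_derivation_constraints (f : NSd.V →ₗ[ℂ] NSd.T2)
    (hder : NSd.IsDer2 0 f) (hdeg : HomogDeg 0 f)
    (α α' γ β β' : ℂ)
    (hL : ∀ n : ℤ, f (NSd.e (NSI.L n)) =
      ((n : ℂ) * α + γ) • Finsupp.single (NSI.I 0, NSI.I n) 1 +
        ((n : ℂ) * α' - γ) • Finsupp.single (NSI.I n, NSI.I 0) 1)
    (hI : ∀ n : ℤ, f (NSd.e (NSI.I n)) =
      β • Finsupp.single (NSI.I 0, NSI.I n) 1 +
        β' • Finsupp.single (NSI.I n, NSI.I 0) 1) :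
    α = 0 ∧ α' = 0 ∧ γ = 0 ∧ β = 0 ∧ β' = 0 ∧
      ∃ a : ℂ, ∀ k : ℤ,
        f (NSd.e (NSI.G true k)) =
          a • (Finsupp.single (NSI.I 0, NSI.G true k) 1 +
            Finsupp.single (NSI.G true k, NSI.I 0) 1) ∧
        f (NSd.e (NSI.G false k)) =
          (-a) • (Finsupp.single (NSI.I 0, NSI.G false k) 1 +
            Finsupp.single (NSI.G false k, NSI.I 0) 1) := by
  obtain ⟨F, hF⟩ : ∃ F : NSI → NSI × NSI →₀ ℂ, ∀ x, F x = f (NSd.e x) := ⟨_, fun _ => rfl⟩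
  have hd := der_coeff hder F hF
  have key (c : ℂ) (p : NSI × NSI) :
      (c • Finsupp.single p 1 : NSI × NSI →₀ ℂ) = Finsupp.single p c := by simp
  have hL' : ∀ n : ℤ, F (.L n) =
      Finsupp.single (.I 0, .I n) (n * α + γ) + Finsupp.single (.I n, .I 0) (n * α' - γ) :=
    fun n => (hF _).trans ((hL n).trans (congrArg₂ (· + ·) (key _ _) (key _ _)))
  have hI' : ∀ n : ℤ, F (.I n) =
      Finsupp.single (.I 0, .I n) β + Finsupp.single (.I n, .I 0) β' :=
    fun n => (hF _).trans ((hI n).trans (congrArg₂ (· + ·) (key _ _) (key _ _)))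
  have hdeg' : ∀ x p, F x p ≠ 0 → deg2 p.1 + deg2 p.2 = deg2 x := by
    intro x p hp
    rw [hF] at hp
    simpa using hdeg x p (Finsupp.mem_support_iff.mpr hp)
  obtain ⟨⟨hα, hα', hγ, hβ, hβ'⟩, -⟩ := even_odd_coefficients_right hd hL' hI' true
  simp only [wt, if_true, one_mul] at hα hα' hγ
  subst hα hα' hγ hβ hβ'
  obtain ⟨b, d, hG⟩ : ∃ b d : Bool → ℂ, ∀ s k, F (.G s k) =
      Finsupp.single (.I 0, .G s k) (b s) + Finsupp.single (.G s k, .I 0) (d s) :=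
    ⟨_, _, odd_part_eq hd hL' hI' hdeg'⟩
  have h₁ := hd (.G true 0) (.G false 0) (.I 0) (.L 1)
  have h₂ := hd (.G true 0) (.G false 0) (.L 1) (.I 0)
  have h₃ := hd (.G true 0) (.G false 0) (.G true 0) (.G false 0)
  rw [hG, hG] at h₁ h₂ h₃
  simp only [map_add, actCoeff_single] at h₁ h₂ h₃
  simp [nsBr, nsPar, sg, hL'] at h₁ h₂ h₃
  have combine (c : ℂ) (p q : NSI × NSI) :
      (Finsupp.single p c + Finsupp.single q c : NSI × NSI →₀ ℂ) =
        c • (Finsupp.single p 1 + Finsupp.single q 1) := by simp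
  have hb : b false = -b true := by linear_combination -h₁ / 2
  have hd₁ : d true = b true := by linear_combination h₃ + h₁ / 2
  have hd₀ : d false = -b true := by linear_combination -h₂ / 2 - hd₁
  refine ⟨rfl, rfl, rfl, rfl, rfl, b true, fun k => ⟨?_, ?_⟩⟩
  · refine (hF _).symm.trans ((hG _ _).trans ?_)
    rw [hd₁]
    exact combine _ _ _
  · refine (hF _).symm.trans ((hG _ _).trans ?_)
    rw [hb, hd₀]
    exact combine _ _ _
end
end
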